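/- Let φ and ψ be tuples of real polynomials in N variables arising from the critical-point reformulation (4.1) of the saddle point problem, let F be the objective polynomial, and set d_0 := ⌈max(deg φ, deg ψ)/2⌉. Assume IQ(φ,ψ) := Ideal(φ) + Qmod(ψ) is archimedean. Suppose the problem min F(z) subject to φ(z) = 0, ψ(z) ≥ 0 is feasible, has finitely many minimizers, and each of its minimizers is an isolated real solution of the equation φ(z) = 0. Then for all k big enough: the order-k moment relaxation min { R_w(F) : w_0 = 1, M_k(w) ⪰ 0, L_φ^{(k)}(w) = 0, L_ψ^{(k)}(w) ⪰ 0 } attains a minimizer, and every minimizer w* satisfies the flat truncation rank condition: there exists t with d_0 ≤ t ≤ k such that rank M_t(w*) = rank M_{t−d_0}(w*). -/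

import Mathlib

open MvPolynomial

noncomputable section

/-- Index set for rows/columns of moment and localizing matrices:
(exponent vectors of) monomials in the variables `σ` of degree at most `t`. -/
abbrev MomIdx (σ : Type) [Fintype σ] [DecidableEq σ] (t : ℕ) : Type :=
  {v : σ → Fin (t + 1) // ∑ i, (v i : ℕ) ≤ t}

/-- The exponent vector of a moment-matrix index. -/
def MomIdx.exp {σ : Type} [Fintype σ] [DecidableEq σ] {t : ℕ} (v : MomIdx σ t) : σ →₀ ℕ :=
  Finsupp.equivFunOnFinite.symm fun i => (v.1 i : ℕ)

/-- The Riesz functional of a (truncated) multi-sequence `w`, acting on a polynomial: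
`R_w (Σ f_α ξ^α) = Σ f_α w_α`. -/
def riesz {σ : Type} (w : (σ →₀ ℕ) → ℝ) (f : MvPolynomial σ ℝ) : ℝ :=
  ∑ α ∈ f.support, f.coeff α * w α

/-- The order-`k` localizing matrix `L_q^{(k)}(w)` of the polynomial `q`, generated by
`w`: rows and columns are indexed by monomials of degree `≤ k − ⌈deg(q)/2⌉`, and the
`(α, β)` entry is `R_w(q · ξ^α · ξ^β)`. -/
def locMat {σ : Type} [Fintype σ] [DecidableEq σ] (k : ℕ) (q : MvPolynomial σ ℝ)
    (w : (σ →₀ ℕ) → ℝ) :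
    Matrix (MomIdx σ (k - (q.totalDegree + 1) / 2)) (MomIdx σ (k - (q.totalDegree + 1) / 2)) ℝ :=
  Matrix.of fun a b => riesz w (q * monomial (a.exp + b.exp) 1)

/-- The order-`t` moment matrix `M_t(w)` generated by `w`. -/
def momMat {σ : Type} [Fintype σ] [DecidableEq σ] (t : ℕ) (w : (σ →₀ ℕ) → ℝ) :
    Matrix (MomIdx σ t) (MomIdx σ t) ℝ :=
  Matrix.of fun a b => w (a.exp + b.exp)

/-- Feasibility for the order-`k` Lasserre moment relaxation with equality
constraints `φ` and inequality constraints `ψ`: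
`w₀ = 1`, `M_k(w) ⪰ 0`, `L_φ^{(k)}(w) = 0` and `L_ψ^{(k)}(w) ⪰ 0`. -/
def RelaxFeasible {σ : Type} [Fintype σ] [DecidableEq σ] {ι κ : Type*} (k : ℕ)
    (φ : ι → MvPolynomial σ ℝ) (ψ : κ → MvPolynomial σ ℝ) (w : (σ →₀ ℕ) → ℝ) : Prop :=
  w 0 = 1 ∧ (momMat k w).PosSemidef ∧ (∀ i, locMat k (φ i) w = 0) ∧
    ∀ j, (locMat k (ψ j) w).PosSemidef

/-- A sum of squares of polynomials. -/
def IsSOS {σ : Type} (p : MvPolynomial σ ℝ) : Prop :=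
  ∃ (t : ℕ) (s : Fin t → MvPolynomial σ ℝ), p = ∑ i, s i ^ 2


/-- Membership in `IQ(φ,ψ) = Ideal(φ) + Qmod(ψ)`. -/
def InIQ {σ : Type} {ι κ : Type*} [Fintype ι] [Fintype κ]
    (φ : ι → MvPolynomial σ ℝ) (ψ : κ → MvPolynomial σ ℝ) (f : MvPolynomial σ ℝ) : Prop :=
  ∃ (p : ι → MvPolynomial σ ℝ) (σ0 : MvPolynomial σ ℝ) (σs : κ → MvPolynomial σ ℝ),
    IsSOS σ0 ∧ (∀ j, IsSOS (σs j)) ∧ f = ∑ i, φ i * p i + σ0 + ∑ j, ψ j * σs j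

/-- `IQ(φ,ψ)` is archimedean: it contains some `σ` whose nonnegativity set is compact. -/
def IsArchimedean {σ : Type} [Fintype σ] {ι κ : Type*} [Fintype ι] [Fintype κ]
    (φ : ι → MvPolynomial σ ℝ) (ψ : κ → MvPolynomial σ ℝ) : Prop :=
  ∃ σ0 : MvPolynomial σ ℝ, InIQ φ ψ σ0 ∧ IsCompact {z : σ → ℝ | 0 ≤ eval z σ0}

/-- The matrix `G(x)` associated with a tuple `g` of constraining polynomials:
its `i`-th column is `(∇g_i(x); g_i(x)·e_i)`. -/
def Gmat {n l : ℕ} (g : Fin l → MvPolynomial (Fin n) ℝ) (x : Fin n → ℝ) :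
    Matrix (Fin n ⊕ Fin l) (Fin l) ℝ :=
  Matrix.of fun r c =>
    match r with
    | Sum.inl i => eval x (pderiv i (g c))
    | Sum.inr i => if i = c then eval x (g c) else 0

/-- The Lagrange polynomial tuple `λ(x,y) := G₁(x)_{:,1:n} ∇ₓ F(x,y)`. -/
def lagX {n m l1 : ℕ} (G1 : Matrix (Fin l1) (Fin n ⊕ Fin l1) (MvPolynomial (Fin n) ℝ))
    (F : MvPolynomial (Fin n ⊕ Fin m) ℝ) (i : Fin l1) : MvPolynomial (Fin n ⊕ Fin m) ℝ :=
  ∑ j : Fin n, rename Sum.inl (G1 i (Sum.inl j)) * pderiv (Sum.inl j) F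

/-- The Lagrange polynomial tuple `μ(x,y) := H₁(y)_{:,1:m} ∇_y F(x,y)`. -/
def lagY {n m l2 : ℕ} (H1 : Matrix (Fin l2) (Fin m ⊕ Fin l2) (MvPolynomial (Fin m) ℝ))
    (F : MvPolynomial (Fin n ⊕ Fin m) ℝ) (j : Fin l2) : MvPolynomial (Fin n ⊕ Fin m) ℝ :=
  ∑ j' : Fin m, rename Sum.inr (H1 j (Sum.inl j')) * pderiv (Sum.inr j') F

/-- The tuple `φ` of equality constraining polynomials (4.2) of the critical-point
reformulation (4.1): the entries of `∇ₓF − Σᵢ λᵢ(x,y)∇ₓgᵢ` and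
`∇_yF − Σⱼ μⱼ(x,y)∇_yhⱼ`, together with `gᵢ (i ∈ E1X)`, `hⱼ (j ∈ E1Y)`,
`λᵢ(x,y)·gᵢ (i ∈ E2X)` and `μⱼ(x,y)·hⱼ (j ∈ E2Y)`. -/
def phiTop {n m l1 l2 : ℕ} (E1X E2X : Finset (Fin l1)) (E1Y E2Y : Finset (Fin l2))
    (g : Fin l1 → MvPolynomial (Fin n) ℝ) (h : Fin l2 → MvPolynomial (Fin m) ℝ)
    (G1 : Matrix (Fin l1) (Fin n ⊕ Fin l1) (MvPolynomial (Fin n) ℝ))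
    (H1 : Matrix (Fin l2) (Fin m ⊕ Fin l2) (MvPolynomial (Fin m) ℝ))
    (F : MvPolynomial (Fin n ⊕ Fin m) ℝ) :
    (Fin n ⊕ Fin m) ⊕ ((↥E1X ⊕ ↥E1Y) ⊕ (↥E2X ⊕ ↥E2Y)) → MvPolynomial (Fin n ⊕ Fin m) ℝ
  | Sum.inl (Sum.inl j) =>
      pderiv (Sum.inl j) F - ∑ i, lagX G1 F i * rename Sum.inl (pderiv j (g i))
  | Sum.inl (Sum.inr j') =>
      pderiv (Sum.inr j') F - ∑ j, lagY H1 F j * rename Sum.inr (pderiv j' (h j))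
  | Sum.inr (Sum.inl (Sum.inl i)) => rename Sum.inl (g i.1)
  | Sum.inr (Sum.inl (Sum.inr j)) => rename Sum.inr (h j.1)
  | Sum.inr (Sum.inr (Sum.inl i)) => lagX G1 F i.1 * rename Sum.inl (g i.1)
  | Sum.inr (Sum.inr (Sum.inr j)) => lagY H1 F j.1 * rename Sum.inr (h j.1)

/-- The tuple `ψ` of inequality constraining polynomials (4.3) of the critical-point
reformulation (4.1): `gᵢ, λᵢ(x,y) (i ∈ E2X)`, `hⱼ, −μⱼ(x,y) (j ∈ E2Y)`, together with
`F(u,y) − F(x,y) (u ∈ K₁)` and `F(x,y) − F(x,v) (v ∈ K₂)`. -/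
def psiTop {n m l1 l2 : ℕ} (E2X : Finset (Fin l1)) (E2Y : Finset (Fin l2))
    (K1 : Finset (Fin n → ℝ)) (K2 : Finset (Fin m → ℝ))
    (g : Fin l1 → MvPolynomial (Fin n) ℝ) (h : Fin l2 → MvPolynomial (Fin m) ℝ)
    (G1 : Matrix (Fin l1) (Fin n ⊕ Fin l1) (MvPolynomial (Fin n) ℝ))
    (H1 : Matrix (Fin l2) (Fin m ⊕ Fin l2) (MvPolynomial (Fin m) ℝ))
    (F : MvPolynomial (Fin n ⊕ Fin m) ℝ) :
    ((↥E2X ⊕ ↥E2Y) ⊕ (↥E2X ⊕ ↥E2Y)) ⊕ (↥K1 ⊕ ↥K2) → MvPolynomial (Fin n ⊕ Fin m) ℝ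
  | Sum.inl (Sum.inl (Sum.inl i)) => rename Sum.inl (g i.1)
  | Sum.inl (Sum.inl (Sum.inr j)) => rename Sum.inr (h j.1)
  | Sum.inl (Sum.inr (Sum.inl i)) => lagX G1 F i.1
  | Sum.inl (Sum.inr (Sum.inr j)) => -lagY H1 F j.1
  | Sum.inr (Sum.inl u) =>
      aeval (Sum.elim (fun i => (C (u.1 i) : MvPolynomial (Fin n ⊕ Fin m) ℝ))
        fun j => X (Sum.inr j)) F - F
  | Sum.inr (Sum.inr v) =>
      F - aeval (Sum.elim (fun i => (X (Sum.inl i) : MvPolynomial (Fin n ⊕ Fin m) ℝ))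
        fun j => C (v.1 j)) F

/-- `d₀ = ⌈max(deg φ, deg ψ)/2⌉`. -/
def dTop {n m l1 l2 : ℕ} (E1X E2X : Finset (Fin l1)) (E1Y E2Y : Finset (Fin l2))
    (K1 : Finset (Fin n → ℝ)) (K2 : Finset (Fin m → ℝ))
    (g : Fin l1 → MvPolynomial (Fin n) ℝ) (h : Fin l2 → MvPolynomial (Fin m) ℝ)
    (G1 : Matrix (Fin l1) (Fin n ⊕ Fin l1) (MvPolynomial (Fin n) ℝ))
    (H1 : Matrix (Fin l2) (Fin m ⊕ Fin l2) (MvPolynomial (Fin m) ℝ))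
    (F : MvPolynomial (Fin n ⊕ Fin m) ℝ) : ℕ :=
  (((Finset.univ.sup fun idx => (phiTop E1X E2X E1Y E2Y g h G1 H1 F idx).totalDegree) ⊔
    (Finset.univ.sup fun idx => (psiTop E2X E2Y K1 K2 g h G1 H1 F idx).totalDegree)) + 1) / 2

/-- A total positive cone on a subfield of `Ω`: the subfield is `P ∪ -P`. -/
structure FieldCone {Ω : Type*} [Field Ω] (P : Set Ω) : Prop where
  one_mem : 1 ∈ P
  add_mem : ∀ {x y}, x ∈ P → y ∈ P → x + y ∈ P
  mul_mem : ∀ {x y}, x ∈ P → y ∈ P → x * y ∈ P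
  inv_mem : ∀ {x}, x ∈ P → x⁻¹ ∈ P
  eq_zero : ∀ {x}, x ∈ P → -x ∈ P → x = 0
  total : ∀ {x y}, x ∈ P → y ∈ P → x - y ∈ P ∨ y - x ∈ P

section PrimeCone

variable {A : Type*} [CommRing A]

/-- The semiring `T + a T`, for `T` containing all squares. -/
def Subsemiring.adjoinElem (T : Subsemiring A) (hsq : ∀ a, a * a ∈ T) (a : A) :
    Subsemiring A where
  carrier := {z | ∃ x ∈ T, ∃ y ∈ T, z = x + a * y}
  zero_mem' := ⟨0, T.zero_mem, 0, T.zero_mem, by simp⟩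
  one_mem' := ⟨1, T.one_mem, 0, T.zero_mem, by simp⟩
  add_mem' := by
    rintro _ _ ⟨x, hx, y, hy, rfl⟩ ⟨x', hx', y', hy', rfl⟩
    exact ⟨x + x', T.add_mem hx hx', y + y', T.add_mem hy hy', by ring⟩
  mul_mem' := by
    rintro _ _ ⟨x, hx, y, hy, rfl⟩ ⟨x', hx', y', hy', rfl⟩
    exact ⟨x * x' + a * a * (y * y'),
      T.add_mem (T.mul_mem hx hx') (T.mul_mem (hsq a) (T.mul_mem hy hy')),
      x * y' + y * x', T.add_mem (T.mul_mem hx hy') (T.mul_mem hy hx'), by ring⟩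

lemma exists_maximal_subsemiring (T : Subsemiring A) (p : A) (hp : ∀ l : ℕ, -p ^ (2 * l) ∉ T) :
    ∃ P : Subsemiring A, T ≤ P ∧
      Maximal (fun Q : Subsemiring A => ∀ l : ℕ, -p ^ (2 * l) ∉ Q) P := by
  refine zorn_le_nonempty₀ {Q : Subsemiring A | ∀ l : ℕ, -p ^ (2 * l) ∉ Q} ?_ T hp
  intro c hc hchain y hy
  refine ⟨sSup c, ?_, fun z hz => le_sSup hz⟩
  intro l hl
  rw [Subsemiring.mem_sSup_of_directedOn ⟨y, hy⟩ hchain.directedOn] at hl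
  obtain ⟨Q, hQ, hlQ⟩ := hl
  exact hc hQ l hlQ

variable {P : Subsemiring A} {p : A}

lemma exists_of_notMem_maximal (hsq : ∀ a, a * a ∈ P)
    (hP : Maximal (fun Q : Subsemiring A => ∀ l : ℕ, -p ^ (2 * l) ∉ Q) P) {a : A} (ha : a ∉ P) :
    ∃ l : ℕ, ∃ x ∈ P, ∃ y ∈ P, -p ^ (2 * l) = x + a * y := by
  by_contra! hcon
  have hle : P ≤ P.adjoinElem hsq a := fun x hx => ⟨x, hx, 0, P.zero_mem, by simp⟩
  have hmem : a ∈ P.adjoinElem hsq a := ⟨0, P.zero_mem, 1, P.one_mem, by simp⟩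
  refine ha (hP.2 (y := P.adjoinElem hsq a) ?_ hle hmem)
  rintro l ⟨x, hx, y, hy, h⟩
  exact hcon l x hx y hy h

lemma pow_two_mul_mem (hsq : ∀ a, a * a ∈ P) (p : A) (l : ℕ) : p ^ (2 * l) ∈ P := by
  have := hsq (p ^ l)
  rwa [← pow_add, ← two_mul] at this

lemma mem_or_neg_mem_of_maximal (hsq : ∀ a, a * a ∈ P)
    (hP : Maximal (fun Q : Subsemiring A => ∀ l : ℕ, -p ^ (2 * l) ∉ Q) P) (a : A) :
    a ∈ P ∨ -a ∈ P := by
  by_contra! hcon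
  obtain ⟨l, x, hx, y, hy, h1⟩ := exists_of_notMem_maximal hsq hP hcon.1
  obtain ⟨m, x', hx', y', hy', h2⟩ := exists_of_notMem_maximal hsq hP hcon.2
  refine hP.1 (l + m) ?_
  have : -p ^ (2 * (l + m)) = p ^ (2 * l) * x' + p ^ (2 * m) * x + x * x' + a * a * (y * y') := by
    have e1 : a * y = -p ^ (2 * l) - x := by rw [h1]; ring
    have e2 : a * y' = p ^ (2 * m) + x' := by linear_combination h2
    have e3 : a * a * (y * y') = (a * y) * (a * y') := by ring
    rw [e3, e1, e2]; ring
  rw [this]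
  exact P.add_mem (P.add_mem (P.add_mem (P.mul_mem (pow_two_mul_mem hsq p l) hx')
    (P.mul_mem (pow_two_mul_mem hsq p m) hx)) (P.mul_mem hx hx'))
    (P.mul_mem (hsq a) (P.mul_mem hy hy'))

/-- The support `P ∩ -P` of a total semiring cone. -/
def Subsemiring.supportIdeal (P : Subsemiring A) (htot : ∀ a, a ∈ P ∨ -a ∈ P) : Ideal A where
  carrier := {a | a ∈ P ∧ -a ∈ P}
  zero_mem' := by simp [P.zero_mem]
  add_mem' := by
    rintro a b ⟨ha, ha'⟩ ⟨hb, hb'⟩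
    refine ⟨P.add_mem ha hb, ?_⟩
    rw [neg_add]; exact P.add_mem ha' hb'
  smul_mem' := by
    rintro c a ⟨ha, ha'⟩
    simp only [smul_eq_mul, Set.mem_ofPred_eq]
    rcases htot c with hc | hc
    · refine ⟨P.mul_mem hc ha, ?_⟩
      rw [← mul_neg]; exact P.mul_mem hc ha'
    · refine ⟨?_, ?_⟩
      · rw [← neg_mul_neg]; exact P.mul_mem hc ha'
      · rw [← neg_mul]; exact P.mul_mem hc ha

lemma supportIdeal_isPrime (hsq : ∀ a, a * a ∈ P)
    (hP : Maximal (fun Q : Subsemiring A => ∀ l : ℕ, -p ^ (2 * l) ∉ Q) P)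
    (htot : ∀ a, a ∈ P ∨ -a ∈ P) : (P.supportIdeal htot).IsPrime := by
  have key : ∀ a b : A, -a ∉ P → -b ∉ P → -(a * b) ∉ P := by
    intro a b ha hb hab
    obtain ⟨l, x, hx, y, hy, h1⟩ := exists_of_notMem_maximal hsq hP ha
    obtain ⟨m, x', hx', y', hy', h2⟩ := exists_of_notMem_maximal hsq hP hb
    refine hP.1 (l + m) ?_
    have : -p ^ (2 * (l + m)) =
        p ^ (2 * l) * x' + p ^ (2 * m) * x + x * x' + -(a * b) * (y * y') := by
      have e1 : a * y = p ^ (2 * l) + x := by linear_combination h1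
      have e2 : b * y' = p ^ (2 * m) + x' := by linear_combination h2
      have e3 : -(a * b) * (y * y') = -((a * y) * (b * y')) := by ring
      rw [e3, e1, e2]; ring
    rw [this]
    exact P.add_mem (P.add_mem (P.add_mem (P.mul_mem (pow_two_mul_mem hsq p l) hx')
      (P.mul_mem (pow_two_mul_mem hsq p m) hx)) (P.mul_mem hx hx'))
      (P.mul_mem hab (P.mul_mem hy hy'))
  refine ⟨?_, ?_⟩
  · intro h
    have h1 : (1 : A) ∈ P.supportIdeal htot := by rw [h]; trivial
    exact hP.1 0 (by simpa using h1.2)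
  · rintro a b ⟨hab, hab'⟩
    by_contra! hcon
    obtain ⟨ha, hb⟩ := hcon
    have ha : a ∉ P ∨ -a ∉ P := by
      by_contra! h; exact ha h
    have hb : b ∉ P ∨ -b ∉ P := by
      by_contra! h; exact hb h
    rcases ha with ha | ha <;> rcases hb with hb | hb
    · exact key (-a) (-b) (by simpa using ha) (by simpa using hb) (by simpa using hab')
    · exact key (-a) b (by simpa using ha) hb (by simpa using hab)
    · exact key a (-b) ha (by simpa using hb) (by simpa using hab)
    · exact key a b ha hb hab'

lemma fieldCone_of_total {Ω : Type*} [Field Ω] (ι : A →+* Ω) (hsq : ∀ a, a * a ∈ P)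
    (htot : ∀ a, a ∈ P ∨ -a ∈ P) (hι : ∀ a, ι a = 0 ↔ a ∈ P ∧ -a ∈ P) :
    FieldCone {x : Ω | ∃ a ∈ P, ∃ b, ι b ≠ 0 ∧ x = ι a / ι b ^ 2} where
  one_mem := ⟨1, P.one_mem, 1, by simp, by simp⟩
  add_mem := by
    rintro _ _ ⟨a, ha, b, hb, rfl⟩ ⟨a', ha', b', hb', rfl⟩
    refine ⟨a * (b' * b') + a' * (b * b), P.add_mem (P.mul_mem ha (hsq _))
      (P.mul_mem ha' (hsq _)), b * b', by simp [hb, hb'], ?_⟩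
    simp only [map_add, map_mul]
    field_simp
  mul_mem := by
    rintro _ _ ⟨a, ha, b, hb, rfl⟩ ⟨a', ha', b', hb', rfl⟩
    refine ⟨a * a', P.mul_mem ha ha', b * b', by simp [hb, hb'], ?_⟩
    simp only [map_mul]
    field_simp
  inv_mem := by
    rintro _ ⟨a, ha, b, hb, rfl⟩
    by_cases h : ι a = 0
    · exact ⟨0, P.zero_mem, 1, by simp, by simp [h]⟩
    · refine ⟨a * (b * b), P.mul_mem ha (hsq _), a, h, ?_⟩
      simp only [map_mul]
      field_simp
  eq_zero := by
    rintro _ ⟨a, ha, b, hb, rfl⟩ ⟨a', ha', b', hb', h⟩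
    have h0 : ι (a * (b' * b') + a' * (b * b)) = 0 := by
      simp only [map_add, map_mul]
      field_simp at h
      linear_combination -h
    have h1 := ((hι _).1 h0).2
    have h2 : ι (a * (b' * b')) = 0 := by
      refine (hι _).2 ⟨P.mul_mem ha (hsq _), ?_⟩
      have := P.add_mem h1 (P.mul_mem ha' (hsq b))
      convert this using 1; ring
    have h3 : ι a = 0 := by simpa [hb'] using h2
    simp [h3]
  total := by
    rintro _ _ ⟨a, ha, b, hb, rfl⟩ ⟨a', ha', b', hb', rfl⟩
    rcases htot (a * (b' * b') - a' * (b * b)) with h | h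
    · refine Or.inl ⟨_, h, b * b', by simp [hb, hb'], ?_⟩
      simp only [map_sub, map_mul]
      field_simp
    · refine Or.inr ⟨_, h, b * b', by simp [hb, hb'], ?_⟩
      simp only [map_sub, map_mul, map_neg]
      field_simp
      ring

end PrimeCone

namespace FieldCone

variable {Ω : Type*} [Field Ω] {P : Set Ω}

lemma zero_mem (h : FieldCone P) : (0 : Ω) ∈ P := by
  simpa using h.total h.one_mem h.one_mem

/-- The subfield `P ∪ -P`. -/
def toSubfield (h : FieldCone P) : Subfield Ω where
  carrier := {x | x ∈ P ∨ -x ∈ P}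
  zero_mem' := Or.inl h.zero_mem
  one_mem' := Or.inl h.one_mem
  neg_mem' := by rintro x (hx | hx) <;> simp [hx]
  add_mem' := by
    rintro x y (hx | hx) (hy | hy)
    · exact Or.inl (h.add_mem hx hy)
    · rcases h.total hx hy with h1 | h1
      · left; simpa using h1
      · right; convert h1 using 1; ring
    · rcases h.total hy hx with h1 | h1
      · left; convert h1 using 1; ring
      · right; convert h1 using 1; ring
    · right; rw [neg_add]; exact h.add_mem hx hy
  mul_mem' := by
    rintro x y (hx | hx) (hy | hy)
    · exact Or.inl (h.mul_mem hx hy)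
    · right; rw [← mul_neg]; exact h.mul_mem hx hy
    · right; rw [← neg_mul]; exact h.mul_mem hx hy
    · left; rw [← neg_mul_neg]; exact h.mul_mem hx hy
  inv_mem' := by
    rintro x (hx | hx)
    · exact Or.inl (h.inv_mem hx)
    · right; rw [← inv_neg]; exact h.inv_mem hx

lemma mem_toSubfield (h : FieldCone P) {x : Ω} : x ∈ h.toSubfield ↔ x ∈ P ∨ -x ∈ P := Iff.rfl

/-- The order on `P ∪ -P` whose nonnegative elements are those of `P`. -/
abbrev linearOrder (h : FieldCone P) : LinearOrder h.toSubfield where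
  le x y := (y - x : Ω) ∈ P
  le_refl x := by simpa using h.zero_mem
  le_trans x y z hxy hyz := by simpa using h.add_mem hyz hxy
  le_antisymm x y hxy hyx := by
    have := h.eq_zero hxy (by simpa using hyx)
    exact Subtype.ext (sub_eq_zero.1 this).symm
  le_total x y := by
    have := (y - x).2
    simpa [mem_toSubfield] using this
  toDecidableLE := Classical.decRel _

lemma isStrictOrderedRing (h : FieldCone P) :
    letI := h.linearOrder
    IsStrictOrderedRing h.toSubfield := by
  let := h.linearOrder
  have hle : ∀ x y : h.toSubfield, x ≤ y ↔ (y - x : Ω) ∈ P := fun x y => Iff.rfl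
  have : IsOrderedAddMonoid h.toSubfield := ⟨fun a b hab c => by
    rw [hle] at hab ⊢
    simpa using hab, fun a b hab c => by
    rw [hle] at hab ⊢
    simpa using hab⟩
  have : ZeroLEOneClass h.toSubfield := ⟨by rw [hle]; simpa using h.one_mem⟩
  refine IsStrictOrderedRing.of_mul_pos fun a b ha hb => ?_
  refine lt_of_le_of_ne ?_ (mul_ne_zero ha.ne' hb.ne').symm
  have ha := ha.le
  have hb := hb.le
  rw [hle] at *
  simpa using h.mul_mem ha hb

lemma exists_maximal {P : Set Ω} (hP : FieldCone P) :
    ∃ Q : Set Ω, P ⊆ Q ∧ Maximal FieldCone Q := by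
  refine zorn_subset_nonempty {Q : Set Ω | FieldCone Q} ?_ P hP
  intro c hc hchain ⟨y, hy⟩
  have two : ∀ {u v : Ω}, u ∈ ⋃₀ c → v ∈ ⋃₀ c → ∃ Q ∈ c, u ∈ Q ∧ v ∈ Q := by
    rintro u v ⟨Q, hQ, hu⟩ ⟨Q', hQ', hv⟩
    rcases hchain.total hQ hQ' with h | h
    · exact ⟨Q', hQ', h hu, hv⟩
    · exact ⟨Q, hQ, hu, h hv⟩
  refine ⟨⋃₀ c, ⟨⟨y, hy, (hc hy).one_mem⟩, ?_, ?_, ?_, ?_, ?_⟩,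
    fun s hs => Set.subset_sUnion_of_mem hs⟩
  · intro u v hu hv
    obtain ⟨Q, hQ, hu, hv⟩ := two hu hv
    exact ⟨Q, hQ, (hc hQ).add_mem hu hv⟩
  · intro u v hu hv
    obtain ⟨Q, hQ, hu, hv⟩ := two hu hv
    exact ⟨Q, hQ, (hc hQ).mul_mem hu hv⟩
  · rintro u ⟨Q, hQ, hu⟩
    exact ⟨Q, hQ, (hc hQ).inv_mem hu⟩
  · intro u hu hv
    obtain ⟨Q, hQ, hu, hv⟩ := two hu hv
    exact (hc hQ).eq_zero hu hv
  · intro u v hu hv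
    obtain ⟨Q, hQ, hu, hv⟩ := two hu hv
    rcases (hc hQ).total hu hv with h | h
    · exact Or.inl ⟨Q, hQ, h⟩
    · exact Or.inr ⟨Q, hQ, h⟩

end FieldCone

section PolyIVT

variable {R : Type*} [Field R] [LinearOrder R] [IsStrictOrderedRing R]

/-- The intermediate value property for polynomials of degree less than `d`. -/
def PolyIVT (R : Type*) [Field R] [LinearOrder R] (d : ℕ) : Prop :=
  ∀ f : Polynomial R, f.natDegree < d → ∀ a b : R, a < b → f.eval a < 0 → 0 < f.eval b →
    ∃ c, a < c ∧ c < b ∧ f.eval c = 0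

lemma PolyIVT.mul_pos {d : ℕ} (hR : PolyIVT R d) {f : Polynomial R} (hf : f.natDegree < d)
    {a b : R} (hab : a ≤ b) (h : ∀ c, a ≤ c → c ≤ b → f.eval c ≠ 0) :
    0 < f.eval a * f.eval b := by
  have ha := h a le_rfl hab
  have hb := h b hab le_rfl
  rcases hab.eq_or_lt with rfl | hab
  · exact mul_self_pos.2 ha
  rcases lt_or_gt_of_ne ha with ha' | ha' <;> rcases lt_or_gt_of_ne hb with hb' | hb'
  · exact mul_pos_of_neg_of_neg ha' hb'
  · obtain ⟨c, hc1, hc2, hc⟩ := hR f hf a b hab ha' hb'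
    exact absurd hc (h c hc1.le hc2.le)
  · obtain ⟨c, hc1, hc2, hc⟩ := hR (-f) (by simpa using hf) a b hab (by simpa using ha')
      (by simpa using hb')
    exact absurd (by simpa using hc) (h c hc1.le hc2.le)
  · exact _root_.mul_pos ha' hb'

lemma PolyIVT.exists_root {d : ℕ} (hR : PolyIVT R d) {f : Polynomial R} (hf : f.natDegree < d)
    {a b : R} (hab : a < b) (h : f.eval a * f.eval b < 0) :
    ∃ c, a < c ∧ c < b ∧ f.eval c = 0 := by
  by_contra! hcon
  refine (hR.mul_pos hf hab.le fun c h1 h2 hc => ?_).not_gt h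
  rcases h1.eq_or_lt with rfl | h1
  · simp [hc] at h
  rcases h2.eq_or_lt with rfl | h2
  · simp [hc] at h
  exact hcon c h1 h2 hc

lemma PolyIVT.rolle (hR : ∀ d, PolyIVT R d) {f : Polynomial R} {a b : R} (hab : a < b)
    (ha : f.eval a = 0) (hb : f.eval b = 0) :
    ∃ c, a < c ∧ c < b ∧ f.derivative.eval c = 0 := by
  rcases eq_or_ne f 0 with rfl | hf
  · obtain ⟨c, hc1, hc2⟩ := exists_between hab
    exact ⟨c, hc1, hc2, by simp⟩
  -- replace `b` by the least root above `a`
  wlog hmin : ∀ c, a < c → c < b → f.eval c ≠ 0 generalizing b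
  · have hne : (f.roots.toFinset.filter fun c => a < c).Nonempty :=
      ⟨b, by simp [hf, hab, hb]⟩
    set b' := (f.roots.toFinset.filter fun c => a < c).min' hne
    have hb' : b' ∈ f.roots.toFinset.filter fun c => a < c := Finset.min'_mem _ _
    have hle : ∀ c, a < c → f.eval c = 0 → b' ≤ c := fun c h1 h2 =>
      Finset.min'_le _ _ (by simp [hf, h1, h2])
    simp only [Finset.mem_filter, Multiset.mem_toFinset, Polynomial.mem_roots', ne_eq, hf,
      not_false_eq_true, Polynomial.IsRoot.def, true_and] at hb'
    obtain ⟨c, h1, h2, h3⟩ := this hb'.2 hb'.1 fun c h1 h2 h3 => (hle c h1 h3).not_gt h2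
    exact ⟨c, h1, h2.trans_le (hle b hab hb), h3⟩
  obtain ⟨f1, hf1, hf1a⟩ := Polynomial.exists_eq_pow_rootMultiplicity_mul_and_not_dvd f hf a
  have hf10 : f1 ≠ 0 := by rintro rfl; exact hf1a (dvd_zero _)
  obtain ⟨g, hg, hgb⟩ := Polynomial.exists_eq_pow_rootMultiplicity_mul_and_not_dvd f1 hf10 b
  have hm : 0 < f.rootMultiplicity a := (Polynomial.rootMultiplicity_pos hf).2 ha
  have hf1b : f1.eval b = 0 := by
    have := hb
    rw [hf1] at this
    simpa [sub_eq_zero, hab.ne'] using this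
  have hn : 0 < f1.rootMultiplicity b := (Polynomial.rootMultiplicity_pos hf10).2 hf1b
  obtain ⟨m, hm⟩ := Nat.exists_eq_succ_of_ne_zero hm.ne'
  obtain ⟨n, hn⟩ := Nat.exists_eq_succ_of_ne_zero hn.ne'
  rw [hm] at hf1
  rw [hn] at hg
  have hfg : f = (Polynomial.X - Polynomial.C a) ^ (m + 1) *
      ((Polynomial.X - Polynomial.C b) ^ (n + 1) * g) := by rw [hf1, hg]
  rw [Polynomial.dvd_iff_isRoot, Polynomial.IsRoot.def] at hgb hf1a
  have hgne : ∀ c, a ≤ c → c ≤ b → g.eval c ≠ 0 := by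
    intro c h1 h2 hc
    rcases h2.eq_or_lt with rfl | h2
    · exact hgb hc
    rcases h1.eq_or_lt with rfl | h1
    · exact hf1a (by rw [hg]; simp [hc])
    · exact hmin c h1 h2 (by rw [hfg]; simp [hc])
  have hgpos : 0 < g.eval a * g.eval b :=
    (hR (g.natDegree + 1)).mul_pos (Nat.lt_succ_self _) hab.le hgne
  set h : Polynomial R := Polynomial.C (m + 1 : R) * (Polynomial.X - Polynomial.C b) * g +
    Polynomial.C (n + 1 : R) * (Polynomial.X - Polynomial.C a) * g +
    (Polynomial.X - Polynomial.C a) * (Polynomial.X - Polynomial.C b) * g.derivative with hh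
  have hder : f.derivative = (Polynomial.X - Polynomial.C a) ^ m *
      (Polynomial.X - Polynomial.C b) ^ n * h := by
    rw [hfg, hh]
    simp only [Polynomial.derivative_mul, Polynomial.derivative_X_sub_C_pow,
      Polynomial.C_add, Polynomial.C_1, map_natCast]
    push_cast
    ring
  have hm0 : (0 : R) < m + 1 := by positivity
  have hn0 : (0 : R) < n + 1 := by positivity
  have hval : h.eval a * h.eval b < 0 := by
    have : h.eval a * h.eval b =
        -((m + 1) * (n + 1) * (b - a) ^ 2 * (g.eval a * g.eval b)) := by
      rw [hh]; simp; ring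
    rw [this, neg_lt_zero]
    have : 0 < b - a := sub_pos.2 hab
    positivity
  obtain ⟨c, h1, h2, h3⟩ := (hR (h.natDegree + 1)).exists_root (Nat.lt_succ_self _) hab hval
  exact ⟨c, h1, h2, by rw [hder]; simp [h3]⟩

lemma PolyIVT.mul_mul_sub_pos (hR : ∀ d, PolyIVT R d) {f : Polynomial R} {c c' a r : R}
    (hca : c < a) (hac : a < c') (hder : ∀ x, c < x → x < c' → f.derivative.eval x ≠ 0)
    (ha : f.eval a = 0) (hcr : c ≤ r) (hrc : r ≤ c') (hra : r ≠ a) :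
    0 < f.eval c' * (f.eval r * (r - a)) := by
  obtain ⟨g, hg⟩ := Polynomial.dvd_iff_isRoot.2 (Polynomial.IsRoot.def.2 ha)
  have hgne : ∀ x, c ≤ x → x ≤ c' → g.eval x ≠ 0 := by
    intro x h1 h2 h3
    rcases lt_trichotomy x a with hx | rfl | hx
    · obtain ⟨y, hy1, hy2, hy⟩ := PolyIVT.rolle hR hx (f := f) (by rw [hg]; simp [h3]) ha
      exact hder y (h1.trans_lt hy1) (hy2.trans hac) hy
    · exact hder x hca hac (by rw [hg]; simp [h3])
    · obtain ⟨y, hy1, hy2, hy⟩ := PolyIVT.rolle hR hx (f := f) ha (by rw [hg]; simp [h3])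
      exact hder y (hca.trans hy1) (hy2.trans_le h2) hy
  have h0 := (hR (g.natDegree + 1)).mul_pos (Nat.lt_succ_self _) hrc
    fun x h1 h2 => hgne x (hcr.trans h1) h2
  have : f.eval c' * (f.eval r * (r - a)) =
      (c' - a) * (r - a) ^ 2 * (g.eval r * g.eval c') := by
    rw [hg]; simp; ring
  rw [this]
  have h1 : 0 < c' - a := sub_pos.2 hac
  have h2 : 0 < (r - a) ^ 2 := by
    have := sub_ne_zero.2 hra
    positivity
  positivity

end PolyIVT

section RealClosure

variable {R : Type*} [Field R] [LinearOrder R] [IsStrictOrderedRing R]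

lemma Polynomial.exists_gt_forall_neg (f : Polynomial R) {x b : R} (hx : f.eval x < 0)
    (hxb : x < b) : ∃ y, x < y ∧ y < b ∧ ∀ z, x ≤ z → z ≤ y → f.eval z < 0 := by
  let _ : TopologicalSpace R := Preorder.topology R
  have : OrderTopology R := ⟨rfl⟩
  have hc : {z | f.eval z < 0} ∈ nhds x :=
    (isOpen_Iio.preimage f.continuous).mem_nhds (Set.mem_Iio.2 hx)
  obtain ⟨u, hu, hu2⟩ := exists_Ico_subset_of_mem_nhds hc ⟨b, hxb⟩
  obtain ⟨y, hy1, hy2⟩ := exists_between (lt_min hu hxb)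
  exact ⟨y, hy1, hy2.trans_le (min_le_right _ _), fun z h1 h2 =>
    hu2 ⟨h1, (h2.trans_lt hy2).trans_le (min_le_left _ _)⟩⟩

lemma Polynomial.exists_lt_pos (f : Polynomial R) {x a : R} (hx : 0 < f.eval x)
    (hax : a < x) : ∃ y, a < y ∧ y < x ∧ 0 < f.eval y := by
  let _ : TopologicalSpace R := Preorder.topology R
  have : OrderTopology R := ⟨rfl⟩
  have hc : {z | 0 < f.eval z} ∈ nhds x :=
    (isOpen_Ioi.preimage f.continuous).mem_nhds (Set.mem_Ioi.2 hx)
  obtain ⟨l, hl, hl2⟩ := exists_Ioc_subset_of_mem_nhds hc ⟨a, hax⟩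
  obtain ⟨y, hy1, hy2⟩ := exists_between (max_lt hl hax)
  exact ⟨y, (le_max_right _ _).trans_lt hy1, hy2, hl2 ⟨(le_max_left _ _).trans_lt hy1, hy2.le⟩⟩

/-- The points `x ≥ a` such that `f` is negative on `[a, x]`. -/
def cutLower (f : Polynomial R) (a : R) : Set R :=
  {x | a ≤ x ∧ ∀ y, a ≤ y → y ≤ x → f.eval y < 0}

/-- The polynomial `g` is positive on an interval around the cut `cutLower f a`. -/
def PosAtCut (f : Polynomial R) (a b : R) (g : Polynomial R) : Prop :=
  ∃ x ∈ cutLower f a, ∃ y, y ∉ cutLower f a ∧ x < y ∧ y ≤ b ∧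
    ∀ z, x ≤ z → z ≤ y → 0 < g.eval z

variable {f g h : Polynomial R} {a b : R} {d : ℕ}

lemma lt_of_mem_cutLower {x y : R} (hx : x ∈ cutLower f a) (hy : y ∉ cutLower f a)
    (hay : a ≤ y) : x < y := by
  by_contra! hcon
  exact hy ⟨hay, fun z h1 h2 => hx.2 z h1 (h2.trans hcon)⟩

lemma exists_gt_mem_cutLower {x : R} (hx : x ∈ cutLower f a) (hb : 0 < f.eval b) (hab : a < b) :
    ∃ y ∈ cutLower f a, x < y := by
  have hxb : x < b := lt_of_mem_cutLower hx (fun h => (h.2 b hab.le le_rfl).not_gt hb) hab.le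
  obtain ⟨y, h1, -, h3⟩ := f.exists_gt_forall_neg (hx.2 x hx.1 le_rfl) hxb
  refine ⟨y, ⟨hx.1.trans h1.le, fun z hz1 hz2 => ?_⟩, h1⟩
  rcases le_total z x with h | h
  · exact hx.2 z hz1 h
  · exact h3 z h hz2

lemma exists_pos_of_notMem_cutLower {y : R} (hay : a ≤ y) (hyb : y ≤ b) (hb : 0 < f.eval b)
    (ha : f.eval a < 0) (hno : ∀ c, a < c → c < b → f.eval c ≠ 0) (hy : y ∉ cutLower f a) :
    ∃ z, a < z ∧ z ≤ y ∧ 0 < f.eval z := by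
  have : ¬ ∀ z, a ≤ z → z ≤ y → f.eval z < 0 := fun h => hy ⟨hay, h⟩
  push Not at this
  obtain ⟨z, h1, h2, h3⟩ := this
  have haz : a < z := h1.lt_of_ne (by rintro rfl; exact h3.not_gt ha)
  refine ⟨z, haz, h2, h3.lt_of_ne' ?_⟩
  rcases (h2.trans hyb).eq_or_lt with rfl | h4
  · exact hb.ne'
  · exact hno z haz h4

lemma exists_lt_notMem_cutLower {y : R} (hay : a ≤ y) (hyb : y ≤ b) (hb : 0 < f.eval b)
    (ha : f.eval a < 0) (hno : ∀ c, a < c → c < b → f.eval c ≠ 0) (hy : y ∉ cutLower f a) :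
    ∃ z, z ∉ cutLower f a ∧ a ≤ z ∧ z < y := by
  obtain ⟨z, h1, h2, h3⟩ := exists_pos_of_notMem_cutLower hay hyb hb ha hno hy
  obtain ⟨u, h4, h5, h6⟩ := f.exists_lt_pos h3 h1
  exact ⟨u, fun h => (h.2 u h4.le le_rfl).not_gt h6, h4.le, h5.trans_le h2⟩

lemma posAtCut_or_neg (hR : PolyIVT R d) (hab : a < b) (ha : f.eval a < 0) (hb : 0 < f.eval b)
    (hno : ∀ c, a < c → c < b → f.eval c ≠ 0) (hg : g.natDegree < d) (hg0 : g ≠ 0) :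
    PosAtCut f a b g ∨ PosAtCut f a b (-g) := by
  classical
  have haC : a ∈ cutLower f a := ⟨le_rfl, fun y h1 h2 => by rwa [le_antisymm h2 h1]⟩
  have hbC : b ∉ cutLower f a := fun h => (h.2 b hab.le le_rfl).not_gt hb
  -- `x` is beyond all the roots of `g` below the cut
  obtain ⟨x, hxC, hx⟩ : ∃ x ∈ cutLower f a, ∀ r ∈ cutLower f a, g.eval r = 0 → r < x := by
    set s := insert a (g.roots.toFinset.filter (· ∈ cutLower f a))
    have hs : s.Nonempty := Finset.insert_nonempty _ _
    have hm : s.max' hs ∈ cutLower f a := by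
      have := s.max'_mem hs
      rcases Finset.mem_insert.1 this with h | h
      · rwa [h]
      · exact (Finset.mem_filter.1 h).2
    obtain ⟨x, hx, hx2⟩ := exists_gt_mem_cutLower hm hb hab
    exact ⟨x, hx, fun r hr hr0 => (s.le_max' r (by simp [s, hr, hr0, hg0])).trans_lt hx2⟩
  obtain ⟨y, hyC, hay, hyb, hy⟩ : ∃ y, y ∉ cutLower f a ∧ a ≤ y ∧ y ≤ b ∧
      ∀ r, r ∉ cutLower f a → a ≤ r → g.eval r = 0 → y < r := by
    set s := insert b (g.roots.toFinset.filter fun r => r ∉ cutLower f a ∧ a ≤ r)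
    have hs : s.Nonempty := Finset.insert_nonempty _ _
    have hm : s.min' hs ∉ cutLower f a ∧ a ≤ s.min' hs := by
      have := s.min'_mem hs
      rcases Finset.mem_insert.1 this with h | h
      · rw [h]; exact ⟨hbC, hab.le⟩
      · exact (Finset.mem_filter.1 h).2
    have hmb : s.min' hs ≤ b := s.min'_le b (by simp [s])
    obtain ⟨y, hy, hy1, hy2⟩ := exists_lt_notMem_cutLower hm.2 hmb hb ha hno hm.1
    exact ⟨y, hy, hy1, hy2.le.trans hmb, fun r hr har hr0 =>
      hy2.trans_le (s.min'_le r (by simp [s, hr, hr0, hg0, har]))⟩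
  have hxy := lt_of_mem_cutLower hxC hyC hay
  have hroot : ∀ z, x ≤ z → z ≤ y → g.eval z ≠ 0 := by
    intro z h1 h2 h3
    by_cases hz : z ∈ cutLower f a
    · exact (hx z hz h3).not_ge h1
    · exact (hy z hz (hxC.1.trans h1) h3).not_ge h2
  have hsgn : ∀ z, x ≤ z → z ≤ y → 0 < g.eval x * g.eval z := fun z h1 h2 =>
    hR.mul_pos hg h1 fun c h3 h4 => hroot c h3 (h4.trans h2)
  rcases lt_or_gt_of_ne (hroot x le_rfl hxy.le) with h | h
  · exact Or.inr ⟨x, hxC, y, hyC, hxy, hyb, fun z h1 h2 => by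
      simpa using neg_of_mul_pos_right (hsgn z h1 h2) h.le⟩
  · exact Or.inl ⟨x, hxC, y, hyC, hxy, hyb, fun z h1 h2 =>
      pos_of_mul_pos_right (hsgn z h1 h2) h.le⟩

lemma PosAtCut.common (hg : PosAtCut f a b g) (hh : PosAtCut f a b h) :
    ∃ x ∈ cutLower f a, ∃ y, y ∉ cutLower f a ∧ x < y ∧ y ≤ b ∧
      ∀ z, x ≤ z → z ≤ y → 0 < g.eval z ∧ 0 < h.eval z := by
  obtain ⟨x, hx, y, hy, hxy, hyb, h1⟩ := hg
  obtain ⟨x', hx', y', hy', hxy', hyb', h2⟩ := hh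
  have hX : max x x' ∈ cutLower f a := by rcases max_choice x x' with h | h <;> rw [h] <;> assumption
  have hY : min y y' ∉ cutLower f a := by rcases min_choice y y' with h | h <;> rw [h] <;> assumption
  exact ⟨_, hX, _, hY, lt_of_mem_cutLower hX hY (le_min (hx.1.trans hxy.le) (hx'.1.trans hxy'.le)),
    (min_le_left _ _).trans hyb, fun z h3 h4 =>
      ⟨h1 z ((le_max_left _ _).trans h3) (h4.trans (min_le_left _ _)),
        h2 z ((le_max_right _ _).trans h3) (h4.trans (min_le_right _ _))⟩⟩

lemma PosAtCut.add (hg : PosAtCut f a b g) (hh : PosAtCut f a b h) : PosAtCut f a b (g + h) := by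
  obtain ⟨x, hx, y, hy, hxy, hyb, h1⟩ := hg.common hh
  refine ⟨x, hx, y, hy, hxy, hyb, fun z h2 h3 => ?_⟩
  have := h1 z h2 h3
  rw [Polynomial.eval_add]
  exact _root_.add_pos this.1 this.2

lemma not_posAtCut_zero : ¬ PosAtCut f a b 0 := by
  rintro ⟨x, -, y, -, hxy, -, h⟩
  simpa using h x le_rfl hxy.le

lemma posAtCut_C (hab : a < b) (ha : f.eval a < 0) (hb : 0 < f.eval b) {r : R} (hr : 0 < r) :
    PosAtCut f a b (Polynomial.C r) :=
  ⟨a, ⟨le_rfl, fun y h1 h2 => by rwa [le_antisymm h2 h1]⟩, b,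
    fun h => (h.2 b hab.le le_rfl).not_gt hb, hab, le_rfl, by simp [hr]⟩

lemma PosAtCut.mul_mod (hR : PolyIVT R d) (hab : a < b) (hfd : f.natDegree = d)
    (hd : 0 < d) (ha : f.eval a < 0)
    (hb : 0 < f.eval b) (hno : ∀ c, a < c → c < b → f.eval c ≠ 0)
    (hgd : g.natDegree < d) (hhd : h.natDegree < d)
    (hg : PosAtCut f a b g) (hh : PosAtCut f a b h) :
    PosAtCut f a b (g * h % f) := by
  have hf0 : f ≠ 0 := by rintro rfl; simp at hb
  have hmod : (g * h % f).natDegree < d := by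
    rw [← hfd]; exact Polynomial.natDegree_mod_lt _ (by omega)
  have hdiv : f * (g * h / f) + g * h % f = g * h := EuclideanDomain.div_add_mod _ _
  have hquot : (g * h / f).natDegree < d := by
    by_contra! hcon
    have hq0 : g * h / f ≠ 0 := by rintro h; rw [h] at hcon; simp at hcon; omega
    have h1 : (f * (g * h / f)).natDegree = d + (g * h / f).natDegree := by
      rw [Polynomial.natDegree_mul hf0 hq0, hfd]
    have h2 := Polynomial.natDegree_sub_le (g * h) (g * h % f)
    rw [← eq_sub_of_add_eq hdiv, h1] at h2
    have h3 := Polynomial.natDegree_mul_le (p := g) (q := h)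
    rcases le_max_iff.1 h2 with h2 | h2 <;> omega
  by_contra hcon
  have key : ∃ x ∈ cutLower f a, ∃ y, y ∉ cutLower f a ∧ x < y ∧ y ≤ b ∧
      ∀ z, x ≤ z → z ≤ y → 0 < f.eval z * (g * h / f).eval z := by
    by_cases h0 : g * h % f = 0
    · obtain ⟨x, hx, y, hy, hxy, hyb, h1⟩ := hg.common hh
      refine ⟨x, hx, y, hy, hxy, hyb, fun z h2 h3 => ?_⟩
      rw [← Polynomial.eval_mul, ← add_zero (f * _), ← h0, hdiv, Polynomial.eval_mul]
      exact _root_.mul_pos (h1 z h2 h3).1 (h1 z h2 h3).2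
    · have hneg := (posAtCut_or_neg hR hab ha hb hno hmod h0).resolve_left hcon
      obtain ⟨x, hx, y, hy, hxy, hyb, h1⟩ := hg.common hh
      obtain ⟨x, hx, y, hy, hxy, hyb, h1⟩ :=
        PosAtCut.common (f := f) (g := g * h) (a := a) (b := b) ⟨x, hx, y, hy, hxy, hyb,
          fun z h2 h3 => by
            rw [Polynomial.eval_mul]
            exact _root_.mul_pos (h1 z h2 h3).1 (h1 z h2 h3).2⟩ hneg
      refine ⟨x, hx, y, hy, hxy, hyb, fun z h2 h3 => ?_⟩
      have h4 := h1 z h2 h3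
      have h5 : f.eval z * (g * h / f).eval z = (g * h).eval z + (-(g * h % f)).eval z := by
        have := congrArg (Polynomial.eval z) hdiv
        rw [Polynomial.eval_add, Polynomial.eval_mul] at this
        rw [Polynomial.eval_neg]
        linear_combination this
      rw [h5]
      exact _root_.add_pos h4.1 h4.2
  obtain ⟨x, hx, y, hy, hxy, hyb, h1⟩ := key
  obtain ⟨z, haz, hzy, hz⟩ :=
    exists_pos_of_notMem_cutLower (hx.1.trans hxy.le) hyb hb ha hno hy
  have hxz : x ≤ z := by
    by_contra! hlt
    exact (hx.2 z haz.le hlt.le).not_gt hz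
  have h2 := hR.mul_pos hquot hxz fun c h3 h4 h5 => by
    have := h1 c h3 (h4.trans hzy)
    simp [h5] at this
  have h3 := h1 x le_rfl hxy.le
  have h4 := h1 z hxz hzy
  have h5 := hx.2 x hx.1 le_rfl
  have h6 : (g * h / f).eval x < 0 := neg_of_mul_pos_right h3 h5.le
  have h7 : 0 < (g * h / f).eval z := pos_of_mul_pos_right h4 hz.le
  exact (mul_neg_of_neg_of_pos h6 h7).not_gt h2

lemma PolyIVT.irreducible (hR : PolyIVT R d) (hab : a < b) (hfd : f.natDegree = d)
    (ha : f.eval a < 0) (hb : 0 < f.eval b) (hno : ∀ c, a < c → c < b → f.eval c ≠ 0) :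
    Irreducible f := by
  have hf0 : f ≠ 0 := by rintro rfl; simp at hb
  have hd : f.natDegree ≠ 0 := by
    intro h
    rw [Polynomial.eq_C_of_natDegree_eq_zero h] at ha hb
    simp only [Polynomial.eval_C] at ha hb
    exact ha.not_gt hb
  refine ⟨fun h => hd (Polynomial.natDegree_eq_zero_of_isUnit h), fun g h hgh => ?_⟩
  by_contra! hcon
  have hg0 : g ≠ 0 := by rintro rfl; simp [hf0] at hgh
  have hh0 : h ≠ 0 := by rintro rfl; simp [hf0] at hgh
  have hg1 : 0 < g.natDegree := Polynomial.natDegree_pos_iff_degree_pos.2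
    (Polynomial.degree_pos_of_ne_zero_of_nonunit hg0 hcon.1)
  have hh1 : 0 < h.natDegree := Polynomial.natDegree_pos_iff_degree_pos.2
    (Polynomial.degree_pos_of_ne_zero_of_nonunit hh0 hcon.2)
  have hdeg : g.natDegree + h.natDegree = d := by
    rw [← Polynomial.natDegree_mul hg0 hh0, ← hgh, hfd]
  have hneg : (g.eval a * g.eval b) * (h.eval a * h.eval b) < 0 := by
    have := mul_neg_of_neg_of_pos ha hb
    rw [hgh] at this
    simp only [Polynomial.eval_mul] at this
    linarith
  rcases mul_neg_iff.1 hneg with ⟨-, h1⟩ | ⟨h1, -⟩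
  · obtain ⟨c, h2, h3, h4⟩ := hR.exists_root (f := h) (by omega) hab h1
    exact hno c h2 h3 (by rw [hgh]; simp [h4])
  · obtain ⟨c, h2, h3, h4⟩ := hR.exists_root (f := g) (by omega) hab h1
    exact hno c h2 h3 (by rw [hgh]; simp [h4])

end RealClosure

section RealClosure

variable {R : Type*} [Field R] [LinearOrder R] [IsStrictOrderedRing R]
variable {f g h : Polynomial R} {a b : R} {d : ℕ}

lemma Irreducible.eq_zero_of_aeval_eq_zero {R Ω : Type*} [Field R] [Field Ω] [Algebra R Ω] {α : Ω}
    {f : Polynomial R} (hf : Irreducible f) (hα : Polynomial.aeval α f = 0) {g : Polynomial R}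
    (hg : g.natDegree < f.natDegree) (hgα : Polynomial.aeval α g = 0) : g = 0 := by
  by_contra h0
  obtain ⟨u, v, huv⟩ := (hf.coprime_iff_not_dvd).2 (Polynomial.not_dvd_of_natDegree_lt h0 hg)
  have := congrArg (Polynomial.aeval α) huv
  simp [hα, hgα] at this

/-- The positive cone on `R(α)`, with `α` a root of `f` placed in the cut `cutLower f a`. -/
lemma fieldCone_adjoin_root {Ω : Type*} [Field Ω] [Algebra R Ω] {α : Ω}
    (hα : Polynomial.aeval α f = 0) (hR : PolyIVT R d) (hab : a < b) (hfd : f.natDegree = d)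
    (ha : f.eval a < 0) (hb : 0 < f.eval b) (hno : ∀ c, a < c → c < b → f.eval c ≠ 0) :
    FieldCone {x : Ω | ∃ g : Polynomial R, g.natDegree < d ∧ x = Polynomial.aeval α g ∧
      (g = 0 ∨ PosAtCut f a b g)} ∧
    ∀ g : Polynomial R, ∃ u : Polynomial R, u.natDegree < d ∧
      Polynomial.aeval α g = Polynomial.aeval α u ∧
      (u = 0 ∨ PosAtCut f a b u ∨ PosAtCut f a b (-u)) := by
  have hirr := hR.irreducible hab hfd ha hb hno
  have hd : 0 < d := by rw [← hfd]; exact hirr.natDegree_pos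
  have hmod : ∀ g : Polynomial R, (g % f).natDegree < d := fun g => by
    rw [← hfd]; exact Polynomial.natDegree_mod_lt _ (by omega)
  have hmodα : ∀ g : Polynomial R, Polynomial.aeval α (g % f) = Polynomial.aeval α g := fun g => by
    conv_rhs => rw [← EuclideanDomain.div_add_mod g f]
    simp [hα]
  have hzero : ∀ g : Polynomial R, g.natDegree < d → Polynomial.aeval α g = 0 → g = 0 :=
    fun g hg h => hirr.eq_zero_of_aeval_eq_zero hα (hfd ▸ hg) h
  have htri : ∀ u : Polynomial R, u.natDegree < d →
      u = 0 ∨ PosAtCut f a b u ∨ PosAtCut f a b (-u) := fun u hu => by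
    by_cases h : u = 0
    · exact Or.inl h
    · exact Or.inr (posAtCut_or_neg hR hab ha hb hno hu h)
  set P := {x : Ω | ∃ g : Polynomial R, g.natDegree < d ∧ x = Polynomial.aeval α g ∧
      (g = 0 ∨ PosAtCut f a b g)} with hP
  have hone : (1 : Ω) ∈ P := ⟨Polynomial.C 1, by simpa using hd, by simp,
    Or.inr (posAtCut_C hab ha hb one_pos)⟩
  have hmul : ∀ {x y : Ω}, x ∈ P → y ∈ P → x * y ∈ P := by
    rintro _ _ ⟨g, hg, rfl, hg'⟩ ⟨h, hh, rfl, hh'⟩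
    refine ⟨g * h % f, hmod _, by rw [hmodα, map_mul], ?_⟩
    rcases hg' with rfl | hg'
    · simp
    rcases hh' with rfl | hh'
    · simp
    exact Or.inr (PosAtCut.mul_mod hR hab hfd hd ha hb hno hg hh hg' hh')
  have heq : ∀ {x : Ω}, x ∈ P → -x ∈ P → x = 0 := by
    rintro _ ⟨g, hg, rfl, hg'⟩ ⟨h, hh, hgh, hh'⟩
    have h0 : g + h = 0 := by
      refine hzero _ ?_ (by rw [map_add, ← hgh]; simp)
      have := Polynomial.natDegree_add_le g h
      rcases le_max_iff.1 this with h | h <;> omega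
    rcases hg' with rfl | hg'
    · simp
    rcases hh' with rfl | hh'
    · simpa using hgh
    · exact absurd (h0 ▸ hg'.add hh') not_posAtCut_zero
  refine ⟨⟨hone, ?_, hmul, ?_, heq, ?_⟩, fun g => ⟨g % f, hmod g, (hmodα g).symm, htri _ (hmod g)⟩⟩
  · rintro _ _ ⟨g, hg, rfl, hg'⟩ ⟨h, hh, rfl, hh'⟩
    refine ⟨g + h, ?_, by simp, ?_⟩
    · have := Polynomial.natDegree_add_le g h
      rcases le_max_iff.1 this with h | h <;> omega
    rcases hg' with rfl | hg'
    · simpa using hh'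
    rcases hh' with rfl | hh'
    · simpa using Or.inr hg'
    exact Or.inr (hg'.add hh')
  · intro x hx
    by_cases hx0 : x = 0
    · simpa [hx0] using (show (0 : Ω) ∈ P from ⟨0, by simpa using hd, by simp, Or.inl rfl⟩)
    obtain ⟨g, hg, hxg, hg'⟩ := id hx
    have hg0 : g ≠ 0 := by rintro rfl; simp [hxg] at hx0
    obtain ⟨u, v, huv⟩ := (hirr.coprime_iff_not_dvd).2
      (Polynomial.not_dvd_of_natDegree_lt hg0 (hfd ▸ hg))
    have hinv : Polynomial.aeval α (v % f) = x⁻¹ := by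
      have := congrArg (Polynomial.aeval α) huv
      simp only [map_add, map_mul, hα, mul_zero, zero_add, ← hxg, map_one] at this
      rw [hmodα]
      exact eq_inv_of_mul_eq_one_left this
    rcases htri _ (hmod v) with h | h | h
    · exact ⟨_, hmod v, hinv.symm, Or.inl h⟩
    · exact ⟨_, hmod v, hinv.symm, Or.inr h⟩
    · have h1 : -x⁻¹ ∈ P := ⟨-(v % f), by simpa using hmod v, by simp [hinv], Or.inr h⟩
      have h2 := hmul h1 hx
      rw [neg_mul, inv_mul_cancel₀ hx0] at h2
      exact absurd (heq hone h2) one_ne_zero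
  · rintro _ _ ⟨g, hg, rfl, -⟩ ⟨h, hh, rfl, -⟩
    have hgh : (g - h).natDegree < d := by
      have := Polynomial.natDegree_sub_le g h
      rcases le_max_iff.1 this with h | h <;> omega
    rcases htri _ hgh with h0 | h0 | h0
    · exact Or.inl ⟨_, hgh, by simp, Or.inl h0⟩
    · exact Or.inl ⟨_, hgh, by simp, Or.inr h0⟩
    · exact Or.inr ⟨-(g - h), by rwa [Polynomial.natDegree_neg], by simp, Or.inr h0⟩

/-- A root of an irreducible polynomial of minimal degree violating the intermediate value
property can be adjoined to the cone, contradicting maximality. -/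
lemma FieldCone.polyIVT {Ω : Type*} [Field Ω] [IsAlgClosed Ω] {P : Set Ω}
    (hP : Maximal FieldCone P) (d : ℕ) :
    @PolyIVT hP.1.toSubfield _ hP.1.linearOrder d := by
  let _ := hP.1.linearOrder
  have := hP.1.isStrictOrderedRing
  induction d with
  | zero => intro f hf; exact absurd hf (Nat.not_lt_zero _)
  | succ d ih =>
    intro f hf a b hab ha hb
    by_contra! hno
    rcases (Nat.lt_succ_iff.1 hf).lt_or_eq with hfd | hfd
    · obtain ⟨c, h1, h2, h3⟩ := ih f hfd a b hab ha hb
      exact hno c h1 h2 h3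
    have hirr := ih.irreducible hab hfd ha hb hno
    obtain ⟨α, hα⟩ := IsAlgClosed.exists_aeval_eq_zero Ω f
      (Polynomial.natDegree_pos_iff_degree_pos.1 hirr.natDegree_pos).ne'
    obtain ⟨hcone, hred⟩ := fieldCone_adjoin_root hα ih hab hfd ha hb hno
    have hsub := hP.2 hcone fun x hx => by
      have hx' : x ∈ hP.1.toSubfield := Or.inl hx
      have h0 : (0 : hP.1.toSubfield) ≤ ⟨x, hx'⟩ := by
        change (x - 0 : Ω) ∈ P
        simpa using hx
      refine ⟨Polynomial.C ⟨x, hx'⟩, ?_, ?_, ?_⟩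
      · rw [Polynomial.natDegree_C, ← hfd]; exact hirr.natDegree_pos
      · rw [Polynomial.aeval_C]; rfl
      · rcases h0.eq_or_lt with h0 | h0
        · left; rw [← h0]; simp
        · exact Or.inr (posAtCut_C hab ha hb h0)
    have hαL : α ∈ hP.1.toSubfield := by
      obtain ⟨u, hu, hXu, h⟩ := hred Polynomial.X
      rw [Polynomial.aeval_X] at hXu
      rcases h with h | h | h
      · exact Or.inl (hsub ⟨u, hu, hXu, Or.inl h⟩)
      · exact Or.inl (hsub ⟨u, hu, hXu, Or.inr h⟩)
      · exact Or.inr (hsub ⟨-u, by rwa [Polynomial.natDegree_neg], by rw [map_neg, ← hXu], Or.inr h⟩)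
    have hroot : f.eval ⟨α, hαL⟩ = 0 := by
      apply Subtype.ext
      have : Polynomial.aeval (algebraMap hP.1.toSubfield Ω ⟨α, hαL⟩) f = 0 := hα
      rw [Polynomial.aeval_algebraMap_apply] at this
      simpa using this
    have hdeg := Polynomial.degree_eq_one_of_irreducible_of_root hirr hroot
    obtain ⟨k, hk⟩ := Polynomial.dvd_iff_isRoot.2 (Polynomial.IsRoot.def.2 hroot)
    set c : hP.1.toSubfield := ⟨α, hαL⟩
    have hk0 : k ≠ 0 := by rintro rfl; simp [hk] at hb
    have hkd : k.natDegree = 0 := by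
      have h1 : f.natDegree = 1 := Polynomial.natDegree_eq_of_degree_eq_some hdeg
      rw [hk, Polynomial.natDegree_mul (Polynomial.X_sub_C_ne_zero c) hk0,
        Polynomial.natDegree_X_sub_C] at h1
      omega
    obtain ⟨r, hr⟩ : ∃ r, k = Polynomial.C r := ⟨_, Polynomial.eq_C_of_natDegree_eq_zero hkd⟩
    rw [hk, hr] at ha hb
    simp only [Polynomial.eval_mul, Polynomial.eval_sub, Polynomial.eval_X, Polynomial.eval_C]
      at ha hb
    have hr0 : 0 < r := by
      by_contra! h
      nlinarith
    exact hno c (by nlinarith) (by nlinarith) hroot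

/-- An abstract Positivstellensatz over ordered fields with the intermediate value property. -/
theorem exists_orderedField_hom {A : Type} [CommRing A] (T : Subsemiring A)
    (hsq : ∀ a, a * a ∈ T) (p : A) (hp : ∀ l : ℕ, -p ^ (2 * l) ∉ T) :
    ∃ (L : Type) (_ : Field L) (_ : LinearOrder L) (_ : IsStrictOrderedRing L) (φ : A →+* L),
      (∀ d, PolyIVT L d) ∧ (∀ t ∈ T, 0 ≤ φ t) ∧ φ p ≠ 0 := by
  obtain ⟨P, hTP, hP⟩ := exists_maximal_subsemiring T p hp
  have hsqP : ∀ a, a * a ∈ P := fun a => hTP (hsq a)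
  have htot := mem_or_neg_mem_of_maximal hsqP hP
  have := supportIdeal_isPrime hsqP hP htot
  set I := P.supportIdeal htot
  let K := FractionRing (A ⧸ I)
  let Ω := AlgebraicClosure K
  let ι : A →+* Ω := (algebraMap K Ω).comp ((algebraMap (A ⧸ I) K).comp (Ideal.Quotient.mk I))
  have hι : ∀ a, ι a = 0 ↔ a ∈ P ∧ -a ∈ P := fun a => by
    have h1 : ι a = 0 ↔ Ideal.Quotient.mk I a = 0 := by
      simp [ι]
    rw [h1, Ideal.Quotient.eq_zero_iff_mem]
    exact Iff.rfl
  obtain ⟨Q, hQ, hQmax⟩ := (fieldCone_of_total ι hsqP htot hι).exists_maximal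
  have hmem : ∀ a ∈ P, ι a ∈ Q := fun a ha => hQ ⟨a, ha, 1, by simp, by simp⟩
  have hL : ∀ a, ι a ∈ hQmax.1.toSubfield := fun a => by
    rcases htot a with h | h
    · exact Or.inl (hmem a h)
    · exact Or.inr (by simpa using hmem _ h)
  refine ⟨hQmax.1.toSubfield, inferInstance, hQmax.1.linearOrder, hQmax.1.isStrictOrderedRing,
    ι.codRestrict _ hL, FieldCone.polyIVT hQmax, fun t ht => ?_, fun h0 => ?_⟩
  · change (ι t - 0 : Ω) ∈ Q
    simpa using hmem t (hTP ht)
  · have h1 : ι p = 0 := congrArg Subtype.val h0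
    have h2 := ((hι p).1 h1).2
    exact hP.1 1 (by
      have := P.mul_mem h2 ((hι p).1 h1).1
      convert this using 1; ring)

end RealClosure

section PartialIso

lemma Polynomial.exists_root_lt {F R : Type*} [Field F] [Field R] [LinearOrder R]
    [IsStrictOrderedRing R] (i : F →+* R) {f : Polynomial F} (hf : f ≠ 0) :
    ∃ M : F, ∀ a : R, (f.map i).eval a = 0 → a < i M := by
  refine ⟨1 + ∑ k ∈ Finset.range f.natDegree, (1 + (f.coeff k / f.leadingCoeff) ^ 2), ?_⟩
  intro a ha
  by_contra! hle
  set r : ℕ → R := fun k => i (f.coeff k / f.leadingCoeff)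
  have hM : i (1 + ∑ k ∈ Finset.range f.natDegree, (1 + (f.coeff k / f.leadingCoeff) ^ 2)) =
      1 + ∑ k ∈ Finset.range f.natDegree, (1 + r k ^ 2) := by simp [r]
  rw [hM] at hle
  have hnn : 0 ≤ ∑ k ∈ Finset.range f.natDegree, (1 + r k ^ 2) :=
    Finset.sum_nonneg fun k _ => by positivity
  have ha1 : 1 ≤ a := by linarith
  have ha0 : 0 < a := by linarith
  have hl : i f.leadingCoeff ≠ 0 := by simpa using hf
  have hsum : a ^ f.natDegree = ∑ k ∈ Finset.range f.natDegree, -r k * a ^ k := by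
    rw [Polynomial.eval_map, Polynomial.eval₂_eq_sum_range, Finset.sum_range_succ] at ha
    simp only [r, map_div₀]
    have h2 : ∑ k ∈ Finset.range f.natDegree, -(i (f.coeff k) / i f.leadingCoeff) * a ^ k =
        -(∑ k ∈ Finset.range f.natDegree, i (f.coeff k) * a ^ k) / i f.leadingCoeff := by
      rw [← Finset.sum_neg_distrib, Finset.sum_div]
      refine Finset.sum_congr rfl fun k _ => by ring
    rw [h2, eq_div_iff hl]
    change _ + i f.leadingCoeff * a ^ f.natDegree = 0 at ha
    linear_combination ha
  rcases Nat.eq_zero_or_pos f.natDegree with h0 | h0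
  · rw [h0] at hsum; simp at hsum
  obtain ⟨n, hn⟩ := Nat.exists_eq_succ_of_ne_zero h0.ne'
  have hbound : ∑ k ∈ Finset.range f.natDegree, -r k * a ^ k ≤
      (∑ k ∈ Finset.range f.natDegree, (1 + r k ^ 2)) * a ^ n := by
    rw [Finset.sum_mul]
    refine Finset.sum_le_sum fun k hk => ?_
    have h1 : -r k ≤ 1 + r k ^ 2 := by nlinarith [sq_nonneg (r k + 1)]
    have h2 : a ^ k ≤ a ^ n := pow_le_pow_right₀ ha1 (by have := Finset.mem_range.1 hk; omega)
    have h3 : 0 < a ^ k := by positivity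
    calc -r k * a ^ k ≤ (1 + r k ^ 2) * a ^ k := by gcongr
      _ ≤ (1 + r k ^ 2) * a ^ n := by gcongr
  rw [← hsum, hn, pow_succ'] at hbound
  have h3 : 0 < a ^ n := by positivity
  rw [hn] at hle
  have := le_of_mul_le_mul_right hbound h3
  linarith

lemma Polynomial.exists_gt_root {F R : Type*} [Field F] [Field R] [LinearOrder R]
    [IsStrictOrderedRing R] (i : F →+* R) {f : Polynomial F} (hf : f ≠ 0) :
    ∃ M : F, ∀ a : R, (f.map i).eval a = 0 → i M < a := by
  have hf' : f.comp (-Polynomial.X) ≠ 0 := by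
    intro h
    apply hf
    have := congrArg (fun g : Polynomial F => g.comp (-Polynomial.X)) h
    simpa [Polynomial.comp_assoc] using this
  obtain ⟨M, hM⟩ := Polynomial.exists_root_lt i hf'
  refine ⟨-M, fun a ha => ?_⟩
  have := hM (-a) (by simpa [Polynomial.map_comp] using ha)
  rw [map_neg]
  linarith

variable {F R₁ R₂ : Type*} [Field F] [Field R₁] [LinearOrder R₁] [IsStrictOrderedRing R₁]
  [Field R₂] [LinearOrder R₂] [IsStrictOrderedRing R₂] {i₁ : F →+* R₁} {i₂ : F →+* R₂}

lemma exists_cut_avoiding_roots {a : R₁} (ha : a ∉ i₁.range) {m M : F} (hm : i₁ m < a)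
    (hM : a < i₁ M) {h : Polynomial F} (hh : h ≠ 0) :
    ∃ c c' : F, i₁ m ≤ i₁ c ∧ i₁ c' ≤ i₁ M ∧ i₁ c < a ∧ a < i₁ c' ∧
      ∀ r, i₁ c < i₁ r → i₁ r < i₁ c' → h.eval r ≠ 0 := by
  classical
  obtain ⟨c, hc, hcmax⟩ := Finset.exists_max_image
    (insert m (h.roots.toFinset.filter fun r => i₁ r < a)) i₁ (Finset.insert_nonempty _ _)
  obtain ⟨c', hc', hcmin⟩ := Finset.exists_min_image
    (insert M (h.roots.toFinset.filter fun r => a < i₁ r)) i₁ (Finset.insert_nonempty _ _)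
  refine ⟨c, c', hcmax m (by simp), hcmin M (by simp), ?_, ?_, ?_⟩
  · rcases Finset.mem_insert.1 hc with rfl | h
    · exact hm
    · exact (Finset.mem_filter.1 h).2
  · rcases Finset.mem_insert.1 hc' with rfl | h
    · exact hM
    · exact (Finset.mem_filter.1 h).2
  · intro r h1 h2 h3
    rcases lt_trichotomy (i₁ r) a with h4 | h4 | h4
    · exact (hcmax r (by simp [hh, h3, h4])).not_gt h1
    · exact ha ⟨r, h4⟩
    · exact (hcmin r (by simp [hh, h3, h4])).not_gt h2

lemma map_lt_iff_of_pos_iff (hi : ∀ x, 0 < i₁ x ↔ 0 < i₂ x) {x y : F} :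
    i₁ x < i₁ y ↔ i₂ x < i₂ y := by
  have := hi (y - x)
  simpa using this

/-- A root of a polynomial of minimal degree in one ordered field has a counterpart realizing
the same signs in the other one. -/
lemma exists_same_signs (h₁ : ∀ d, PolyIVT R₁ d) (h₂ : ∀ d, PolyIVT R₂ d)
    (hi : ∀ x, 0 < i₁ x ↔ 0 < i₂ x) {f : Polynomial F} (hf : f ≠ 0)
    (hmin₁ : ∀ g : Polynomial F, g ≠ 0 → g.natDegree < f.natDegree →
      ∀ x, (g.map i₁).eval x = 0 → x ∈ i₁.range)
    (hmin₂ : ∀ g : Polynomial F, g ≠ 0 → g.natDegree < f.natDegree →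
      ∀ x, (g.map i₂).eval x = 0 → x ∈ i₂.range)
    {a : R₁} (ha : (f.map i₁).eval a = 0) (har : a ∉ i₁.range) :
    ∃ b : R₂, ∀ g : Polynomial F, 0 < (g.map i₁).eval a ↔ 0 < (g.map i₂).eval b := by
  have hlt : ∀ {x y : F}, i₁ x < i₁ y ↔ i₂ x < i₂ y := map_lt_iff_of_pos_iff hi
  have hd : 0 < f.natDegree := by
    by_contra! h
    rw [Polynomial.eq_C_of_natDegree_le_zero h] at ha hf
    simp at ha
    simp [ha] at hf
  have hchar : CharZero F := (RingHom.charZero_iff i₁.injective).2 inferInstance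
  have hder : f.derivative ≠ 0 := fun h => hd.ne' (Polynomial.natDegree_eq_zero_of_derivative_eq_zero h)
  have hderd : f.derivative.natDegree < f.natDegree := Polynomial.natDegree_derivative_lt hd.ne'
  obtain ⟨m, hm⟩ := Polynomial.exists_gt_root i₁ hf
  obtain ⟨M, hM⟩ := Polynomial.exists_root_lt i₁ hf
  obtain ⟨c, c', -, -, hca, hac, hcc⟩ := exists_cut_avoiding_roots har (hm a ha) (hM a ha) hder
  have hcc1 : i₁ c < i₁ c' := hca.trans hac
  have hcc2 : i₂ c < i₂ c' := hlt.1 hcc1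
  have hno₁ : ∀ x, i₁ c < x → x < i₁ c' → (f.map i₁).derivative.eval x ≠ 0 := by
    intro x h1 h2 h3
    rw [Polynomial.derivative_map] at h3
    obtain ⟨r, rfl⟩ := hmin₁ _ hder hderd x h3
    exact hcc r h1 h2 (by simpa using h3)
  have hno₂ : ∀ x, i₂ c < x → x < i₂ c' → (f.map i₂).derivative.eval x ≠ 0 := by
    intro x h1 h2 h3
    rw [Polynomial.derivative_map] at h3
    obtain ⟨r, rfl⟩ := hmin₂ _ hder hderd x h3
    exact hcc r (hlt.2 h1) (hlt.2 h2) (by simpa using h3)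
  have key₁ : ∀ r, i₁ c ≤ i₁ r → i₁ r ≤ i₁ c' → 0 < i₁ (f.eval c' * f.eval r) * (i₁ r - a) := by
    intro r h1 h2
    have := PolyIVT.mul_mul_sub_pos h₁ hca hac hno₁ ha h1 h2 fun h => har ⟨r, h⟩
    simpa [mul_assoc] using this
  obtain ⟨b, hcb, hbc, hb⟩ : ∃ b, i₂ c < b ∧ b < i₂ c' ∧ (f.map i₂).eval b = 0 := by
    refine (h₂ ((f.map i₂).natDegree + 1)).exists_root (Nat.lt_succ_self _) hcc2 ?_
    have h1 : i₁ (f.eval c' * f.eval c) < i₁ 0 := by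
      rw [map_zero]
      exact neg_of_mul_pos_left (key₁ c le_rfl hcc1.le) (by linarith)
    have h2 := hlt.1 h1
    simpa [mul_comm] using h2
  have hbr : b ∉ i₂.range := by
    rintro ⟨r, rfl⟩
    have h1 := key₁ r (hlt.2 hcb).le (hlt.2 hbc).le
    have h2 : f.eval r = 0 := by simpa using hb
    simp [h2] at h1
  have key₂ : ∀ r, i₂ c ≤ i₂ r → i₂ r ≤ i₂ c' → 0 < i₂ (f.eval c' * f.eval r) * (i₂ r - b) := by
    intro r h1 h2
    have := PolyIVT.mul_mul_sub_pos h₂ hcb hbc hno₂ hb h1 h2 fun h => hbr ⟨r, h⟩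
    simpa [mul_assoc] using this
  have hcut : ∀ r, i₁ r < a ↔ i₂ r < b := by
    intro r
    rcases lt_or_ge (i₁ r) (i₁ c) with h1 | h1
    · exact iff_of_true (h1.trans hca) ((hlt.1 h1).trans hcb)
    rcases lt_or_ge (i₁ c') (i₁ r) with h2 | h2
    · exact iff_of_false (hac.trans h2).not_gt (hbc.trans (hlt.1 h2)).not_gt
    have k1 := key₁ r h1 h2
    have k2 := key₂ r (not_lt.1 fun h => h1.not_gt (hlt.2 h)) (not_lt.1 fun h => h2.not_gt (hlt.2 h))
    have e1 : i₁ (f.eval c' * f.eval r) < 0 ↔ i₂ (f.eval c' * f.eval r) < 0 := by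
      have := @hlt (f.eval c' * f.eval r) 0
      rwa [map_zero, map_zero] at this
    rw [← sub_neg, ← sub_neg (b := b)]
    constructor
    · intro h
      exact neg_of_mul_pos_right k2 (e1.1 (neg_of_mul_pos_left k1 h.le)).le
    · intro h
      exact neg_of_mul_pos_right k1 (e1.2 (neg_of_mul_pos_left k2 h.le)).le
  have hcut' : ∀ r, a < i₁ r ↔ b < i₂ r := by
    intro r
    have h1 : a ≠ i₁ r := fun h => har ⟨r, h.symm⟩
    have h2 : b ≠ i₂ r := fun h => hbr ⟨r, h.symm⟩
    rw [← not_iff_not, not_lt, not_lt, h1.symm.le_iff_lt, h2.symm.le_iff_lt, hcut]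
  have hsmall : ∀ g : Polynomial F, g.natDegree < f.natDegree →
      (0 < (g.map i₁).eval a ↔ 0 < (g.map i₂).eval b) := by
    intro g hgd
    rcases eq_or_ne g 0 with rfl | hg
    · simp
    obtain ⟨r, r', -, -, hra, har', hrr⟩ := exists_cut_avoiding_roots har (hm a ha) (hM a ha) hg
    set q : F := (r + r') / 2
    have hq : i₁ q = (i₁ r + i₁ r') / 2 := by rw [map_div₀, map_add, map_ofNat]
    have hrq : i₁ r < i₁ q := by rw [hq]; linarith
    have hqr : i₁ q < i₁ r' := by rw [hq]; linarith
    have hroot₁ : ∀ x, i₁ r < x → x < i₁ r' → (g.map i₁).eval x ≠ 0 := by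
      intro x k1 k2 k3
      obtain ⟨s, rfl⟩ := hmin₁ _ hg hgd x k3
      exact hrr s k1 k2 (by simpa using k3)
    have hroot₂ : ∀ x, i₂ r < x → x < i₂ r' → (g.map i₂).eval x ≠ 0 := by
      intro x k1 k2 k3
      obtain ⟨s, rfl⟩ := hmin₂ _ hg hgd x k3
      exact hrr s (hlt.2 k1) (hlt.2 k2) (by simpa using k3)
    have hb1 : i₂ r < b := (hcut r).1 hra
    have hb2 : b < i₂ r' := (hcut' r').1 har'
    have s1 : 0 < (g.map i₁).eval (i₁ q) * (g.map i₁).eval a := by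
      rcases le_total (i₁ q) a with h | h
      · exact (h₁ _).mul_pos (Nat.lt_succ_self _) h fun x k1 k2 =>
          hroot₁ x (hrq.trans_le k1) (k2.trans_lt har')
      · rw [mul_comm]
        exact (h₁ _).mul_pos (Nat.lt_succ_self _) h fun x k1 k2 =>
          hroot₁ x (hra.trans_le k1) (k2.trans_lt hqr)
    have s2 : 0 < (g.map i₂).eval (i₂ q) * (g.map i₂).eval b := by
      rcases le_total (i₂ q) b with h | h
      · exact (h₂ _).mul_pos (Nat.lt_succ_self _) h fun x k1 k2 =>
          hroot₂ x ((hlt.1 hrq).trans_le k1) (k2.trans_lt hb2)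
      · rw [mul_comm]
        exact (h₂ _).mul_pos (Nat.lt_succ_self _) h fun x k1 k2 =>
          hroot₂ x (hb1.trans_le k1) (k2.trans_lt (hlt.1 hqr))
    rw [← pos_iff_pos_of_mul_pos s1, ← pos_iff_pos_of_mul_pos s2]
    simpa using hi (g.eval q)
  refine ⟨b, fun g => ?_⟩
  have hmod := hsmall (g % f) (Polynomial.natDegree_mod_lt _ hd.ne')
  have e1 : (g.map i₁).eval a = ((g % f).map i₁).eval a := by
    conv_lhs => rw [← EuclideanDomain.div_add_mod g f]
    simp [ha]
  have e2 : (g.map i₂).eval b = ((g % f).map i₂).eval b := by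
    conv_lhs => rw [← EuclideanDomain.div_add_mod g f]
    simp [hb]
  rw [e1, e2, hmod]

end PartialIso

section PartialIso

variable {R₁ R₂ : Type*} [Field R₁] [LinearOrder R₁] [IsStrictOrderedRing R₁]
  [Field R₂] [LinearOrder R₂] [IsStrictOrderedRing R₂]

/-- A partial order isomorphism between two ordered fields, given by its graph. -/
def SignCompat (G : Subring (R₁ × R₂)) : Prop := ∀ z ∈ G, 0 < z.1 ↔ 0 < z.2

variable {G : Subring (R₁ × R₂)}

lemma SignCompat.eq_zero_iff (hG : SignCompat G) {z : R₁ × R₂} (hz : z ∈ G) :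
    z.1 = 0 ↔ z.2 = 0 := by
  have h1 := hG z hz
  have h2 := hG (-z) (G.neg_mem hz)
  simp only [Prod.fst_neg, Prod.snd_neg, neg_pos] at h2
  constructor
  · intro h
    rw [h] at h1 h2
    exact le_antisymm (not_lt.1 fun h => lt_irrefl _ (h1.2 h)) (not_lt.1 fun h => lt_irrefl _ (h2.2 h))
  · intro h
    rw [h] at h1 h2
    exact le_antisymm (not_lt.1 fun h => lt_irrefl _ (h1.1 h)) (not_lt.1 fun h => lt_irrefl _ (h2.1 h))

lemma SignCompat.exists_maximal (hG : SignCompat G) :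
    ∃ G' : Subring (R₁ × R₂), G ≤ G' ∧ Maximal SignCompat G' := by
  refine zorn_le_nonempty₀ {G : Subring (R₁ × R₂) | SignCompat G} ?_ G hG
  intro c hc hchain y hy
  refine ⟨sSup c, ?_, fun z hz => le_sSup hz⟩
  intro z hz
  rw [Subring.mem_sSup_of_directedOn ⟨y, hy⟩ hchain.directedOn] at hz
  obtain ⟨Q, hQ, hzQ⟩ := hz
  exact hc hQ z hzQ

lemma SignCompat.inv_mem (hG : Maximal SignCompat G) {z : R₁ × R₂} (hz : z ∈ G) :
    (z.1⁻¹, z.2⁻¹) ∈ G := by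
  have key : ∀ b ∈ G, 0 < b.1 → 0 < b.2 := fun b hb => (hG.1 b hb).1
  by_cases h0 : z.1 = 0
  · rw [h0, (hG.1.eq_zero_iff hz).1 h0, inv_zero, inv_zero]
    exact G.zero_mem
  have h0' : z.2 ≠ 0 := fun h => h0 ((hG.1.eq_zero_iff hz).2 h)
  let G' : Subring (R₁ × R₂) :=
    { carrier := {u | ∃ b ∈ G, 0 < b.1 ∧ u * b ∈ G}
      zero_mem' := ⟨1, G.one_mem, by simp, by simp⟩
      one_mem' := ⟨1, G.one_mem, by simp, by simp⟩
      add_mem' := by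
        rintro u v ⟨b, hb, hb0, hub⟩ ⟨c, hc, hc0, hvc⟩
        refine ⟨b * c, G.mul_mem hb hc, mul_pos hb0 hc0, ?_⟩
        have := G.add_mem (G.mul_mem hub hc) (G.mul_mem hvc hb)
        convert this using 1; ring
      mul_mem' := by
        rintro u v ⟨b, hb, hb0, hub⟩ ⟨c, hc, hc0, hvc⟩
        refine ⟨b * c, G.mul_mem hb hc, mul_pos hb0 hc0, ?_⟩
        have := G.mul_mem hub hvc
        convert this using 1; ring
      neg_mem' := by
        rintro u ⟨b, hb, hb0, hub⟩
        exact ⟨b, hb, hb0, by simpa using G.neg_mem hub⟩ }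
  have hG' : SignCompat G' := by
    rintro u ⟨b, hb, hb0, hub⟩
    have h1 := hG.1 _ hub
    rw [Prod.fst_mul, Prod.snd_mul, mul_pos_iff_of_pos_right hb0,
      mul_pos_iff_of_pos_right (key b hb hb0)] at h1
    exact h1
  refine hG.2 hG' (fun u hu => ⟨1, G.one_mem, by simp, by simpa using hu⟩) ?_
  refine ⟨z * z, G.mul_mem hz hz, by simpa using h0, ?_⟩
  convert hz using 1
  ext <;> simp [h0, h0']

/-- A maximal partial isomorphism, viewed as a subfield of the first ordered field. -/
def SignCompat.subfield (hG : Maximal SignCompat G) : Subfield R₁ where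
  __ := G.map (RingHom.fst R₁ R₂)
  inv_mem' := by
    rintro _ ⟨z, hz, rfl⟩
    exact ⟨_, SignCompat.inv_mem hG hz, rfl⟩

lemma SignCompat.exists_pair (hG : Maximal SignCompat G) (x : SignCompat.subfield hG) :
    ∃ y, ((x : R₁), y) ∈ G := by
  obtain ⟨x, z, hz, rfl⟩ := x
  exact ⟨z.2, hz⟩

lemma SignCompat.eq_of_mem (hG : SignCompat G) {x : R₁} {y y' : R₂} (h : (x, y) ∈ G)
    (h' : (x, y') ∈ G) : y = y' := by
  have := (hG.eq_zero_iff (G.sub_mem h h')).1 (by simp)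
  simpa [sub_eq_zero] using this

/-- The embedding in the second ordered field given by a maximal partial isomorphism. -/
def SignCompat.hom (hG : Maximal SignCompat G) : SignCompat.subfield hG →+* R₂ where
  toFun x := (SignCompat.exists_pair hG x).choose
  map_one' := hG.1.eq_of_mem (SignCompat.exists_pair hG 1).choose_spec G.one_mem
  map_zero' := hG.1.eq_of_mem (SignCompat.exists_pair hG 0).choose_spec G.zero_mem
  map_add' x y := hG.1.eq_of_mem (SignCompat.exists_pair hG (x + y)).choose_spec
    (G.add_mem (SignCompat.exists_pair hG x).choose_spec (SignCompat.exists_pair hG y).choose_spec)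
  map_mul' x y := hG.1.eq_of_mem (SignCompat.exists_pair hG (x * y)).choose_spec
    (G.mul_mem (SignCompat.exists_pair hG x).choose_spec (SignCompat.exists_pair hG y).choose_spec)

lemma SignCompat.hom_mem (hG : Maximal SignCompat G) (x : SignCompat.subfield hG) :
    ((x : R₁), SignCompat.hom hG x) ∈ G := (SignCompat.exists_pair hG x).choose_spec

/-- A maximal partial isomorphism is closed under adjoining pairs realizing the same signs. -/
lemma SignCompat.mem_of_same_signs (hG : Maximal SignCompat G) {a : R₁} {b : R₂}
    (h : ∀ g : Polynomial (SignCompat.subfield hG),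
      0 < (g.map (SignCompat.subfield hG).subtype).eval a ↔
        0 < (g.map (SignCompat.hom hG)).eval b) : (a, b) ∈ G := by
  let e : Polynomial (SignCompat.subfield hG) →+* R₁ × R₂ :=
    (Polynomial.eval₂RingHom (SignCompat.subfield hG).subtype a).prod
      (Polynomial.eval₂RingHom (SignCompat.hom hG) b)
  refine hG.2 (y := e.range) ?_ ?_ ⟨Polynomial.X, by simp [e]⟩
  · rintro _ ⟨g, rfl⟩
    simpa [e, Polynomial.eval_map] using h g
  · intro z hz
    have hz1 : z.1 ∈ SignCompat.subfield hG := ⟨z, hz, rfl⟩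
    refine ⟨Polynomial.C ⟨z.1, hz1⟩, ?_⟩
    have := hG.1.eq_of_mem (SignCompat.hom_mem hG ⟨z.1, hz1⟩) hz
    ext
    · simp [e]
    · simpa [e] using this

lemma SignCompat.roots_mem (h₁ : ∀ d, PolyIVT R₁ d) (h₂ : ∀ d, PolyIVT R₂ d)
    (hG : Maximal SignCompat G) (d : ℕ) :
    ∀ f : Polynomial (SignCompat.subfield hG), f ≠ 0 → f.natDegree < d →
      (∀ x, (f.map (SignCompat.subfield hG).subtype).eval x = 0 →
        x ∈ (SignCompat.subfield hG).subtype.range) ∧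
      (∀ x, (f.map (SignCompat.hom hG)).eval x = 0 → x ∈ (SignCompat.hom hG).range) := by
  have hi : ∀ x, 0 < (SignCompat.subfield hG).subtype x ↔ 0 < SignCompat.hom hG x :=
    fun x => hG.1 _ (SignCompat.hom_mem hG x)
  induction d with
  | zero => intro f _ h; exact absurd h (Nat.not_lt_zero _)
  | succ d ih =>
    intro f hf hfd
    have hm : ∀ g : Polynomial (SignCompat.subfield hG), g ≠ 0 → g.natDegree < f.natDegree →
        g.natDegree < d := fun g _ h => by omega
    constructor
    · intro a ha
      by_contra har
      obtain ⟨b, hb⟩ := exists_same_signs h₁ h₂ hi hf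
        (fun g hg h => (ih g hg (hm g hg h)).1) (fun g hg h => (ih g hg (hm g hg h)).2) ha har
      have hmem := SignCompat.mem_of_same_signs hG hb
      exact har ⟨⟨a, _, hmem, rfl⟩, rfl⟩
    · intro a ha
      by_contra har
      obtain ⟨b, hb⟩ := exists_same_signs h₂ h₁ (fun x => (hi x).symm) hf
        (fun g hg h => (ih g hg (hm g hg h)).2) (fun g hg h => (ih g hg (hm g hg h)).1) ha har
      have hmem := SignCompat.mem_of_same_signs hG fun g => (hb g).symm
      refine har ⟨⟨b, _, hmem, rfl⟩, ?_⟩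
      exact hG.1.eq_of_mem (SignCompat.hom_mem hG _) hmem

/-- A partial isomorphism between ordered fields with the intermediate value property extends
to all elements algebraic over its domain. -/
theorem SignCompat.exists_extension (h₁ : ∀ d, PolyIVT R₁ d) (h₂ : ∀ d, PolyIVT R₂ d)
    (hG : SignCompat G) :
    ∃ G' : Subring (R₁ × R₂), G ≤ G' ∧ SignCompat G' ∧
      ∀ x, IsAlgebraic (Subfield.closure (G.map (RingHom.fst R₁ R₂) : Set R₁)) x →
        ∃ y, (x, y) ∈ G' := by
  obtain ⟨G', hle, hG'⟩ := hG.exists_maximal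
  refine ⟨G', hle, hG'.1, fun x hx => ?_⟩
  have hsub : Subfield.closure (G.map (RingHom.fst R₁ R₂) : Set R₁) ≤
      SignCompat.subfield hG' := by
    rw [Subfield.closure_le]
    rintro _ ⟨z, hz, rfl⟩
    exact ⟨z, hle hz, rfl⟩
  obtain ⟨f, hf, hfx⟩ := hx
  let j : _ →+* SignCompat.subfield hG' := Subfield.inclusion hsub
  have hj : f.map j ≠ 0 := (Polynomial.map_ne_zero_iff j.injective).2 hf
  have := (SignCompat.roots_mem h₁ h₂ hG' _ (f.map j) hj (Nat.lt_succ_self _)).1 x (by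
    rw [Polynomial.map_map, Polynomial.eval_map]
    exact hfx)
  obtain ⟨⟨_, z, hz, rfl⟩, rfl⟩ := this
  exact ⟨z.2, hz⟩

end PartialIso

section Transfer

lemma germ_coeRingHom_surjective {α R : Type*} [CommRing R] (l : Filter α) (a : l.Germ R) :
    ∃ u, Filter.Germ.coeRingHom l u = a := by
  induction a using Filter.Germ.inductionOn with
  | _ u => exact ⟨u, rfl⟩

/-- An ultrapower of an ordered field with the intermediate value property has it too. -/
lemma PolyIVT.germ {α R : Type*} [Field R] [LinearOrder R] [IsStrictOrderedRing R]
    (𝒰 : Ultrafilter α) (hR : ∀ d, PolyIVT R d) (d : ℕ) :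
    PolyIVT ((𝒰 : Filter α).Germ R) d := by
  intro f _ a b hab ha hb
  obtain ⟨u, rfl⟩ := germ_coeRingHom_surjective (𝒰 : Filter α) a
  obtain ⟨v, rfl⟩ := germ_coeRingHom_surjective (𝒰 : Filter α) b
  choose c hc using fun i => germ_coeRingHom_surjective (𝒰 : Filter α) (f.coeff i)
  let g : α → Polynomial R := fun s =>
    ∑ i ∈ Finset.range (f.natDegree + 1), Polynomial.C (c i s) * Polynomial.X ^ i
  have key : ∀ w : α → R, f.eval (Filter.Germ.coeRingHom (𝒰 : Filter α) w) =
      Filter.Germ.coeRingHom (𝒰 : Filter α) fun s => (g s).eval (w s) := by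
    intro w
    have : (fun s => (g s).eval (w s)) =
        ∑ i ∈ Finset.range (f.natDegree + 1), c i * w ^ i := by
      ext s
      simp [g, Polynomial.eval_finsetSum]
    rw [this, map_sum, Polynomial.eval_eq_sum_range]
    simp [map_mul, map_pow, hc]
  rw [key] at ha hb
  have ha' := Filter.Germ.coe_lt.1 ha
  have hb' := Filter.Germ.coe_lt.1 hb
  have hab' := Filter.Germ.coe_lt.1 hab
  have hex : ∀ s, ∃ x, u s < v s → (g s).eval (u s) < 0 → 0 < (g s).eval (v s) →
      u s < x ∧ x < v s ∧ (g s).eval x = 0 := by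
    intro s
    by_cases h : u s < v s ∧ (g s).eval (u s) < 0 ∧ 0 < (g s).eval (v s)
    · obtain ⟨x, hx⟩ := hR _ (g s) (Nat.lt_succ_self _) _ _ h.1 h.2.1 h.2.2
      exact ⟨x, fun _ _ _ => hx⟩
    · exact ⟨0, fun h1 h2 h3 => absurd ⟨h1, h2, h3⟩ h⟩
  choose w hw using hex
  have hall : ∀ᶠ s in (𝒰 : Filter α), u s < w s ∧ w s < v s ∧ (g s).eval (w s) = 0 := by
    filter_upwards [ha', hb', hab'] with s h1 h2 h3 using hw s h3 h1 h2
  refine ⟨Filter.Germ.coeRingHom (𝒰 : Filter α) w, ?_, ?_, ?_⟩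
  · exact Filter.Germ.coe_lt.2 (hall.mono fun _ h => h.1)
  · exact Filter.Germ.coe_lt.2 (hall.mono fun _ h => h.2.1)
  · rw [key]
    exact Filter.Germ.coe_eq.2 (hall.mono fun _ h => h.2.2)

variable {L : Type*} [Field L] [LinearOrder L] [IsStrictOrderedRing L]

omit [IsStrictOrderedRing L] in
lemma PolyIVT.subfield (hL : ∀ d, PolyIVT L d) (F : Subfield L)
    (hF : ∀ x, IsAlgebraic F x → x ∈ F) (d : ℕ) : PolyIVT F d := by
  intro f _ a b hab ha hb
  have hev : ∀ x : F, (f.map F.subtype).eval (x : L) = ((f.eval x : F) : L) := fun x => by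
    exact Polynomial.eval_map_apply (f := F.subtype) x
  obtain ⟨c, hac, hcb, hc⟩ := hL _ (f.map F.subtype) (Nat.lt_succ_self _) a b hab
    (by rw [hev]; exact ha) (by rw [hev]; exact hb)
  have hmem : c ∈ F := hF c ⟨f, fun h => by simp [h] at ha, by
    rw [Polynomial.eval_map] at hc; exact hc⟩
  refine ⟨⟨c, hmem⟩, hac, hcb, ?_⟩
  have := hev ⟨c, hmem⟩
  rw [hc] at this
  exact_mod_cast this.symm

lemma SignCompat.eval₂_eq_zero_iff {R₂ σ : Type*} [Field R₂] [LinearOrder R₂]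
    [IsStrictOrderedRing R₂] {G : Subring (L × R₂)} (hG : SignCompat G) {j : ℝ →+* L}
    {j₂ : ℝ →+* R₂} (hj : ∀ r, (j r, j₂ r) ∈ G) {x : σ → L} {y : σ → R₂}
    (hxy : ∀ i, (x i, y i) ∈ G) (p : MvPolynomial σ ℝ) :
    eval₂ j x p = 0 ↔ eval₂ j₂ y p = 0 := by
  have h1 : eval₂ (j.prod j₂) (fun i => (x i, y i)) p ∈ G := by
    refine MvPolynomial.eval₂_mem (f := j.prod j₂) (s := G) ?_ ?_
    · intro i _; exact hj _
    · intro i; exact hxy i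
  have h2 := hG.eq_zero_iff h1
  have e1 : (eval₂ (j.prod j₂) (fun i => (x i, y i)) p).1 = eval₂ j x p :=
    MvPolynomial.eval₂_comp_left (RingHom.fst L R₂) _ _ _
  have e2 : (eval₂ (j.prod j₂) (fun i => (x i, y i)) p).2 = eval₂ j₂ y p :=
    MvPolynomial.eval₂_comp_left (RingHom.snd L R₂) _ _ _
  rwa [e1, e2] at h2

lemma polyIVT_real (d : ℕ) : PolyIVT ℝ d := by
  intro f _ a b hab ha hb
  obtain ⟨c, hc, h⟩ := intermediate_value_Ioo hab.le f.continuous.continuousOn ⟨ha, hb⟩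
  exact ⟨c, hc.1, hc.2, h⟩

lemma ringHom_real_pos_iff (j : ℝ →+* L) (r : ℝ) : 0 < j r ↔ 0 < r := by
  have key : ∀ r : ℝ, 0 < r → 0 < j r := fun r hr => by
    rw [← Real.mul_self_sqrt hr.le, map_mul]
    exact mul_self_pos.2 ((map_ne_zero j).2 (Real.sqrt_pos.2 hr).ne')
  refine ⟨fun h => ?_, key r⟩
  by_contra hr
  rcases (not_lt.1 hr).eq_or_lt with h0 | h0
  · simp [h0] at h
  · have := key (-r) (by linarith)
    rw [map_neg] at this
    linarith

/-- A relatively algebraically closed subfield, containing the reals, in which real polynomial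
equations are only solvable if they are over the reals. -/
structure RealTransfer (j : ℝ →+* L) (F : Subfield L) : Prop where
  range_le : ∀ r, j r ∈ F
  isAlgebraic_mem : ∀ x, IsAlgebraic F x → x ∈ F
  exists_zero : ∀ {n : ℕ} (p : MvPolynomial (Fin n) ℝ) (x : Fin n → L), (∀ i, x i ∈ F) →
    eval₂ j x p = 0 → ∃ z : Fin n → ℝ, eval z p = 0

lemma realTransfer_range (hL : ∀ d, PolyIVT L d) (j : ℝ →+* L) :
    RealTransfer j j.fieldRange := by
  refine ⟨fun r => ⟨r, rfl⟩, fun x hx => ?_, fun p x hx h => ?_⟩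
  · let G : Subring (L × ℝ) := (j.prod (RingHom.id ℝ)).range
    have hG : SignCompat G := by
      rintro _ ⟨r, rfl⟩
      exact ringHom_real_pos_iff j r
    obtain ⟨G', hle, hG', hext⟩ := hG.exists_extension hL polyIVT_real
    have hle' : j.fieldRange ≤ Subfield.closure (G.map (RingHom.fst L ℝ) : Set L) := by
      rintro _ ⟨r, rfl⟩
      exact Subfield.subset_closure ⟨(j r, r), ⟨r, rfl⟩, rfl⟩
    obtain ⟨y, hy⟩ := hext x (by
      obtain ⟨f, hf, hfx⟩ := hx
      refine ⟨f.map (Subfield.inclusion hle'),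
        (Polynomial.map_ne_zero_iff (Subfield.inclusion hle').injective).2 hf, ?_⟩
      rw [Polynomial.aeval_def, Polynomial.eval₂_map]
      exact hfx)
    have := G'.sub_mem hy (hle ⟨y, rfl⟩ : (j y, y) ∈ G')
    have h0 := (hG'.eq_zero_iff this).2 (by simp)
    exact ⟨y, (sub_eq_zero.1 h0).symm⟩
  · choose z hz using hx
    refine ⟨z, j.injective ?_⟩
    rw [map_zero, ← h, ← funext hz]
    exact MvPolynomial.eval₂_comp_left j (RingHom.id ℝ) z p

lemma exists_between_cut (F : Subfield L) {t : L} (K : Finset F) :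
    ∃ s : F, ∀ c ∈ K, ((c : L) < t → c < s) ∧ (t < c → s < c) := by
  classical
  obtain ⟨m, hm1, hm2⟩ := Order.exists_between_finsets (K.filter fun c : F => (c : L) < t)
    (K.filter fun c : F => t < c) (fun x hx y hy => by
      have := (Finset.mem_filter.1 hx).2.trans (Finset.mem_filter.1 hy).2
      exact this)
  exact ⟨m, fun c hc => ⟨fun h => hm1 c (Finset.mem_filter.2 ⟨hc, h⟩),
    fun h => hm2 c (Finset.mem_filter.2 ⟨hc, h⟩)⟩⟩

lemma RealTransfer.exists_adjoin (hL : ∀ d, PolyIVT L d) {j : ℝ →+* L} {F : Subfield L}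
    (hF : RealTransfer j F) (t : L) : ∃ F', RealTransfer j F' ∧ F ≤ F' ∧ t ∈ F' := by
  classical
  by_cases ht : t ∈ F
  · exact ⟨F, hF, le_rfl, ht⟩
  choose s hs using fun K : Finset F => exists_between_cut F (t := t) K
  let 𝒰 : Ultrafilter (Finset F) := Ultrafilter.of Filter.atTop
  have hmem : ∀ c : F, ∀ᶠ K in (𝒰 : Filter (Finset F)), c ∈ K := fun c =>
    Ultrafilter.of_le Filter.atTop ((Filter.eventually_ge_atTop {c}).mono fun K hK =>
      hK (Finset.mem_singleton_self c))
  let ψ : Polynomial F →+* (𝒰 : Filter (Finset F)).Germ F :=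
    (Filter.Germ.coeRingHom (𝒰 : Filter (Finset F))).comp
      (RingHom.pi fun K => Polynomial.evalRingHom (s K))
  let e : Polynomial F →+* L × (𝒰 : Filter (Finset F)).Germ F :=
    (Polynomial.eval₂RingHom F.subtype t).prod ψ
  have hpos : ∀ g : Polynomial F, 0 < g.eval₂ F.subtype t → 0 < ψ g := by
    intro g hg
    have hg0 : g.map F.subtype ≠ 0 := by
      rw [Polynomial.map_ne_zero_iff F.subtype.injective]
      rintro rfl; simp at hg
    have hev : ∀ᶠ K in (𝒰 : Filter (Finset F)), ∀ c ∈ (g.map F.subtype).roots.toFinset,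
        (c < t → c < s K) ∧ (t < c → (s K : L) < c) := by
      rw [Filter.eventually_all_finset]
      intro c hc
      have hc' : c ∈ F := hF.isAlgebraic_mem c ⟨g, by rintro rfl; simp at hg0, by
        have := (Polynomial.mem_roots'.1 (Multiset.mem_toFinset.1 hc)).2
        rwa [Polynomial.IsRoot.def, Polynomial.eval_map] at this⟩
      filter_upwards [hmem ⟨c, hc'⟩] with K hK using hs K _ hK
    refine Filter.Germ.coe_pos.2 (hev.mono fun K hK => ?_)
    have hst : (s K : L) ≠ t := fun h => ht (h ▸ (s K).2)
    have hK' : ∀ c, (g.map F.subtype).eval c = 0 → (c < t → c < s K) ∧ (t < c → (s K : L) < c) :=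
      fun c hc => hK c (by simp [hg0, hc])
    have htz : (g.map F.subtype).eval t ≠ 0 := by rw [Polynomial.eval_map]; exact hg.ne'
    have hprod : 0 < (g.map F.subtype).eval (s K : L) * (g.map F.subtype).eval t := by
      rcases hst.lt_or_gt with h | h
      · refine (hL _).mul_pos (Nat.lt_succ_self _) h.le fun c hc1 hc2 hc => ?_
        rcases hc2.eq_or_lt with rfl | h2
        · exact htz hc
        · exact absurd ((hK' c hc).1 h2) (not_lt.2 hc1)
      · rw [mul_comm]
        refine (hL _).mul_pos (Nat.lt_succ_self _) h.le fun c hc1 hc2 hc => ?_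
        rcases hc1.eq_or_lt with rfl | h2
        · exact htz hc
        · exact absurd ((hK' c hc).2 h2) (not_lt.2 hc2)
    rw [Polynomial.eval_map (x := t), mul_pos_iff_of_pos_right hg] at hprod
    have : (g.map F.subtype).eval (s K : L) = ((g.eval (s K) : F) : L) :=
      Polynomial.eval_map_apply (f := F.subtype) (s K)
    rw [this] at hprod
    exact hprod
  have hG : SignCompat e.range := by
    rintro _ ⟨g, rfl⟩
    change 0 < g.eval₂ F.subtype t ↔ 0 < ψ g
    refine ⟨hpos g, fun h => ?_⟩
    by_contra hn
    rcases (not_lt.1 hn).eq_or_lt with h0 | h0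
    · have : g = 0 := by
        by_contra hg
        exact ht (hF.isAlgebraic_mem t ⟨g, hg, h0⟩)
      simp [this] at h
    · have := hpos (-g) (by rw [Polynomial.eval₂_neg]; linarith)
      rw [map_neg] at this
      linarith
  obtain ⟨G', hle, hG', hext⟩ := hG.exists_extension hL
    (PolyIVT.germ 𝒰 (PolyIVT.subfield hL F hF.isAlgebraic_mem))
  let K : Subfield L := Subfield.closure (e.range.map (RingHom.fst L _) : Set L)
  have hFK : ∀ x ∈ F, x ∈ K := fun x hx => Subfield.subset_closure
    ⟨e (Polynomial.C ⟨x, hx⟩), ⟨_, rfl⟩, by simp [e]⟩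
  have hKc : ∀ x ∈ K, x ∈ algebraicClosure K L := fun x hx =>
    (algebraicClosure K L).algebraMap_mem ⟨x, hx⟩
  refine ⟨(algebraicClosure K L).toSubfield, ⟨fun r => hKc _ (hFK _ (hF.range_le r)), ?_, ?_⟩,
    fun x hx => hKc _ (hFK _ hx), hKc _ (Subfield.subset_closure
      ⟨e Polynomial.X, ⟨_, rfl⟩, by simp [e]⟩)⟩
  · intro x hx
    have hx' : IsAlgebraic (algebraicClosure K L) x := hx
    exact mem_algebraicClosure_iff.2 (hx'.restrictScalars K)
  · intro n p x hx h
    choose y hy using fun i => hext (x i) (mem_algebraicClosure_iff.1 (hx i))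
    let jF : ℝ →+* F := j.codRestrict F hF.range_le
    let j₂ : ℝ →+* (𝒰 : Filter (Finset F)).Germ F :=
      (Filter.Germ.coeRingHom (𝒰 : Filter (Finset F))).comp (RingHom.pi fun _ => jF)
    have hj : ∀ r, (j r, j₂ r) ∈ G' := fun r => hle ⟨Polynomial.C (jF r), by
      ext
      · simp [e, jF]
      · simp only [e, ψ, j₂, RingHom.prod_apply, RingHom.comp_apply]
        congr 1
        ext K
        exact congrArg Subtype.val (Polynomial.eval_C (a := jF r) (x := s K))⟩
    have h2 := (hG'.eval₂_eq_zero_iff hj hy p).1 h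
    choose v hv using fun i => germ_coeRingHom_surjective (𝒰 : Filter (Finset F)) (y i)
    have h3 : eval₂ j₂ y p = Filter.Germ.coeRingHom (𝒰 : Filter (Finset F))
        (fun K => eval₂ jF (fun i => v i K) p) := by
      rw [← funext hv]
      have := MvPolynomial.eval₂_comp_left (Filter.Germ.coeRingHom (𝒰 : Filter (Finset F)))
        (RingHom.pi fun _ => jF) v p
      rw [show eval₂ j₂ (fun i => Filter.Germ.coeRingHom (𝒰 : Filter (Finset F)) (v i)) p = _
        from this.symm]
      congr 1
      ext K
      have := MvPolynomial.eval₂_comp_left (Pi.evalRingHom (fun _ : Finset F => F) K)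
        (RingHom.pi fun _ => jF) v p
      exact congrArg Subtype.val this
    rw [h3] at h2
    obtain ⟨K, hK⟩ := (Filter.Germ.coe_eq.1 h2 : ∀ᶠ K in (𝒰 : Filter (Finset F)), _ = _).exists
    refine hF.exists_zero p (fun i => v i K) (fun i => (v i K).2) ?_
    have := MvPolynomial.eval₂_comp_left F.subtype jF (fun i => v i K) p
    exact this.symm.trans (congrArg Subtype.val hK)

/-- Real polynomial equations solvable in an ordered field with the intermediate value property
are solvable in the reals. -/
theorem exists_real_zero (hL : ∀ d, PolyIVT L d) (j : ℝ →+* L) {σ : Type*} [Finite σ]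
    (p : MvPolynomial σ ℝ) (x : σ → L) (h : eval₂ j x p = 0) : ∃ z : σ → ℝ, eval z p = 0 := by
  classical
  obtain ⟨n, ⟨e⟩⟩ := Finite.exists_equiv_fin σ
  have hs : ∀ s : Finset σ, ∃ F, RealTransfer j F ∧ ∀ i ∈ s, x i ∈ F := by
    intro s
    induction s using Finset.induction_on with
    | empty => exact ⟨_, realTransfer_range hL j, by simp⟩
    | insert a s _ ih =>
      obtain ⟨F, hF, hs⟩ := ih
      obtain ⟨F', hF', hle, ha⟩ := hF.exists_adjoin hL (x a)
      refine ⟨F', hF', fun i hi => ?_⟩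
      rcases Finset.mem_insert.1 hi with rfl | hi
      · exact ha
      · exact hle (hs i hi)
  have := Fintype.ofFinite σ
  obtain ⟨F, hF, hx⟩ := hs Finset.univ
  obtain ⟨z, hz⟩ := hF.exists_zero (rename e p) (fun i => x (e.symm i))
    (fun i => hx _ (Finset.mem_univ _)) (by
      rw [eval₂_rename]
      convert h using 2
      ext i
      simp)
  exact ⟨fun i => z (e i), by rwa [eval_rename] at hz⟩

lemma PolyIVT.exists_mul_self (hL : ∀ d, PolyIVT L d) {a : L} (ha : 0 ≤ a) : ∃ y, a = y * y := by
  rcases ha.eq_or_lt with rfl | ha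
  · exact ⟨0, by simp⟩
  obtain ⟨c, _, _, hc⟩ := hL _ (Polynomial.X * Polynomial.X - Polynomial.C a) (Nat.lt_succ_self _)
    0 (a + 1) (by linarith) (by simpa using ha) (by simp; nlinarith)
  exact ⟨c, by simpa [sub_eq_zero, eq_comm] using hc⟩

/-- A Positivstellensatz: a real polynomial `p` vanishing on a set defined by finitely many
inequalities `0 ≤ q i` has an even power whose opposite lies in any preordering containing the
`q i`. -/
theorem exists_neg_pow_mem {σ : Type} [Finite σ] {ι : Type} [Finite ι]
    (T : Subsemiring (MvPolynomial σ ℝ)) (hsq : ∀ a, a * a ∈ T) (q : ι → MvPolynomial σ ℝ)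
    (hq : ∀ i, q i ∈ T) (p : MvPolynomial σ ℝ)
    (hp : ∀ z, (∀ i, 0 ≤ eval z (q i)) → eval z p = 0) : ∃ l : ℕ, -p ^ (2 * l) ∈ T := by
  by_contra! hcon
  obtain ⟨L, _, _, _, φ, hL, hT, hφ⟩ := exists_orderedField_hom T hsq p hcon
  have := Fintype.ofFinite ι
  choose y hy using fun i => PolyIVT.exists_mul_self hL (hT _ (hq i))
  let j : ℝ →+* L := φ.comp C
  let x : σ ⊕ Option ι → L :=
    Sum.elim (fun s => φ (X s)) fun i => i.elim (φ p)⁻¹ y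
  have hev : ∀ f : MvPolynomial σ ℝ, eval₂ j x (rename Sum.inl f) = φ f := fun f => by
    rw [eval₂_rename]
    have : φ f = eval₂ (φ.comp C) (φ ∘ X) f := by
      rw [← MvPolynomial.eval₂_comp_left φ C X f, MvPolynomial.eval₂_eta]
    rw [this]
    rfl
  obtain ⟨z, hz⟩ := exists_real_zero hL j
    ((rename Sum.inl p * X (Sum.inr none) - 1) ^ 2 +
      ∑ i, (rename Sum.inl (q i) - X (Sum.inr (some i)) * X (Sum.inr (some i))) ^ 2) x (by
    rw [← coe_eval₂Hom]
    simp only [map_add, map_sum, map_pow, map_sub, map_mul, map_one, coe_eval₂Hom, hev, eval₂_X]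
    simp [x, hφ, ← hy])
  simp only [map_add, map_sum, map_pow, map_sub, map_mul, map_one, eval_X, eval_rename] at hz
  have h1 := sq_nonneg (eval (z ∘ Sum.inl) p * z (Sum.inr none) - 1)
  have h2 : ∀ i ∈ Finset.univ, 0 ≤ (eval (z ∘ Sum.inl) (q i) -
    z (Sum.inr (some i)) * z (Sum.inr (some i))) ^ 2 := fun i _ => sq_nonneg _
  have h3 := Finset.sum_nonneg h2
  have h4 : ∀ i, 0 ≤ eval (z ∘ Sum.inl) (q i) := fun i => by
    have h5 := (Finset.sum_eq_zero_iff_of_nonneg h2).1 (by linarith) i (Finset.mem_univ i)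
    nlinarith [mul_self_nonneg (z (Sum.inr (some i))), pow_eq_zero_iff (two_ne_zero) |>.1 h5]
  have h5 : (eval (z ∘ Sum.inl) p * z (Sum.inr none) - 1) ^ 2 = 0 := by linarith
  rw [hp _ h4] at h5
  norm_num at h5

end Transfer

section QuadModule

variable {σ : Type}

/-- A quadratic module of real polynomials. -/
structure IsQuadModule (Q : Set (MvPolynomial σ ℝ)) : Prop where
  one_mem : 1 ∈ Q
  add_mem : ∀ {a b}, a ∈ Q → b ∈ Q → a + b ∈ Q
  mul_self_mul_mem : ∀ a {q}, q ∈ Q → a * a * q ∈ Q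

namespace IsQuadModule

variable {Q : Set (MvPolynomial σ ℝ)} (hQ : IsQuadModule Q)
include hQ

lemma C_mul_mem {r : ℝ} (hr : 0 ≤ r) {q : MvPolynomial σ ℝ} (hq : q ∈ Q) : C r * q ∈ Q := by
  have := hQ.mul_self_mul_mem (C √r) hq
  rwa [← C_mul, Real.mul_self_sqrt hr] at this

lemma C_mem {r : ℝ} (hr : 0 ≤ r) : (C r : MvPolynomial σ ℝ) ∈ Q := by
  simpa using hQ.C_mul_mem hr hQ.one_mem

lemma zero_mem : (0 : MvPolynomial σ ℝ) ∈ Q := by simpa using hQ.C_mem le_rfl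

lemma mul_self_mem (a : MvPolynomial σ ℝ) : a * a ∈ Q := by
  simpa using hQ.mul_self_mul_mem a hQ.one_mem

lemma sumSq_mul_mem {s : MvPolynomial σ ℝ} (hs : IsSumSq s) {q : MvPolynomial σ ℝ} (hq : q ∈ Q) :
    s * q ∈ Q := by
  induction hs with
  | zero => simpa using hQ.zero_mem
  | sq_add a _ ih => rw [add_mul]; exact hQ.add_mem (hQ.mul_self_mul_mem a hq) ih

lemma sumSq_mem {s : MvPolynomial σ ℝ} (hs : IsSumSq s) : s ∈ Q := by
  simpa using hQ.sumSq_mul_mem hs hQ.one_mem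

lemma sum_mem {ι : Type*} (t : Finset ι) (f : ι → MvPolynomial σ ℝ) (h : ∀ i ∈ t, f i ∈ Q) :
    ∑ i ∈ t, f i ∈ Q := Finset.sum_induction f (· ∈ Q) (fun _ _ => hQ.add_mem) hQ.zero_mem h

lemma mem_of_C_mul_mem {r : ℝ} (hr : 0 < r) {q : MvPolynomial σ ℝ} (hq : C r * q ∈ Q) : q ∈ Q := by
  have := hQ.C_mul_mem (inv_nonneg.2 hr.le) hq
  rwa [← mul_assoc, ← C_mul, inv_mul_cancel₀ hr.ne', C_1, one_mul] at this

lemma C_mem_mono {r s : ℝ} (hrs : r ≤ s) {f : MvPolynomial σ ℝ} (h : C r + f ∈ Q) :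
    C s + f ∈ Q := by
  have := hQ.add_mem (hQ.C_mem (sub_nonneg.2 hrs)) h
  rwa [← add_assoc, ← C_add, sub_add_cancel] at this

lemma sq_sub_sq_mem {r : ℝ} (hr : 0 < r) {f : MvPolynomial σ ℝ} (h1 : C r - f ∈ Q)
    (h2 : C r + f ∈ Q) : C (r ^ 2) - f * f ∈ Q := by
  refine hQ.mem_of_C_mul_mem (r := 2 * r) (by positivity) ?_
  have := hQ.add_mem (hQ.mul_self_mul_mem (C r + f) h1) (hQ.mul_self_mul_mem (C r - f) h2)
  convert this using 1
  simp only [C_mul, C_pow, map_ofNat]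
  ring

/-- A quadratic module bounding the norm of the variables bounds all polynomials. -/
lemma exists_C_sub_mem [Fintype σ] {N : ℝ} (hN : C N - ∑ i, X i * X i ∈ Q)
    (f : MvPolynomial σ ℝ) : ∃ r : ℝ, 0 < r ∧ C r - f ∈ Q ∧ C r + f ∈ Q := by
  classical
  have hadd : ∀ f g : MvPolynomial σ ℝ, (∃ r : ℝ, 0 < r ∧ C r - f ∈ Q ∧ C r + f ∈ Q) →
      (∃ r : ℝ, 0 < r ∧ C r - g ∈ Q ∧ C r + g ∈ Q) →
      ∃ r : ℝ, 0 < r ∧ C r - (f + g) ∈ Q ∧ C r + (f + g) ∈ Q := by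
    rintro f g ⟨r, hr, h1, h2⟩ ⟨s, hs, h3, h4⟩
    refine ⟨r + s, add_pos hr hs, ?_, ?_⟩
    · convert hQ.add_mem h1 h3 using 1; rw [C_add]; ring
    · convert hQ.add_mem h2 h4 using 1; rw [C_add]; ring
  have hneg : ∀ f : MvPolynomial σ ℝ, (∃ r : ℝ, 0 < r ∧ C r - f ∈ Q ∧ C r + f ∈ Q) →
      ∃ r : ℝ, 0 < r ∧ C r - (-f) ∈ Q ∧ C r + (-f) ∈ Q := by
    rintro f ⟨r, hr, h1, h2⟩
    exact ⟨r, hr, by simpa using h2, by simpa [← sub_eq_add_neg] using h1⟩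
  have hsq : ∀ f : MvPolynomial σ ℝ, (∃ r : ℝ, 0 < r ∧ C r - f ∈ Q ∧ C r + f ∈ Q) →
      ∃ r : ℝ, 0 < r ∧ C r - C (1 / 4) * (f * f) ∈ Q ∧ C r + C (1 / 4) * (f * f) ∈ Q := by
    rintro f ⟨r, hr, h1, h2⟩
    have h3 := hQ.C_mul_mem (r := 1 / 4) (by norm_num) (hQ.sq_sub_sq_mem hr h1 h2)
    refine ⟨1 / 4 * r ^ 2, by positivity, ?_, ?_⟩
    · rwa [mul_sub, ← C_mul] at h3
    · exact hQ.add_mem (hQ.C_mem (by positivity))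
        (hQ.C_mul_mem (by norm_num) (hQ.mul_self_mem f))
  have hmul : ∀ f g : MvPolynomial σ ℝ, (∃ r : ℝ, 0 < r ∧ C r - f ∈ Q ∧ C r + f ∈ Q) →
      (∃ r : ℝ, 0 < r ∧ C r - g ∈ Q ∧ C r + g ∈ Q) →
      ∃ r : ℝ, 0 < r ∧ C r - (f * g) ∈ Q ∧ C r + (f * g) ∈ Q := by
    intro f g hf hg
    have h := hadd _ _ (hsq _ (hadd _ _ hf hg)) (hneg _ (hsq _ (hadd _ _ hf (hneg _ hg))))
    have h4 : (C (1 / 4) : MvPolynomial σ ℝ) * 4 = 1 := by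
      rw [← map_ofNat C 4, ← C_mul]; norm_num
    have h5 : f * g = C (1 / 4) * ((f + g) * (f + g)) +
        -(C (1 / 4) * ((f + -g) * (f + -g))) := by linear_combination (-(f * g)) * h4
    rwa [← h5] at h
  induction f using MvPolynomial.induction_on with
  | C a =>
    refine ⟨|a| + 1, by positivity, ?_, ?_⟩
    · rw [← C_sub]; exact hQ.C_mem (by linarith [le_abs_self a])
    · rw [← C_add]; exact hQ.C_mem (by linarith [neg_abs_le a])
  | add p q hp hq => exact hadd p q hp hq
  | mul_X p i hp =>
    refine hmul p (X i) hp ⟨|N| + 1 / 4, by positivity, ?_, ?_⟩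
    all_goals
      try rw [sub_eq_add_neg]
      refine hQ.C_mem_mono (r := N + 1 / 4) (by linarith [le_abs_self N]) ?_
      have h1 := hQ.sum_mem (Finset.univ.erase i) (fun j => X j * X j)
        fun j _ => hQ.mul_self_mem (X j)
      have h2 := hQ.mul_self_mem (X i - C (1 / 2))
      have h2' := hQ.mul_self_mem (X i + C (1 / 2))
      have h3 := Finset.add_sum_erase Finset.univ (fun j => X j * X j : σ → MvPolynomial σ ℝ)
        (Finset.mem_univ i)
      have hC : (C (1 / 2) : MvPolynomial σ ℝ) * 2 = 1 := by
        rw [← map_ofNat C 2, ← C_mul]; norm_num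
      have hC4 : (C (1 / 4) : MvPolynomial σ ℝ) = C (1 / 2) * C (1 / 2) := by
        rw [← C_mul]; norm_num
      rw [C_add, hC4]
    · convert hQ.add_mem hN (hQ.add_mem h1 h2) using 1
      linear_combination (-1 : MvPolynomial σ ℝ) * h3 + X i * hC
    · convert hQ.add_mem hN (hQ.add_mem h1 h2') using 1
      linear_combination (-1 : MvPolynomial σ ℝ) * h3 - X i * hC

/-- Adding a generator to a quadratic module. -/
lemma adjoin (g : MvPolynomial σ ℝ) :
    IsQuadModule {f | ∃ q ∈ Q, ∃ s, IsSumSq s ∧ f = q + g * s} where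
  one_mem := ⟨1, hQ.one_mem, 0, .zero, by simp⟩
  add_mem := by
    rintro _ _ ⟨q, hq, s, hs, rfl⟩ ⟨q', hq', s', hs', rfl⟩
    exact ⟨q + q', hQ.add_mem hq hq', s + s', hs.add hs', by ring⟩
  mul_self_mul_mem := by
    rintro a _ ⟨q, hq, s, hs, rfl⟩
    exact ⟨a * a * q, hQ.mul_self_mul_mem a hq, a * a * s, (IsSumSq.mul_self a).mul hs, by ring⟩

lemma mul_mem_of_mem_of_neg_mem {f : MvPolynomial σ ℝ} (h : f ∈ Q) (h' : -f ∈ Q)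
    (g : MvPolynomial σ ℝ) : f * g ∈ Q := by
  have h1 := hQ.mul_self_mul_mem (g + 1) h
  have h2 := hQ.mul_self_mul_mem (g - 1) h'
  refine hQ.mem_of_C_mul_mem (r := 4) (by norm_num) ?_
  convert hQ.add_mem h1 h2 using 1
  rw [map_ofNat]; ring

end IsQuadModule

lemma IsQuadModule.exists_maximal {Q : Set (MvPolynomial σ ℝ)} (hQ : IsQuadModule Q)
    (h1 : (-1 : MvPolynomial σ ℝ) ∉ Q) :
    ∃ P, Q ⊆ P ∧ Maximal (fun P : Set (MvPolynomial σ ℝ) => IsQuadModule P ∧ -1 ∉ P) P := by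
  refine zorn_subset_nonempty {P : Set (MvPolynomial σ ℝ) | IsQuadModule P ∧ -1 ∉ P} ?_ Q ⟨hQ, h1⟩
  intro c hc hchain ⟨y, hy⟩
  refine ⟨⋃₀ c, ⟨⟨⟨y, hy, (hc hy).1.one_mem⟩, ?_, ?_⟩, ?_⟩, fun s hs => Set.subset_sUnion_of_mem hs⟩
  · rintro a b ⟨s, hs, ha⟩ ⟨t, ht, hb⟩
    rcases hchain.total hs ht with h | h
    · exact ⟨t, ht, (hc ht).1.add_mem (h ha) hb⟩
    · exact ⟨s, hs, (hc hs).1.add_mem ha (h hb)⟩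
  · rintro a q ⟨s, hs, hq⟩
    exact ⟨s, hs, (hc hs).1.mul_self_mul_mem a hq⟩
  · rintro ⟨s, hs, h⟩
    exact (hc hs).2 h

lemma IsQuadModule.mem_or_neg_mem {P : Set (MvPolynomial σ ℝ)}
    (hP : Maximal (fun P : Set (MvPolynomial σ ℝ) => IsQuadModule P ∧ -1 ∉ P) P)
    (a : MvPolynomial σ ℝ) : a ∈ P ∨ -a ∈ P := by
  have hQ := hP.1.1
  have key : ∀ g, g ∉ P → ∃ q ∈ P, ∃ s, IsSumSq s ∧ -1 = q + g * s := by
    intro g hg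
    by_contra hcon
    have hle := hP.2 ⟨hQ.adjoin g, hcon⟩ (fun q hq => ⟨q, hq, 0, .zero, by simp⟩)
    exact hg (hle ⟨0, hQ.zero_mem, 1, by simpa using IsSumSq.mul_self (1 : MvPolynomial σ ℝ),
      by simp⟩)
  by_contra! hcon
  obtain ⟨q, hq, s, hs, h1⟩ := key a hcon.1
  obtain ⟨q', hq', s', hs', h2⟩ := key (-a) hcon.2
  have h3 : -s ∈ P := by
    convert hQ.add_mem (hQ.add_mem (hQ.sumSq_mul_mem hs' hq) (hQ.sumSq_mul_mem hs hq'))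
      (hQ.sumSq_mem hs') using 1
    linear_combination s' * h1 + s * h2
  have h4 := hQ.mul_mem_of_mem_of_neg_mem (hQ.sumSq_mem hs) h3 a
  refine hP.1.2 ?_
  rw [h1, mul_comm]
  exact hQ.add_mem hq h4

/-- A proper archimedean quadratic module is nonnegative at some real point. -/
theorem IsQuadModule.exists_eval_nonneg [Fintype σ] {Q : Set (MvPolynomial σ ℝ)}
    (hQ : IsQuadModule Q) {N : ℝ} (hN : C N - ∑ i, X i * X i ∈ Q)
    (h1 : (-1 : MvPolynomial σ ℝ) ∉ Q) : ∃ z : σ → ℝ, ∀ q ∈ Q, 0 ≤ eval z q := by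
  obtain ⟨P, hQP, hPmax⟩ := hQ.exists_maximal h1
  have hP := hPmax.1.1
  have hpr : ∀ r : ℝ, r < 0 → C r ∉ P := fun r hr h => hPmax.1.2 <| by
    refine hP.mem_of_C_mul_mem (r := -r) (by linarith) ?_
    simpa using h
  have harch := fun f => hP.exists_C_sub_mem (hQP hN) f
  have hval : ∀ a : MvPolynomial σ ℝ, ∃ r : ℝ, ∀ ε : ℝ, 0 < ε →
      C ε + (a - C r) ∈ P ∧ C ε - (a - C r) ∈ P := by
    intro a
    let S : Set ℝ := {s | a - C s ∈ P}
    obtain ⟨M, _, hM1, hM2⟩ := harch a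
    have hne : S.Nonempty := ⟨-M, by
      change a - C (-M) ∈ P
      rw [C_neg, sub_neg_eq_add, add_comm]; exact hM2⟩
    have hbdd : BddAbove S := ⟨M, fun s (hs : a - C s ∈ P) => by
      by_contra hlt
      refine hpr (M - s) (by linarith) ?_
      rw [C_sub]
      convert hP.add_mem hM1 hs using 1; ring⟩
    refine ⟨sSup S, fun ε hε => ⟨?_, ?_⟩⟩
    · obtain ⟨s, hs, hlt⟩ := exists_lt_of_lt_csSup hne (sub_lt_self (sSup S) hε)
      have hs' : a - C s ∈ P := hs
      convert hP.add_mem (hP.C_mem (r := s - (sSup S - ε)) (by linarith)) hs' using 1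
      simp only [C_sub]; ring
    · have : a - C (sSup S + ε) ∉ P := fun h => by
        have := le_csSup hbdd (show sSup S + ε ∈ S from h)
        linarith
      have := (IsQuadModule.mem_or_neg_mem hPmax _).resolve_left this
      convert this using 1
      rw [C_add]; ring
  choose z hz using fun i => hval (X i)
  refine ⟨z, fun q hq => ?_⟩
  have hall : ∀ f : MvPolynomial σ ℝ, ∀ ε : ℝ, 0 < ε →
      C ε + (f - C (eval z f)) ∈ P ∧ C ε - (f - C (eval z f)) ∈ P := by
    have hmul : ∀ h : MvPolynomial σ ℝ, (∀ ε : ℝ, 0 < ε → C ε + h ∈ P ∧ C ε - h ∈ P) →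
        ∀ g : MvPolynomial σ ℝ, ∀ ε : ℝ, 0 < ε → C ε - h * g ∈ P := by
      intro h hh g ε hε
      obtain ⟨M, hM, hM1, hM2⟩ := harch g
      have e1 : 0 < ε / M := by positivity
      have h2 := hP.sq_sub_sq_mem e1 (hh _ e1).2 (hh _ e1).1
      have h3 := hP.sq_sub_sq_mem hM hM1 hM2
      have h4 := hP.mul_self_mem (C M * h - C (ε / M) * g)
      refine hP.mem_of_C_mul_mem (r := 2 * ε) (by positivity) ?_
      convert hP.add_mem h4 (hP.add_mem (hP.C_mul_mem (sq_nonneg M) h2)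
        (hP.C_mul_mem (sq_nonneg (ε / M)) h3)) using 1
      have e2 : (C M : MvPolynomial σ ℝ) * C (ε / M) = C ε := by
        rw [← C_mul, mul_div_cancel₀ _ hM.ne']
      simp only [C_mul, C_pow, map_ofNat, ← e2]
      ring
    intro f
    induction f using MvPolynomial.induction_on with
    | C a =>
      intro ε hε
      simpa using hP.C_mem hε.le
    | add p q hp hq =>
      intro ε hε
      have h1 := hp (ε / 2) (by positivity)
      have h2 := hq (ε / 2) (by positivity)
      have e : (C ε : MvPolynomial σ ℝ) = C (ε / 2) + C (ε / 2) := by rw [← C_add]; simp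
      constructor
      · convert hP.add_mem h1.1 h2.1 using 1
        rw [map_add, C_add, e]; ring
      · convert hP.add_mem h1.2 h2.2 using 1
        rw [map_add, C_add, e]; ring
    | mul_X p i hp =>
      intro ε hε
      have e : (C ε : MvPolynomial σ ℝ) = C (ε / 2) + C (ε / 2) := by rw [← C_add]; simp
      have hε2 : 0 < ε / 2 := by positivity
      constructor
      · convert hP.add_mem (hmul _ hp (-X i) _ hε2) (hmul _ (hz i) (-C (eval z p)) _ hε2) using 1
        rw [map_mul, eval_X, C_mul, e]; ring
      · convert hP.add_mem (hmul _ hp (X i) _ hε2) (hmul _ (hz i) (C (eval z p)) _ hε2) using 1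
        rw [map_mul, eval_X, C_mul, e]; ring
  by_contra! hlt
  refine hpr (eval z q / 2) (by linarith) ?_
  have h2 := (hall q (-eval z q / 2) (by linarith)).2
  convert hP.add_mem h2 (hQP hq) using 1
  have e : (C (eval z q / 2) : MvPolynomial σ ℝ) = C (-eval z q / 2) + C (eval z q) := by
    rw [← C_add]; congr 1; ring
  rw [e]; ring

/-- Putinar's Positivstellensatz. -/
theorem IsQuadModule.mem_of_forall_pos [Fintype σ] {Q : Set (MvPolynomial σ ℝ)}
    (hQ : IsQuadModule Q) {N : ℝ} (hN : C N - ∑ i, X i * X i ∈ Q) {f : MvPolynomial σ ℝ}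
    (hf : ∀ z, (∀ q ∈ Q, 0 ≤ eval z q) → 0 < eval z f) : f ∈ Q := by
  have harch := fun f => hQ.exists_C_sub_mem hN f
  obtain ⟨q, hq, s, hs, h1⟩ : -1 ∈ {g | ∃ q ∈ Q, ∃ s, IsSumSq s ∧ g = q + -f * s} := by
    by_contra hcon
    obtain ⟨z, hz⟩ := (hQ.adjoin (-f)).exists_eval_nonneg (N := N)
      ⟨_, hN, 0, .zero, by simp⟩ hcon
    have h2 := hf z fun q hq => hz q ⟨q, hq, 0, .zero, by simp⟩
    have h3 := hz (-f) ⟨0, hQ.zero_mem, 1, by simpa using IsSumSq.mul_self (1 : MvPolynomial σ ℝ),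
      by simp⟩
    rw [map_neg] at h3
    linarith
  obtain ⟨k, hk, hks, hkf⟩ : ∃ k : ℝ, 0 < k ∧ C (2 * k) - s ∈ Q ∧ C (2 * k - 1) - s * s * f ∈ Q := by
    obtain ⟨a, ha, ha', _⟩ := harch s
    obtain ⟨b, hb, hb', _⟩ := harch (s * s * f)
    refine ⟨a + b + 1, by positivity, ?_, ?_⟩
    · rw [sub_eq_add_neg] at ha' ⊢
      exact hQ.C_mem_mono (by linarith) ha'
    · rw [sub_eq_add_neg] at hb' ⊢
      exact hQ.C_mem_mono (by linarith) hb'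
  have hss : s * (C (2 * k) - s) ∈ Q := by
    refine hQ.mem_of_C_mul_mem (r := 2 * k) (by positivity) ?_
    convert hQ.add_mem (hQ.mul_self_mul_mem s hks)
      (hQ.mul_self_mul_mem (C (2 * k) - s) (hQ.sumSq_mem hs)) using 1
    ring
  have step : ∀ r : ℝ, 0 ≤ r → f + C r ∈ Q → f + C (r - 1 / k ^ 2) ∈ Q := by
    intro r hr hfr
    refine hQ.mem_of_C_mul_mem (r := k ^ 2) (by positivity) ?_
    convert hQ.add_mem (hQ.add_mem (hQ.mul_self_mul_mem (C k - s) hfr)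
      (hQ.C_mul_mem (r := 2 * k) (by positivity) hq)) (hQ.add_mem hkf (hQ.C_mul_mem hr hss)) using 1
    have e : (C (k ^ 2) : MvPolynomial σ ℝ) * C (r - 1 / k ^ 2) = C k * C k * C r - 1 := by
      rw [← C_1, ← C_mul, ← C_mul, ← C_mul, ← C_sub]; congr 1; field_simp
    rw [mul_add, e]
    simp only [C_mul, C_pow, C_sub, C_1, map_ofNat]
    linear_combination (2 * C k) * h1
  obtain ⟨r, hr, _, hr'⟩ := harch f
  have hind : ∀ n : ℕ, f + C (max (r - n * (1 / k ^ 2)) 0) ∈ Q := by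
    intro n
    induction n with
    | zero => simpa [hr.le, add_comm] using hr'
    | succ n ih =>
      have := step _ (le_max_right _ _) ih
      rw [add_comm] at this ⊢
      refine hQ.C_mem_mono ?_ this
      have hk2 : 0 < 1 / k ^ 2 := by positivity
      push_cast
      rcases max_cases (r - n * (1 / k ^ 2)) 0 with h | h
      · exact le_max_of_le_left (by rw [h.1]; linarith)
      · exact le_max_of_le_right (by rw [h.1]; linarith)
  obtain ⟨n, hn⟩ := exists_nat_gt (r / (1 / k ^ 2))
  have hk2 : 0 < 1 / k ^ 2 := by positivity
  have := hind n
  rwa [max_eq_right (by rw [div_lt_iff₀ hk2] at hn; linarith), C_0, add_zero] at this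

end QuadModule

section Preorder

variable {σ : Type}

/-- The preordering generated by an ideal and one further element. -/
def preorderAdjoin (I : Ideal (MvPolynomial σ ℝ)) (g : MvPolynomial σ ℝ) :
    Subsemiring (MvPolynomial σ ℝ) where
  carrier := {f | ∃ s s' : MvPolynomial σ ℝ, IsSumSq s ∧ IsSumSq s' ∧ ∃ n ∈ I, f = s + s' * g + n}
  zero_mem' := ⟨0, 0, .zero, .zero, 0, I.zero_mem, by simp⟩
  one_mem' := ⟨1, 0, .one, .zero, 0, I.zero_mem, by simp⟩
  add_mem' := by
    rintro _ _ ⟨s, s', hs, hs', n, hn, rfl⟩ ⟨u, u', hu, hu', m, hm, rfl⟩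
    exact ⟨s + u, s' + u', hs.add hu, hs'.add hu', n + m, I.add_mem hn hm, by ring⟩
  mul_mem' := by
    rintro _ _ ⟨s, s', hs, hs', n, hn, rfl⟩ ⟨u, u', hu, hu', m, hm, rfl⟩
    exact ⟨s * u + s' * u' * (g * g), s * u' + s' * u,
      (hs.mul hu).add ((hs'.mul hu').mul (.mul_self g)), (hs.mul hu').add (hs'.mul hu),
      n * (u + u' * g + m) + m * (s + s' * g),
      I.add_mem (I.mul_mem_right _ hn) (I.mul_mem_right _ hm), by ring⟩

lemma mul_self_mem_preorderAdjoin (I : Ideal (MvPolynomial σ ℝ)) (g a : MvPolynomial σ ℝ) :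
    a * a ∈ preorderAdjoin I g := ⟨a * a, 0, .mul_self a, .zero, 0, I.zero_mem, by simp⟩

lemma mem_preorderAdjoin_self (I : Ideal (MvPolynomial σ ℝ)) (g : MvPolynomial σ ℝ) :
    g ∈ preorderAdjoin I g := ⟨0, 1, .zero, .one, 0, I.zero_mem, by simp⟩

lemma mem_preorderAdjoin_of_mem {I : Ideal (MvPolynomial σ ℝ)} (g : MvPolynomial σ ℝ)
    {n : MvPolynomial σ ℝ} (hn : n ∈ I) : n ∈ preorderAdjoin I g :=
  ⟨0, 0, .zero, .zero, n, hn, by simp⟩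

lemma isQuadModule_of_subsemiring (T : Subsemiring (MvPolynomial σ ℝ)) (hsq : ∀ a, a * a ∈ T) :
    IsQuadModule (T : Set (MvPolynomial σ ℝ)) :=
  ⟨T.one_mem, T.add_mem, fun a _ hq => T.mul_mem (hsq a) hq⟩

lemma IsQuadModule.preorderAdjoin_subset {Q : Set (MvPolynomial σ ℝ)} (hQ : IsQuadModule Q)
    {I : Ideal (MvPolynomial σ ℝ)} (hI : ∀ n ∈ I, n ∈ Q) {g : MvPolynomial σ ℝ} (hg : g ∈ Q)
    {f : MvPolynomial σ ℝ} (hf : f ∈ preorderAdjoin I g) : f ∈ Q := by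
  obtain ⟨s, s', hs, hs', n, hn, rfl⟩ := hf
  exact hQ.add_mem (hQ.add_mem (hQ.sumSq_mem hs) (hQ.sumSq_mul_mem hs' hg)) (hI n hn)

/-- Wörmann's theorem: a quadratic module containing a polynomial whose nonnegativity set is
compact bounds the norm of the variables. -/
theorem IsQuadModule.exists_C_sub_sum_mem [Fintype σ] {Q : Set (MvPolynomial σ ℝ)}
    (hQ : IsQuadModule Q) {g : MvPolynomial σ ℝ} (hg : g ∈ Q)
    (hc : IsCompact {z : σ → ℝ | 0 ≤ eval z g}) : ∃ N : ℝ, C N - ∑ i, X i * X i ∈ Q := by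
  let T := preorderAdjoin ⊥ g
  have hsq : ∀ a, a * a ∈ T := mul_self_mem_preorderAdjoin _ _
  have hT := isQuadModule_of_subsemiring T hsq
  suffices h : ∃ N : ℝ, C N - ∑ i, X i * X i ∈ T by
    obtain ⟨N, hN⟩ := h
    exact ⟨N, hQ.preorderAdjoin_subset (by
      intro n hn
      rw [Ideal.mem_bot] at hn
      exact hn ▸ hQ.zero_mem) hg hN⟩
  let a : MvPolynomial σ ℝ := ∑ i, X i * X i
  have ha : a ∈ T := hT.sum_mem _ _ fun i _ => hsq (X i)
  obtain ⟨N, hN0, hN⟩ : ∃ N : ℝ, 0 < N ∧ ∀ z, 0 ≤ eval z g → eval z a < N := by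
    have hcont : ContinuousOn (fun z : σ → ℝ => eval z a) {z : σ → ℝ | 0 ≤ eval z g} :=
      (MvPolynomial.continuous_eval a).continuousOn
    obtain ⟨B, hB⟩ := hc.bddAbove_image hcont
    refine ⟨|B| + 1, by positivity, fun z hz => ?_⟩
    have := hB ⟨z, hz, rfl⟩
    exact lt_of_le_of_lt (this.trans (le_abs_self B)) (by linarith)
  obtain ⟨l, hl⟩ := exists_neg_pow_mem (T.adjoinElem hsq (a - C N))
    (fun b => ⟨b * b, hsq b, 0, T.zero_mem, by simp⟩) ![g, a - C N]
    (by
      intro i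
      fin_cases i
      · exact ⟨g, mem_preorderAdjoin_self _ _, 0, T.zero_mem, by simp⟩
      · exact ⟨0, T.zero_mem, 1, T.one_mem, by simp⟩) 1
    (by
      intro z hz
      have h0 := hz 0
      have h1 := hz 1
      simp only [Matrix.cons_val_zero, Matrix.cons_val_one, map_sub, eval_C] at h0 h1
      have := hN z h0
      linarith)
  rw [one_pow] at hl
  obtain ⟨t', ht', t, ht, h1⟩ := hl
  have h2 : (1 + t') * (C N - a) ∈ T := by
    have := T.mul_mem ht (hsq (C N - a))
    convert this using 1
    linear_combination (a - C N) * h1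
  obtain ⟨m, hm0, hm, _⟩ := (hT.adjoin (C N - a)).exists_C_sub_mem (N := N)
    ⟨0, T.zero_mem, 1, .one, by simp [a]⟩ t'
  obtain ⟨u, hu, v, hv, hm⟩ := hm
  have h3 : C (m + m ^ 2 / 4) - t' ∈ T := by
    have := T.add_mem (T.add_mem (T.mul_mem (T.add_mem T.one_mem ht') hu)
      (T.mul_mem h2 (hT.sumSq_mem hv))) (hsq (t' - C (m / 2)))
    convert this using 1
    have e : (C m : MvPolynomial σ ℝ) = 2 * C (m / 2) := by
      rw [← map_ofNat C 2, ← C_mul]; congr 1; ring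
    have e2 : (C (m + m ^ 2 / 4) : MvPolynomial σ ℝ) = C m + C (m / 2) * C (m / 2) := by
      rw [← C_mul, ← C_add]; congr 1; ring
    rw [e2]
    linear_combination (1 + t') * hm - t' * e
  refine ⟨N * (1 + (m + m ^ 2 / 4)), ?_⟩
  have := T.add_mem (T.add_mem h2 (T.mul_mem ha ht')) (hT.C_mul_mem hN0.le h3)
  convert this using 1
  rw [C_mul, C_add (σ := σ) (a := (1 : ℝ)), C_1]
  ring

/-- If the points of a finite set `S` are isolated real zeros of `φ`, then a quadratic module
in which the `φ i` vanish and the product of the squared distances to `S` is small contains the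
opposite of a power of this product. -/
theorem exists_neg_pow_mem_of_isolated [Fintype σ] {ι : Type} [Finite ι]
    (φ : ι → MvPolynomial σ ℝ) (S : Finset (σ → ℝ))
    (hS : ∀ s ∈ S, ∃ U : Set (σ → ℝ), IsOpen U ∧ s ∈ U ∧
      U ∩ {z | ∀ i, eval z (φ i) = 0} = {s}) :
    ∃ ε : ℝ, 0 < ε ∧ ∀ (Q : Set (MvPolynomial σ ℝ)) (I : Ideal (MvPolynomial σ ℝ)),
      IsQuadModule Q → (∀ n ∈ I, n ∈ Q) → (∀ i, φ i ∈ I) →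
      C ε - ∏ s ∈ S, ∑ i, (X i - C (s i)) ^ 2 ∈ Q →
      ∃ l : ℕ, -(∏ s ∈ S, ∑ i, (X i - C (s i)) ^ 2) ^ (2 * l) ∈ Q := by
  have hδ : ∀ s ∈ S, ∃ δ : ℝ, 0 < δ ∧ ∀ z : σ → ℝ, (∀ i, eval z (φ i) = 0) →
      ∑ i, (z i - s i) ^ 2 < δ → z = s := by
    intro s hs
    obtain ⟨U, hU, hsU, hUZ⟩ := hS s hs
    obtain ⟨δ, hδ, hball⟩ := Metric.isOpen_iff.1 hU s hsU
    refine ⟨δ ^ 2, by positivity, fun z hz hlt => ?_⟩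
    have : z ∈ U ∩ {z | ∀ i, eval z (φ i) = 0} := ⟨hball ?_, hz⟩
    · rwa [hUZ] at this
    · rw [Metric.mem_ball, dist_pi_lt_iff hδ]
      intro i
      rw [Real.dist_eq]
      refine abs_lt_of_sq_lt_sq (lt_of_le_of_lt ?_ hlt) hδ.le
      exact Finset.single_le_sum (f := fun i => (z i - s i) ^ 2) (fun j _ => sq_nonneg _)
        (Finset.mem_univ i)
  choose! δ hδ0 hδ using hδ
  refine ⟨(∏ s ∈ S, δ s) / 2, half_pos (Finset.prod_pos hδ0), fun Q I hQ hI hφ hε => ?_⟩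
  obtain ⟨l, hl⟩ := exists_neg_pow_mem (ι := (ι ⊕ ι) ⊕ Unit)
    (preorderAdjoin I (C ((∏ s ∈ S, δ s) / 2) - ∏ s ∈ S, ∑ i, (X i - C (s i)) ^ 2))
    (mul_self_mem_preorderAdjoin _ _)
    (Sum.elim (Sum.elim φ fun i => -φ i) fun _ =>
      C ((∏ s ∈ S, δ s) / 2) - ∏ s ∈ S, ∑ i, (X i - C (s i)) ^ 2)
    (by
      rintro ((i | i) | _)
      · exact mem_preorderAdjoin_of_mem _ (hφ i)
      · exact mem_preorderAdjoin_of_mem _ (I.neg_mem (hφ i))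
      · exact mem_preorderAdjoin_self _ _)
    (∏ s ∈ S, ∑ i, (X i - C (s i)) ^ 2)
    (by
      intro z hz
      have hz0 : ∀ i, eval z (φ i) = 0 := fun i => by
        have h1 := hz (.inl (.inl i))
        have h2 := hz (.inl (.inr i))
        simp only [Sum.elim_inl, Sum.elim_inr, map_neg] at h1 h2
        linarith
      have h3 := hz (.inr ())
      simp only [Sum.elim_inr, map_sub, eval_C, map_prod, map_sum, map_pow, eval_X] at h3 ⊢
      have hlt : ∏ s ∈ S, ∑ i, (z i - s i) ^ 2 < ∏ s ∈ S, δ s := by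
        have := half_lt_self (Finset.prod_pos hδ0)
        linarith
      by_contra hne
      refine absurd hlt (not_lt.2 (Finset.prod_le_prod (fun s hs => (hδ0 s hs).le) fun s hs => ?_))
      by_contra hlt'
      have := hδ s hs z hz0 (not_le.1 hlt')
      exact hne (Finset.prod_eq_zero hs (by simp [this])))
  exact ⟨l, hQ.preorderAdjoin_subset hI hε hl⟩

end Preorder

section CriticalValues

/-- In a finitely generated field extension of characteristic zero, an element whose differential
vanishes is algebraic. -/
lemma isAlgebraic_of_kaehlerDifferential_eq_zero {k K : Type} [Field k] [CharZero k] [Field K]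
    [Algebra k K] [Algebra.EssFiniteType k K] {x : K} (hx : KaehlerDifferential.D k K x = 0) :
    IsAlgebraic k x := by
  by_contra htr
  have hinj : Function.Injective (Polynomial.aeval x : Polynomial k →ₐ[k] K) :=
    transcendental_iff_injective.1 htr
  let _ : Algebra (Polynomial k) K := (Polynomial.aeval x : Polynomial k →ₐ[k] K).toAlgebra
  have : IsScalarTower k (Polynomial k) K := .of_algebraMap_eq fun r => by
    simp [RingHom.algebraMap_toAlgebra]
  have : FaithfulSMul (Polynomial k) K := (faithfulSMul_iff_algebraMap_injective _ _).2 hinj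
  let _ : Algebra (FractionRing (Polynomial k)) K := FractionRing.liftAlgebra _ _
  have : IsScalarTower (Polynomial k) (FractionRing (Polynomial k)) K :=
    FractionRing.isScalarTower_liftAlgebra _ _
  have : IsScalarTower k (FractionRing (Polynomial k)) K := .to₁₃₄ k (Polynomial k) _ K
  have : CharZero (FractionRing (Polynomial k)) :=
    charZero_of_injective_algebraMap (IsFractionRing.injective (Polynomial k) _)
  have : Algebra.EssFiniteType (FractionRing (Polynomial k)) K := .of_comp k _ _
  have : Algebra.FormallySmooth (Polynomial k) (FractionRing (Polynomial k)) :=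
    .of_isLocalization (nonZeroDivisors _)
  have hsm : Algebra.FormallySmooth (Polynomial k) K :=
    .comp _ (FractionRing (Polynomial k)) _
  have := hsm.subsingleton_h1Cotangent
  have hbc : Function.Injective (KaehlerDifferential.mapBaseChange k (Polynomial k) K) := by
    rw [injective_iff_map_eq_zero]
    intro y hy
    obtain ⟨c, hc⟩ := (Algebra.H1Cotangent.exact_δ_mapBaseChange k (Polynomial k) K y).1 hy
    rw [← hc, Subsingleton.elim c 0, map_zero]
  have h0 : (1 : K) ⊗ₜ[Polynomial k] KaehlerDifferential.D k (Polynomial k) Polynomial.X = 0 := by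
    apply hbc
    rw [KaehlerDifferential.mapBaseChange_tmul, map_zero, KaehlerDifferential.map_D, one_smul]
    simpa [RingHom.algebraMap_toAlgebra] using hx
  have h1 := congrArg (TensorProduct.rid (Polynomial k) K ∘
    (KaehlerDifferential.polynomialEquiv k).toLinearMap.lTensor K) h0
  simp [KaehlerDifferential.polynomialEquiv_D] at h1

lemma derivation_apply_algHom {σ K M : Type} [Fintype σ] [CommRing K] [Algebra ℝ K]
    [AddCommGroup M] [Module ℝ M] [Module K M] [IsScalarTower ℝ K M]
    (e : MvPolynomial σ ℝ →ₐ[ℝ] K) (D : Derivation ℝ K M) (f : MvPolynomial σ ℝ) :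
    D (e f) = ∑ j, e (pderiv j f) • D (e (X j)) := by
  classical
  induction f using MvPolynomial.induction_on with
  | C a => simp [← MvPolynomial.algebraMap_eq]
  | add p q hp hq => simp [hp, hq, add_smul, Finset.sum_add_distrib]
  | mul_X p i hp =>
    simp only [map_mul, Derivation.leibniz, hp, pderiv_X, smul_eq_mul, map_add, add_smul,
      Finset.sum_add_distrib, mul_smul, Finset.smul_sum]
    congr 1
    rw [Finset.sum_eq_single i] <;> simp +contextual

/-- A polynomial takes only finitely many values on its critical locus: some nonzero univariate
polynomial in `F` vanishes on the variety of any ideal containing a Lagrange multiplier system for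
`F` with complementarity conditions. -/
theorem exists_aeval_mem_radical {σ ι : Type} [Fintype σ] [Fintype ι]
    (I : Ideal (MvPolynomial σ ℝ)) (F : MvPolynomial σ ℝ) (l g : ι → MvPolynomial σ ℝ)
    (hF : ∀ j, pderiv j F - ∑ i, l i * pderiv j (g i) ∈ I) (hg : ∀ i, l i * g i ∈ I) :
    ∃ m : Polynomial ℝ, m ≠ 0 ∧ Polynomial.aeval F m ∈ I.radical := by
  have key : ∀ P ∈ I.minimalPrimes, ∃ m : Polynomial ℝ, m ≠ 0 ∧ Polynomial.aeval F m ∈ P := by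
    intro P hP
    have hPp : P.IsPrime := hP.1.1
    have hIP : I ≤ P := hP.1.2
    let e : MvPolynomial σ ℝ →ₐ[ℝ] FractionRing (MvPolynomial σ ℝ ⧸ P) :=
      (IsScalarTower.toAlgHom ℝ (MvPolynomial σ ℝ ⧸ P) _).comp (Ideal.Quotient.mkₐ ℝ P)
    have he : ∀ f, e f = 0 ↔ f ∈ P := fun f => by
      simp [e, Ideal.Quotient.eq_zero_iff_mem]
    have : Algebra.EssFiniteType (MvPolynomial σ ℝ ⧸ P)
        (FractionRing (MvPolynomial σ ℝ ⧸ P)) :=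
      .of_isLocalization _ (nonZeroDivisors (MvPolynomial σ ℝ ⧸ P))
    have : Algebra.EssFiniteType ℝ (FractionRing (MvPolynomial σ ℝ ⧸ P)) :=
      .comp _ (MvPolynomial σ ℝ ⧸ P) _
    have hD : KaehlerDifferential.D ℝ (FractionRing (MvPolynomial σ ℝ ⧸ P)) (e F) = 0 := by
      have h1 : ∀ j, e (pderiv j F) = ∑ i, e (l i) * e (pderiv j (g i)) := fun j => by
        have := (he _).2 (hIP (hF j))
        rwa [map_sub, map_sum, sub_eq_zero, Finset.sum_congr rfl fun i _ => map_mul e _ _] at this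
      rw [derivation_apply_algHom]
      simp_rw [h1, Finset.sum_smul, mul_smul]
      rw [Finset.sum_comm]
      simp_rw [← Finset.smul_sum, ← derivation_apply_algHom]
      refine Finset.sum_eq_zero fun i _ => ?_
      have h2 := (he _).2 (hIP (hg i))
      rw [map_mul, mul_eq_zero] at h2
      rcases h2 with h2 | h2 <;> simp [h2]
    obtain ⟨m, hm0, hm⟩ := isAlgebraic_of_kaehlerDifferential_eq_zero hD
    refine ⟨m, hm0, (he _).1 ?_⟩
    rwa [Polynomial.aeval_algHom_apply] at hm
  choose! m hm0 hm using key
  have hfin : I.minimalPrimes.Finite := Ideal.finite_minimalPrimes_of_isNoetherianRing _ I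
  refine ⟨∏ P ∈ hfin.toFinset, m P,
    Finset.prod_ne_zero_iff.2 fun P hP => hm0 P (hfin.mem_toFinset.1 hP), ?_⟩
  rw [← Ideal.sInf_minimalPrimes, Ideal.mem_sInf]
  intro P hP
  rw [map_prod]
  exact Ideal.mem_of_dvd _ (Finset.dvd_prod_of_mem _ (hfin.mem_toFinset.2 hP)) (hm P hP)

end CriticalValues

section Riesz

variable {σ : Type}

lemma riesz_eq_sum {w : (σ →₀ ℕ) → ℝ} {f : MvPolynomial σ ℝ} {s : Finset (σ →₀ ℕ)}
    (h : f.support ⊆ s) : riesz w f = ∑ α ∈ s, f.coeff α * w α :=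
  Finset.sum_subset h fun α _ hα => by simp [notMem_support_iff.1 hα]

lemma riesz_add (w : (σ →₀ ℕ) → ℝ) (f g : MvPolynomial σ ℝ) :
    riesz w (f + g) = riesz w f + riesz w g := by
  classical
  rw [riesz_eq_sum (w := w) (f := f) Finset.subset_union_left,
    riesz_eq_sum (w := w) (f := g) Finset.subset_union_right, riesz_eq_sum support_add,
    ← Finset.sum_add_distrib]
  simp only [coeff_add, add_mul]

lemma riesz_smul (w : (σ →₀ ℕ) → ℝ) (r : ℝ) (f : MvPolynomial σ ℝ) :
    riesz w (r • f) = r * riesz w f := by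
  rw [riesz_eq_sum (support_smul (a := r) (f := f)), riesz, Finset.mul_sum]
  simp only [coeff_smul, smul_eq_mul, mul_assoc]

/-- The Riesz functional as a linear map. -/
def rieszLin (w : (σ →₀ ℕ) → ℝ) : MvPolynomial σ ℝ →ₗ[ℝ] ℝ where
  toFun := riesz w
  map_add' := riesz_add w
  map_smul' := riesz_smul w

@[simp]
lemma rieszLin_apply (w : (σ →₀ ℕ) → ℝ) (f : MvPolynomial σ ℝ) : rieszLin w f = riesz w f := rfl

lemma rieszLin_monomial (w : (σ →₀ ℕ) → ℝ) (α : σ →₀ ℕ) (r : ℝ) :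
    rieszLin w (monomial α r) = r * w α := by
  classical
  rw [rieszLin_apply, riesz_eq_sum support_monomial_subset]
  simp [coeff_monomial]

lemma rieszLin_C (w : (σ →₀ ℕ) → ℝ) (r : ℝ) : rieszLin w (C r) = r * w 0 :=
  rieszLin_monomial w 0 r

variable [Fintype σ] [DecidableEq σ]

omit [DecidableEq σ] in
lemma rieszLin_eval (z : σ → ℝ) (f : MvPolynomial σ ℝ) :
    rieszLin (fun α => ∏ i, z i ^ α i) f = eval z f := by
  rw [rieszLin_apply, riesz, eval_eq']

lemma MomIdx.exp_injective {t : ℕ} : Function.Injective (MomIdx.exp : MomIdx σ t → σ →₀ ℕ) := by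
  intro u v h
  ext i
  exact congrArg (fun f : σ →₀ ℕ => f i) h

lemma MomIdx.degree_exp_le {t : ℕ} (u : MomIdx σ t) : u.exp.degree ≤ t := by
  rw [Finsupp.degree_eq_sum]
  exact u.2

lemma MomIdx.exists_exp_eq {t : ℕ} {α : σ →₀ ℕ} (h : α.degree ≤ t) :
    ∃ u : MomIdx σ t, u.exp = α := by
  rw [Finsupp.degree_eq_sum] at h
  refine ⟨⟨fun i => ⟨α i, Nat.lt_succ_of_le ((Finset.single_le_sum (f := fun i => α i)
    (fun _ _ => Nat.zero_le _) (Finset.mem_univ i)).trans h)⟩, h⟩, ?_⟩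
  ext i
  rfl

lemma eq_sum_momIdx {t : ℕ} {f : MvPolynomial σ ℝ} (hf : f.totalDegree ≤ t) :
    f = ∑ u : MomIdx σ t, monomial u.exp (coeff u.exp f) := by
  conv_lhs => rw [f.as_sum]
  rw [← Finset.sum_image (f := fun v => monomial v (coeff v f)) (g := MomIdx.exp)
    (s := (Finset.univ : Finset (MomIdx σ t))) (MomIdx.exp_injective.injOn)]
  refine Finset.sum_subset (fun α hα => ?_) fun α _ hα => by simp [notMem_support_iff.1 hα]
  obtain ⟨u, hu⟩ := MomIdx.exists_exp_eq (t := t) (α := α)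
    ((le_totalDegree hα).trans hf)
  exact Finset.mem_image.2 ⟨u, Finset.mem_univ _, hu⟩

/-- A bilinear expansion in the monomials indexing a moment or localizing matrix. -/
lemma rieszLin_mul_mul_eq {t : ℕ} (w : (σ →₀ ℕ) → ℝ) (q : MvPolynomial σ ℝ)
    {a b : MvPolynomial σ ℝ} (ha : a.totalDegree ≤ t) (hb : b.totalDegree ≤ t) :
    rieszLin w (q * a * b) = ∑ u : MomIdx σ t, ∑ v : MomIdx σ t,
      coeff u.exp a * riesz w (q * monomial (u.exp + v.exp) 1) * coeff v.exp b := by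
  conv_lhs => rw [eq_sum_momIdx ha, eq_sum_momIdx hb]
  simp only [Finset.mul_sum, Finset.sum_mul, map_sum]
  rw [Finset.sum_comm]
  refine Finset.sum_congr rfl fun u _ => Finset.sum_congr rfl fun v _ => ?_
  rw [mul_assoc, monomial_mul, ← mul_one (coeff _ a * coeff _ b), ← smul_eq_mul _ (1 : ℝ),
    ← smul_monomial, mul_smul_comm, map_smul, rieszLin_apply, smul_eq_mul]
  ring

lemma rieszLin_mul_eq {t : ℕ} (w : (σ →₀ ℕ) → ℝ)
    {a b : MvPolynomial σ ℝ} (ha : a.totalDegree ≤ t) (hb : b.totalDegree ≤ t) :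
    rieszLin w (a * b) = ∑ u : MomIdx σ t, ∑ v : MomIdx σ t,
      coeff u.exp a * momMat t w u v * coeff v.exp b := by
  have := rieszLin_mul_mul_eq w 1 ha hb
  rw [one_mul] at this
  rw [this]
  refine Finset.sum_congr rfl fun u _ => Finset.sum_congr rfl fun v _ => ?_
  rw [one_mul, ← rieszLin_apply, rieszLin_monomial, one_mul, momMat, Matrix.of_apply]

lemma sum_sum_mul_nonneg {n : Type} [Fintype n] {M : Matrix n n ℝ} (hM : M.PosSemidef)
    (x : n → ℝ) : 0 ≤ ∑ u, ∑ v, x u * M u v * x v := by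
  have := hM.dotProduct_mulVec_nonneg x
  simpa [dotProduct, Matrix.mulVec, Finset.mul_sum, mul_assoc] using this

lemma rieszLin_mul_self_nonneg {k : ℕ} {w : (σ →₀ ℕ) → ℝ} (hw : (momMat k w).PosSemidef)
    {a : MvPolynomial σ ℝ} (ha : a.totalDegree ≤ k) : 0 ≤ rieszLin w (a * a) := by
  rw [rieszLin_mul_eq w ha ha]
  exact sum_sum_mul_nonneg hw _

lemma rieszLin_mul_eq_zero {k : ℕ} {w : (σ →₀ ℕ) → ℝ} (hw : (momMat k w).PosSemidef)
    {a b : MvPolynomial σ ℝ} (ha : a.totalDegree ≤ k) (hb : b.totalDegree ≤ k)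
    (h : rieszLin w (a * a) ≤ 0) : rieszLin w (a * b) = 0 := by
  have key : ∀ r : ℝ, 0 ≤ 2 * r * rieszLin w (a * b) + rieszLin w (b * b) := fun r => by
    have := rieszLin_mul_self_nonneg hw (a := r • a + b)
      ((totalDegree_add _ _).trans (max_le ((totalDegree_smul_le _ _).trans ha) hb))
    have e : (r • a + b) * (r • a + b) = (r * r) • (a * a) + (2 * r) • (a * b) + b * b := by
      simp only [smul_eq_C_mul, C_mul, map_ofNat]
      ring
    rw [e, map_add, map_add, map_smul, map_smul, smul_eq_mul, smul_eq_mul] at this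
    nlinarith [mul_self_nonneg r]
  by_contra hne
  have := key (-(rieszLin w (b * b) + 1) / (2 * rieszLin w (a * b)))
  field_simp at this
  linarith

variable {ι κ : Type} {φ : ι → MvPolynomial σ ℝ} {ψ : κ → MvPolynomial σ ℝ}

lemma RelaxFeasible.rieszLin_eq_zero {k : ℕ} {w : (σ →₀ ℕ) → ℝ} (hw : RelaxFeasible k φ ψ w)
    (i : ι) {a : MvPolynomial σ ℝ} (ha : a.totalDegree ≤ k - ((φ i).totalDegree + 1) / 2) :
    rieszLin w (φ i * a) = 0 := by
  have := rieszLin_mul_mul_eq w (φ i) ha (b := 1) (by simp)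
  rw [mul_one] at this
  rw [this]
  refine Finset.sum_eq_zero fun u _ => Finset.sum_eq_zero fun v _ => ?_
  have := congrFun (congrFun (hw.2.2.1 i) u) v
  rw [locMat, Matrix.of_apply, Matrix.zero_apply] at this
  rw [this]
  simp

lemma RelaxFeasible.rieszLin_nonneg {k : ℕ} {w : (σ →₀ ℕ) → ℝ} (hw : RelaxFeasible k φ ψ w)
    (j : κ) {a : MvPolynomial σ ℝ} (ha : a.totalDegree ≤ k - ((ψ j).totalDegree + 1) / 2) :
    0 ≤ rieszLin w (a * a * ψ j) := by
  rw [mul_comm, ← mul_assoc, rieszLin_mul_mul_eq w (ψ j) ha ha]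
  exact sum_sum_mul_nonneg (hw.2.2.2 j) _

lemma relaxFeasible_eval (k : ℕ) {z : σ → ℝ} (hφ : ∀ i, eval z (φ i) = 0)
    (hψ : ∀ j, 0 ≤ eval z (ψ j)) : RelaxFeasible k φ ψ fun α => ∏ i, z i ^ α i := by
  have key : ∀ q : MvPolynomial σ ℝ, locMat k q (fun α => ∏ i, z i ^ α i) =
      eval z q • Matrix.vecMulVec (fun u => ∏ i, z i ^ u.exp i)
        (star fun u => ∏ i, z i ^ u.exp i) := fun q => by
    ext u v
    rw [locMat, Matrix.of_apply, ← rieszLin_apply, rieszLin_eval, map_mul, eval_monomial,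
      Matrix.smul_apply, Matrix.vecMulVec_apply, smul_eq_mul]
    simp [Finsupp.prod_fintype, pow_add, Finset.prod_mul_distrib]
  refine ⟨by simp, ?_, fun i => by rw [key, hφ, zero_smul], fun j => ?_⟩
  · have := Matrix.posSemidef_vecMulVec_self_star (R := ℝ)
      fun u : MomIdx σ k => ∏ i, z i ^ u.exp i
    convert this using 1
    ext u v
    simp [momMat, Matrix.vecMulVec_apply, pow_add, Finset.prod_mul_distrib]
  · rw [key]
    exact (Matrix.posSemidef_vecMulVec_self_star _).smul (hψ j)

end Riesz

section Eventual

open Filter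

variable {σ : Type} (W : ℕ → Set ((σ →₀ ℕ) → ℝ))

/-- The polynomials which are eventually nonnegative, in the localized sense, for a sequence of
sets of Riesz functionals. -/
def evPos : Set (MvPolynomial σ ℝ) :=
  {f | ∀ a, ∀ᶠ k in atTop, ∀ w ∈ W k, 0 ≤ rieszLin w (a * a * f)}

/-- The ideal of polynomials all of whose multiples are eventually in the kernel of a sequence of
sets of Riesz functionals. -/
def evNull : Ideal (MvPolynomial σ ℝ) where
  carrier := {f | ∀ r, ∀ᶠ k in atTop, ∀ w ∈ W k, rieszLin w (f * r) = 0}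
  add_mem' {f g} hf hg r := by
    filter_upwards [hf r, hg r] with k h1 h2 w hw
    rw [add_mul, map_add, h1 w hw, h2 w hw, add_zero]
  zero_mem' r := .of_forall fun k w _ => by rw [zero_mul, map_zero]
  smul_mem' c f hf r := by
    filter_upwards [hf (c * r)] with k h1 w hw
    rw [smul_eq_mul, mul_comm c, mul_assoc, h1 w hw]

variable {W}

lemma evNull_subset_evPos {f : MvPolynomial σ ℝ} (hf : f ∈ evNull W) : f ∈ evPos W := fun a => by
  filter_upwards [hf (a * a)] with k h w hw
  rw [mul_comm, h w hw]

variable [Fintype σ] [DecidableEq σ] {ι κ : Type}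
  {φ : ι → MvPolynomial σ ℝ} {ψ : κ → MvPolynomial σ ℝ}
  (hW : ∀ k, ∀ w ∈ W k, RelaxFeasible k φ ψ w)
include hW

lemma isQuadModule_evPos : IsQuadModule (evPos W) where
  one_mem a := by
    filter_upwards [eventually_ge_atTop a.totalDegree] with k hk w hw
    rw [mul_one]
    exact rieszLin_mul_self_nonneg (hW k w hw).2.1 hk
  add_mem {f g} hf hg a := by
    filter_upwards [hf a, hg a] with k h1 h2 w hw
    rw [mul_add, map_add]
    exact add_nonneg (h1 w hw) (h2 w hw)
  mul_self_mul_mem b f hf a := by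
    filter_upwards [hf (a * b)] with k h w hw
    convert h w hw using 2
    ring

lemma mem_evNull_of_eventually_nonpos {f : MvPolynomial σ ℝ}
    (h : ∀ᶠ k in atTop, ∀ w ∈ W k, rieszLin w (f * f) ≤ 0) : f ∈ evNull W := fun r => by
  filter_upwards [h, eventually_ge_atTop f.totalDegree, eventually_ge_atTop r.totalDegree]
    with k h h1 h2 w hw
  exact rieszLin_mul_eq_zero (hW k w hw).2.1 h1 h2 (h w hw)

lemma mem_evNull_of_neg_mul_self_mem {f : MvPolynomial σ ℝ} (h : -(f * f) ∈ evPos W) :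
    f ∈ evNull W := by
  refine mem_evNull_of_eventually_nonpos hW ?_
  filter_upwards [h 1] with k hk w hw
  have := hk w hw
  rwa [one_mul, one_mul, map_neg, neg_nonneg] at this

lemma isRadical_evNull : (evNull W).IsRadical := by
  rw [Ideal.isRadical_iff_pow_one_lt 2 one_lt_two]
  intro f hf
  rw [pow_two] at hf
  exact mem_evNull_of_neg_mul_self_mem hW (evNull_subset_evPos ((evNull W).neg_mem hf))

lemma phi_mem_evNull (i : ι) : φ i ∈ evNull W := fun r => by
  filter_upwards [eventually_ge_atTop (r.totalDegree + ((φ i).totalDegree + 1) / 2)] with k hk w hw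
  exact (hW k w hw).rieszLin_eq_zero i (Nat.le_sub_of_add_le hk)

lemma psi_mem_evPos (j : κ) : ψ j ∈ evPos W := fun r => by
  filter_upwards [eventually_ge_atTop (r.totalDegree + ((ψ j).totalDegree + 1) / 2)] with k hk w hw
  exact (hW k w hw).rieszLin_nonneg j (Nat.le_sub_of_add_le hk)

lemma mem_evPos_of_inIQ [Fintype ι] [Fintype κ] {f : MvPolynomial σ ℝ} (hf : InIQ φ ψ f) :
    f ∈ evPos W := by
  have hQ := isQuadModule_evPos hW
  have hsos : ∀ s q : MvPolynomial σ ℝ, IsSOS s → q ∈ evPos W → q * s ∈ evPos W := by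
    rintro s q ⟨t, b, rfl⟩ hq
    rw [Finset.mul_sum]
    refine hQ.sum_mem _ _ fun i _ => ?_
    rw [pow_two, mul_comm]
    exact hQ.mul_self_mul_mem _ hq
  obtain ⟨p, s0, s, hs0, hs, rfl⟩ := hf
  refine hQ.add_mem (hQ.add_mem ?_ ?_) (hQ.sum_mem _ _ fun j _ => hsos _ _ (hs j) ?_)
  · exact evNull_subset_evPos (Ideal.sum_mem _ fun i _ =>
      Ideal.mul_mem_right _ _ (phi_mem_evNull hW i))
  · simpa using hsos _ _ hs0 hQ.one_mem
  · exact psi_mem_evPos hW j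

/-- Strict positivity on the feasible set implies eventual nonnegativity. -/
lemma mem_evPos_of_forall_pos [Fintype ι] [Fintype κ] (harch : IsArchimedean φ ψ)
    {f : MvPolynomial σ ℝ}
    (hf : ∀ z, (∀ i, eval z (φ i) = 0) → (∀ j, 0 ≤ eval z (ψ j)) →
      (∀ q ∈ evNull W, eval z q = 0) → 0 < eval z f) : f ∈ evPos W := by
  have hQ := isQuadModule_evPos hW
  obtain ⟨s0, hs0, hc⟩ := harch
  obtain ⟨N, hN⟩ := hQ.exists_C_sub_sum_mem (mem_evPos_of_inIQ hW hs0) hc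
  refine hQ.mem_of_forall_pos hN fun z hz => ?_
  have h0 : ∀ q ∈ evNull W, eval z q = 0 := fun q hq => by
    have h1 := hz q (evNull_subset_evPos hq)
    have h2 := hz (-q) (evNull_subset_evPos ((evNull W).neg_mem hq))
    rw [map_neg] at h2
    linarith
  exact hf z (fun i => h0 _ (phi_mem_evNull hW i)) (fun j => hz _ (psi_mem_evPos hW j)) h0

end Eventual

section CriticalRoots

variable {σ : Type} {Q : Set (MvPolynomial σ ℝ)} {N : Ideal (MvPolynomial σ ℝ)}
  (hQ : IsQuadModule Q) (hNQ : ∀ f ∈ N, f ∈ Q) (hreal : ∀ f, -(f * f) ∈ Q → f ∈ N)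
  {F : MvPolynomial σ ℝ} {c : ℝ} (hc : ∀ ε : ℝ, 0 < ε → F - C c + C ε ∈ Q)
include hQ hNQ hreal hc

lemma exists_prod_sub_mul_mem (m : Polynomial ℝ) (hm : m ≠ 0) (e : MvPolynomial σ ℝ)
    (hme : Polynomial.aeval F m * e ∈ N) :
    ∃ S : Finset ℝ, (∀ v ∈ S, c ≤ v) ∧ (∏ v ∈ S, (F - C v)) * e ∈ N := by
  classical
  induction hd : m.natDegree using Nat.strong_induction_on generalizing m e with
  | _ d ih =>
  subst hd
  by_cases h0 : m.degree = 0
  · refine ⟨∅, by simp, ?_⟩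
    rw [Polynomial.eq_C_of_degree_eq_zero h0, Polynomial.aeval_C, algebraMap_eq] at hme
    have hne : m.coeff 0 ≠ 0 := fun h => hm (by
      rw [Polynomial.eq_C_of_degree_eq_zero h0, h, map_zero])
    have := N.mul_mem_left (C (m.coeff 0)⁻¹) hme
    rw [← mul_assoc, ← C_mul, inv_mul_cancel₀ hne, C_1] at this
    simpa using this
  obtain ⟨z, hz⟩ := IsAlgClosed.exists_aeval_eq_zero ℂ m h0
  by_cases him : z.im = 0
  · have hz' : m.eval z.re = 0 := by
      have e1 : z = ((z.re : ℝ) : ℂ) := Complex.ext rfl (by simp [him])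
      rw [e1] at hz
      have := Polynomial.aeval_algebraMap_apply_eq_algebraMap_eval (A := ℂ) z.re m
      rw [show (algebraMap ℝ ℂ) z.re = (z.re : ℂ) from rfl, hz] at this
      exact (algebraMap ℝ ℂ).injective (this.symm.trans (map_zero _).symm)
    obtain ⟨m', rfl⟩ := Polynomial.dvd_iff_isRoot.2 hz'
    have hm' : m' ≠ 0 := right_ne_zero_of_mul hm
    have hdeg : m'.natDegree < ((Polynomial.X - Polynomial.C z.re) * m').natDegree := by
      rw [Polynomial.natDegree_mul (Polynomial.X_sub_C_ne_zero _) hm',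
        Polynomial.natDegree_X_sub_C]
      omega
    simp only [map_mul, map_sub, Polynomial.aeval_X, Polynomial.aeval_C, algebraMap_eq] at hme
    by_cases hcz : c ≤ z.re
    · obtain ⟨S, hS, hSN⟩ := ih _ hdeg m' hm' ((F - C z.re) * e)
        (by convert hme using 1; ring) rfl
      by_cases hzS : z.re ∈ S
      · refine ⟨S, hS, hreal _ (hNQ _ (N.neg_mem ?_))⟩
        rw [← Finset.mul_prod_erase S _ hzS] at hSN ⊢
        convert N.mul_mem_left ((∏ v ∈ S.erase z.re, (F - C v)) * e) hSN using 1
        ring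
      · refine ⟨insert z.re S, ?_, ?_⟩
        · simp only [Finset.mem_insert, forall_eq_or_imp]
          exact ⟨hcz, hS⟩
        · rw [Finset.prod_insert hzS]
          convert hSN using 1
          ring
    · refine ih _ hdeg m' hm' e (hreal _ ?_) rfl
      set f := Polynomial.aeval F m' * e
      refine hQ.mem_of_C_mul_mem (r := (c - z.re) / 2) (by linarith) ?_
      have h1 := hQ.mul_self_mul_mem f (hc ((c - z.re) / 2) (by linarith))
      have h2 := hNQ _ (N.neg_mem (N.mul_mem_left f hme))
      convert hQ.add_mem h1 h2 using 1
      have : (C c : MvPolynomial σ ℝ) = C z.re + 2 * C ((c - z.re) / 2) := by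
        rw [← map_ofNat C 2, ← C_mul, ← C_add]; congr 1; ring
      rw [this]
      simp only [f]
      ring
  · obtain ⟨m', rfl⟩ := m.quadratic_dvd_of_aeval_eq_zero_im_ne_zero hz him
    have hm' : m' ≠ 0 := right_ne_zero_of_mul hm
    have hq : (Polynomial.X ^ 2 - Polynomial.C (2 * z.re) * Polynomial.X +
        Polynomial.C (‖z‖ ^ 2)).natDegree = 2 := by compute_degree!
    have hdeg : m'.natDegree < ((Polynomial.X ^ 2 - Polynomial.C (2 * z.re) * Polynomial.X +
        Polynomial.C (‖z‖ ^ 2)) * m').natDegree := by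
      rw [Polynomial.natDegree_mul (left_ne_zero_of_mul hm) hm', hq]
      omega
    refine ih _ hdeg m' hm' e (hreal _ ?_) rfl
    simp only [map_mul, map_sub, map_add, map_pow, Polynomial.aeval_X, Polynomial.aeval_C,
      algebraMap_eq] at hme
    set f := Polynomial.aeval F m' * e
    refine hQ.mem_of_C_mul_mem (r := z.im * z.im) (mul_self_pos.2 him) ?_
    have h1 := hQ.mul_self_mem ((F - C z.re) * f)
    have h2 := hNQ _ (N.neg_mem (N.mul_mem_left f hme))
    convert hQ.add_mem h1 h2 using 1
    have : (C ‖z‖ ^ 2 : MvPolynomial σ ℝ) = C z.re * C z.re + C z.im * C z.im := by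
      rw [← C_pow, Complex.sq_norm, Complex.normSq_apply, C_add, C_mul, C_mul]
    rw [this]
    simp only [f, C_mul]
    rw [show (C 2 : MvPolynomial σ ℝ) = 2 from map_ofNat C 2]
    ring

/-- If `F` takes finitely many values modulo `N` and is bounded below by `c` in the limit, then
`F - c` is a square modulo `N`. -/
lemma exists_sub_sq_mem {m : Polynomial ℝ} (hm : m ≠ 0) (hmN : Polynomial.aeval F m ∈ N) :
    ∃ r : MvPolynomial σ ℝ, F - C c - r * r ∈ N := by
  classical
  obtain ⟨S, hS, hSN⟩ := exists_prod_sub_mul_mem hQ hNQ hreal hc m hm 1 (by simpa using hmN)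
  set r := Lagrange.interpolate S id fun v => √(v - c)
  have hr : ∏ v ∈ S, (Polynomial.X - Polynomial.C v) ∣ Polynomial.X - Polynomial.C c - r * r := by
    refine Finset.prod_dvd_of_coprime
      (fun a _ b _ hab => Polynomial.pairwise_coprime_X_sub_C Function.injective_id hab)
      fun v hv => Polynomial.dvd_iff_isRoot.2 ?_
    have := Lagrange.eval_interpolate_at_node (fun v => √(v - c))
      (Function.injective_id.injOn (s := (S : Set ℝ))) hv
    simp only [id] at this
    simp only [Polynomial.IsRoot, Polynomial.eval_sub, Polynomial.eval_X, Polynomial.eval_C,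
      Polynomial.eval_mul, r]
    rw [this, Real.mul_self_sqrt (sub_nonneg.2 (hS v hv)), sub_self]
  obtain ⟨u, hu⟩ := hr
  refine ⟨Polynomial.aeval F r, ?_⟩
  have := congrArg (Polynomial.aeval F) hu
  simp only [map_mul, map_sub, map_prod, Polynomial.aeval_X, Polynomial.aeval_C,
    algebraMap_eq] at this
  rw [this]
  exact N.mul_mem_right _ (by simpa using hSN)

end CriticalRoots

section Flat

variable {σ : Type}

/-- Any monomial of degree `|T|` is the leading form of a product of coordinate functions centred
at the points of `T`. -/
lemma exists_prod_X_sub_C_eq [Nonempty σ] (T : Finset (σ → ℝ)) (α : σ →₀ ℕ)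
    (hα : α.degree = T.card) : ∃ (x : (σ → ℝ) → σ) (r : MvPolynomial σ ℝ),
      ∏ s ∈ T, (X (x s) - C (s (x s))) = monomial α 1 + r ∧ ∀ β ∈ r.support, β.degree < T.card := by
  classical
  induction T using Finset.induction_on generalizing α with
  | empty =>
    rw [Finset.card_empty, Finsupp.degree_eq_zero_iff] at hα
    exact ⟨fun _ => Classical.arbitrary σ, 0, by simp [hα], by simp⟩
  | insert s T hs ih =>
    rw [Finset.card_insert_of_notMem hs] at hα
    have hne : α ≠ 0 := by
      rintro rfl
      simp at hα
    obtain ⟨i, hi⟩ := Finsupp.ne_iff.1 hne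
    have hle : Finsupp.single i 1 ≤ α := by
      rw [Finsupp.single_le_iff]
      exact Nat.one_le_iff_ne_zero.2 hi
    obtain ⟨β, rfl⟩ := exists_add_of_le hle
    rw [map_add, Finsupp.degree_single, add_comm, Nat.add_right_cancel_iff] at hα
    obtain ⟨x, r, hx, hr⟩ := ih β hα
    refine ⟨Function.update x s i, X i * r - C (s i) * (monomial β 1 + r), ?_, ?_⟩
    · rw [Finset.prod_insert hs, Function.update_self, Finset.prod_congr rfl fun t ht => by
        rw [Function.update_of_ne (ne_of_mem_of_not_mem ht hs)], hx,
        show monomial (Finsupp.single i 1 + β) (1 : ℝ) = X i * monomial β 1 by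
          rw [X, monomial_mul, one_mul]]
      ring
    · intro γ hγ
      rw [Finset.card_insert_of_notMem hs, Nat.lt_succ_iff]
      rcases Finset.mem_union.1 (support_sub _ _ _ hγ) with h | h
      · rw [support_X_mul, Finset.mem_map] at h
        obtain ⟨δ, hδ, rfl⟩ := h
        have := hr δ hδ
        simp only [addLeftEmbedding_apply, map_add, Finsupp.degree_single]
        omega
      · have h1 : γ ∈ (monomial β (1 : ℝ) + r).support := by
          rw [mem_support_iff, coeff_C_mul] at h
          exact mem_support_iff.2 (right_ne_zero_of_mul h)
        rcases Finset.mem_union.1 (support_add h1) with h2 | h2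
        · have := Finset.mem_singleton.1 (support_monomial_subset h2)
          rw [this, hα]
        · exact (hr γ h2).le

lemma prod_X_sub_C_mem [Fintype σ] {Q : Set (MvPolynomial σ ℝ)} {N : Ideal (MvPolynomial σ ℝ)}
    (hQ : IsQuadModule Q) (hNQ : ∀ f ∈ N, f ∈ Q) (hreal : ∀ f, -(f * f) ∈ Q → f ∈ N)
    {S : Finset (σ → ℝ)} (h : ∏ s ∈ S, ∑ i, (X i - C (s i)) ^ 2 ∈ N) (x : (σ → ℝ) → σ) :
    ∏ s ∈ S, (X (x s) - C (s (x s))) ∈ N := by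
  classical
  refine hreal _ ?_
  rw [← Finset.prod_coe_sort, Finset.prod_univ_sum,
    ← Finset.add_sum_erase _ _ (Fintype.mem_piFinset.2 fun s : S => Finset.mem_univ (x s))] at h
  have h1 := hNQ _ (N.neg_mem h)
  have h2 : ∑ y ∈ (Fintype.piFinset fun _ : S => (Finset.univ : Finset σ)).erase fun s => x s,
      ∏ s : S, (X (y s) - C (s.1 (y s)) : MvPolynomial σ ℝ) ^ 2 ∈ Q := by
    refine hQ.sum_mem _ _ fun y _ => ?_
    rw [Finset.prod_pow, pow_two]
    exact hQ.mul_self_mem _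
  convert hQ.add_mem h1 h2 using 1
  rw [Finset.prod_pow, ← Finset.prod_coe_sort S]
  ring

/-- If an ideal contains polynomials with every leading monomial of degree `s + 1`, then every
polynomial is congruent to one of degree at most `s`. -/
lemma exists_totalDegree_le_sub_mem {N : Ideal (MvPolynomial σ ℝ)} {s : ℕ}
    (h : ∀ α : σ →₀ ℕ, α.degree = s + 1 → ∃ r : MvPolynomial σ ℝ, monomial α 1 + r ∈ N ∧
      ∀ β ∈ r.support, β.degree < s + 1) (f : MvPolynomial σ ℝ) :
    ∃ c : MvPolynomial σ ℝ, c.totalDegree ≤ s ∧ f - c ∈ N := by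
  classical
  have hlin : ∀ f : MvPolynomial σ ℝ, (∀ α ∈ f.support, ∃ c : MvPolynomial σ ℝ,
      c.totalDegree ≤ s ∧ monomial α 1 - c ∈ N) →
      ∃ c : MvPolynomial σ ℝ, c.totalDegree ≤ s ∧ f - c ∈ N := by
    intro f hf
    choose! c hc hcN using hf
    refine ⟨∑ α ∈ f.support, coeff α f • c α, ?_, ?_⟩
    · exact totalDegree_finsetSum_le fun α hα => (totalDegree_smul_le _ _).trans (hc α hα)
    · conv =>
        enter [2, 1]
        rw [f.as_sum]
      rw [← Finset.sum_sub_distrib]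
      refine N.sum_mem fun α hα => ?_
      have := N.mul_mem_left (C (coeff α f)) (hcN α hα)
      rwa [mul_sub, C_mul_monomial, mul_one, ← smul_eq_C_mul] at this
  suffices key : ∀ α : σ →₀ ℕ, ∃ c : MvPolynomial σ ℝ,
      c.totalDegree ≤ s ∧ monomial α 1 - c ∈ N from hlin f fun α _ => key α
  intro α
  induction hd : α.degree using Nat.strong_induction_on generalizing α with
  | _ d ih =>
  subst hd
  rcases Nat.lt_or_ge s α.degree with hα | hα
  · obtain ⟨β, hβα, hβ⟩ := Finsupp.exists_le_degree_eq α (s + 1) hα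
    obtain ⟨γ, rfl⟩ := exists_add_of_le hβα
    obtain ⟨r, hr, hrd⟩ := h β hβ
    obtain ⟨c, hc, hcN⟩ := hlin (-(r * monomial γ 1)) fun δ hδ => by
      refine ih _ ?_ δ rfl
      rw [support_neg] at hδ
      obtain ⟨a, ha, b, hb, rfl⟩ := Finset.mem_add.1 (support_mul _ _ hδ)
      rw [Finset.mem_singleton.1 (support_monomial_subset hb), map_add, map_add, hβ]
      exact Nat.add_lt_add_right (hrd a ha) _
    refine ⟨c, hc, ?_⟩
    convert N.add_mem (N.mul_mem_right (monomial γ 1) hr) hcN using 1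
    rw [add_mul, monomial_mul, mul_one]
    ring
  · exact ⟨monomial α 1, (totalDegree_monomial_le _ _).trans hα, by simp⟩

variable [Fintype σ] [DecidableEq σ]

lemma rank_of_rieszLin_le {t : ℕ} (w : (σ →₀ ℕ) → ℝ) {ι : Type} [Fintype ι]
    (f : ι → MvPolynomial σ ℝ) (hf : ∀ i, (f i).totalDegree ≤ t) :
    (Matrix.of fun i j => rieszLin w (f i * f j)).rank ≤ (momMat t w).rank := by
  have : (Matrix.of fun i j => rieszLin w (f i * f j)) =
      (Matrix.of fun i (u : MomIdx σ t) => coeff u.exp (f i)) *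
        (momMat t w * (Matrix.of fun i (u : MomIdx σ t) => coeff u.exp (f i)).transpose) := by
    ext i j
    rw [Matrix.of_apply, rieszLin_mul_eq w (hf i) (hf j)]
    simp [Matrix.mul_apply, Finset.mul_sum, mul_assoc]
  rw [this]
  exact (Matrix.rank_mul_le_right _ _).trans (Matrix.rank_mul_le_left _ _)

lemma rank_momMat_eq {s t : ℕ} (hst : s ≤ t) (w : (σ →₀ ℕ) → ℝ)
    (c : MomIdx σ t → MvPolynomial σ ℝ) (hc : ∀ u, (c u).totalDegree ≤ s)
    (h : ∀ u v : MomIdx σ t, rieszLin w ((monomial u.exp 1 - c u) * monomial v.exp 1) = 0)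
    (h' : ∀ u v : MomIdx σ t, rieszLin w ((monomial u.exp 1 - c u) * c v) = 0) :
    (momMat t w).rank = (momMat s w).rank := by
  have hM : ∀ p, momMat p w = Matrix.of fun u v : MomIdx σ p =>
      rieszLin w (monomial u.exp 1 * monomial v.exp 1) := fun p => by
    ext u v
    rw [Matrix.of_apply, monomial_mul, rieszLin_monomial, mul_one, one_mul, momMat, Matrix.of_apply]
  have hdeg : ∀ p (u : MomIdx σ p), (monomial u.exp (1 : ℝ)).totalDegree ≤ p := fun p u =>
    (totalDegree_monomial_le _ _).trans u.degree_exp_le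
  refine le_antisymm ?_ ?_
  · have : momMat t w = Matrix.of fun u v : MomIdx σ t => rieszLin w (c u * c v) := by
      rw [hM]
      ext u v
      have h1 := h u v
      have h2 := h' v u
      rw [sub_mul, map_sub, sub_eq_zero] at h1 h2
      rw [Matrix.of_apply, Matrix.of_apply, h1, mul_comm, h2, mul_comm]
    rw [this]
    exact rank_of_rieszLin_le w c hc
  · rw [hM s]
    exact rank_of_rieszLin_le w _ fun u => (hdeg s u).trans hst

end Flat

section FiniteConvergence

open Filter

variable {σ ι κ : Type} [Fintype σ] [DecidableEq σ] [Fintype ι] [Fintype κ]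
  {φ : ι → MvPolynomial σ ℝ} {ψ : κ → MvPolynomial σ ℝ}

omit [Fintype σ] [DecidableEq σ] in
lemma eval_nonneg_of_inIQ {f : MvPolynomial σ ℝ} (hf : InIQ φ ψ f) {z : σ → ℝ}
    (hφ : ∀ i, eval z (φ i) = 0) (hψ : ∀ j, 0 ≤ eval z (ψ j)) : 0 ≤ eval z f := by
  have hsos : ∀ s : MvPolynomial σ ℝ, IsSOS s → 0 ≤ eval z s := by
    rintro s ⟨t, b, rfl⟩
    rw [map_sum]
    exact Finset.sum_nonneg fun i _ => by rw [map_pow]; exact sq_nonneg _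
  obtain ⟨p, s0, s, hs0, hs, rfl⟩ := hf
  simp only [map_add, map_sum, map_mul, hφ, zero_mul, Finset.sum_const_zero, zero_add]
  exact add_nonneg (hsos _ hs0) (Finset.sum_nonneg fun j _ => mul_nonneg (hψ j) (hsos _ (hs j)))

lemma exists_minimizer (harch : IsArchimedean φ ψ) (F : MvPolynomial σ ℝ)
    (hfeas : {z : σ → ℝ | (∀ i, eval z (φ i) = 0) ∧ ∀ j, 0 ≤ eval z (ψ j)}.Nonempty) :
    ∃ z0 : σ → ℝ, ((∀ i, eval z0 (φ i) = 0) ∧ ∀ j, 0 ≤ eval z0 (ψ j)) ∧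
      ∀ z, ((∀ i, eval z (φ i) = 0) ∧ ∀ j, 0 ≤ eval z (ψ j)) → eval z0 F ≤ eval z F := by
  obtain ⟨s0, hs0, hc⟩ := harch
  have hcl : IsClosed {z : σ → ℝ | (∀ i, eval z (φ i) = 0) ∧ ∀ j, 0 ≤ eval z (ψ j)} := by
    have : {z : σ → ℝ | (∀ i, eval z (φ i) = 0) ∧ ∀ j, 0 ≤ eval z (ψ j)} =
        (⋂ i, {z | eval z (φ i) = 0}) ∩ ⋂ j, {z | 0 ≤ eval z (ψ j)} := by
      ext z
      simp
    rw [this]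
    exact (isClosed_iInter fun i => isClosed_eq (continuous_eval _) continuous_const).inter
      (isClosed_iInter fun j => isClosed_le continuous_const (continuous_eval _))
  obtain ⟨z0, hz0, hmin⟩ := (hc.of_isClosed_subset hcl
    fun z hz => eval_nonneg_of_inIQ hs0 hz.1 hz.2).exists_isMinOn hfeas
    (continuous_eval F).continuousOn
  exact ⟨z0, hz0, fun z hz => hmin hz⟩

variable {F : MvPolynomial σ ℝ}

/-- Along a sequence of sets of feasible points of the relaxations, `F` minus its minimal value
is eventually a square. -/
lemma exists_sub_sq_mem_evNull {W : ℕ → Set ((σ →₀ ℕ) → ℝ)}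
    (hW : ∀ k, ∀ w ∈ W k, RelaxFeasible k φ ψ w) (harch : IsArchimedean φ ψ) {m : Polynomial ℝ}
    (hm : m ≠ 0) (hmF : Polynomial.aeval F m ∈ (Ideal.span (Set.range φ)).radical) {c : ℝ}
    (hc : ∀ z, ((∀ i, eval z (φ i) = 0) ∧ ∀ j, 0 ≤ eval z (ψ j)) → c ≤ eval z F) :
    ∃ r, F - C c - r * r ∈ evNull W := by
  refine exists_sub_sq_mem (isQuadModule_evPos hW) (fun _ => evNull_subset_evPos)
    (fun _ => mem_evNull_of_neg_mul_self_mem hW) (fun ε hε => ?_) hm ?_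
  · refine mem_evPos_of_forall_pos hW harch fun z h1 h2 _ => ?_
    rw [map_add, map_sub, eval_C, eval_C]
    linarith [hc z ⟨h1, h2⟩]
  · refine (isRadical_evNull hW).radical_le_iff.2 (Ideal.span_le.2 ?_) hmF
    rintro _ ⟨i, rfl⟩
    exact phi_mem_evNull hW i

lemma eventually_le_riesz (harch : IsArchimedean φ ψ) {m : Polynomial ℝ}
    (hm : m ≠ 0) (hmF : Polynomial.aeval F m ∈ (Ideal.span (Set.range φ)).radical) {c : ℝ}
    (hc : ∀ z, ((∀ i, eval z (φ i) = 0) ∧ ∀ j, 0 ≤ eval z (ψ j)) → c ≤ eval z F) :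
    ∀ᶠ k in atTop, ∀ w, RelaxFeasible k φ ψ w → c ≤ riesz w F := by
  obtain ⟨r, hr⟩ := exists_sub_sq_mem_evNull
    (W := fun k => {w | RelaxFeasible k φ ψ w}) (fun _ _ h => h) harch hm hmF hc
  filter_upwards [hr 1, eventually_ge_atTop r.totalDegree] with k h1 h2 w hw
  have h3 := h1 w hw
  have h4 := rieszLin_mul_self_nonneg hw.2.1 h2
  rw [mul_one, map_sub, map_sub, rieszLin_C, hw.1, rieszLin_apply w F] at h3
  linarith

/-- The minimizers of the moment relaxations eventually annihilate the product of the squared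
distances to the minimizers of `F`. -/
lemma prod_sum_sq_mem_evNull (harch : IsArchimedean φ ψ) {m : Polynomial ℝ}
    (hm : m ≠ 0) (hmF : Polynomial.aeval F m ∈ (Ideal.span (Set.range φ)).radical) {c : ℝ}
    (hc : ∀ z, ((∀ i, eval z (φ i) = 0) ∧ ∀ j, 0 ≤ eval z (ψ j)) → c ≤ eval z F)
    (S : Finset (σ → ℝ))
    (hS : ∀ z, ((∀ i, eval z (φ i) = 0) ∧ ∀ j, 0 ≤ eval z (ψ j)) → eval z F = c → z ∈ S)
    (hiso : ∀ s ∈ S, ∃ U : Set (σ → ℝ), IsOpen U ∧ s ∈ U ∧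
      U ∩ {z | ∀ i, eval z (φ i) = 0} = {s}) :
    ∏ s ∈ S, ∑ i, (X i - C (s i)) ^ 2 ∈
      evNull fun k => {w | RelaxFeasible k φ ψ w ∧ riesz w F ≤ c} := by
  set W : ℕ → Set ((σ →₀ ℕ) → ℝ) := fun k => {w | RelaxFeasible k φ ψ w ∧ riesz w F ≤ c}
  have hW : ∀ k, ∀ w ∈ W k, RelaxFeasible k φ ψ w := fun _ _ h => h.1
  obtain ⟨r, hr⟩ := exists_sub_sq_mem_evNull hW harch hm hmF hc
  have hrN : r ∈ evNull W := by
    refine mem_evNull_of_eventually_nonpos hW ?_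
    filter_upwards [hr 1] with k h1 w hw
    have h3 := h1 w hw
    rw [mul_one, map_sub, map_sub, rieszLin_C, hw.1.1, rieszLin_apply w F] at h3
    linarith [hw.2]
  have hFN : F - C c ∈ evNull W := by
    have := (evNull W).add_mem hr ((evNull W).mul_mem_left r hrN)
    rwa [sub_add_cancel] at this
  obtain ⟨ε, hε, h⟩ := exists_neg_pow_mem_of_isolated φ S hiso
  obtain ⟨l, hl⟩ := h (evPos W) (evNull W) (isQuadModule_evPos hW)
    (fun _ => evNull_subset_evPos) (phi_mem_evNull hW) <| by
      refine mem_evPos_of_forall_pos hW harch fun z h1 h2 h3 => ?_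
      have h4 := h3 _ hFN
      rw [map_sub, eval_C, sub_eq_zero] at h4
      have h5 : eval z (∏ s ∈ S, ∑ i, (X i - C (s i)) ^ 2 : MvPolynomial σ ℝ) = 0 := by
        rw [map_prod]
        exact Finset.prod_eq_zero (hS z ⟨h1, h2⟩ h4) (by simp)
      rwa [map_sub, eval_C, h5, sub_zero]
  rw [mul_comm, pow_mul, pow_two] at hl
  exact isRadical_evNull hW ⟨l, mem_evNull_of_neg_mul_self_mem hW hl⟩

/-- Finite convergence with flat truncation for polynomial optimization problems with finitely
many critical values whose minimizers are isolated zeros of the equality constraints. -/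
theorem exists_forall_flat_truncation (harch : IsArchimedean φ ψ)
    (hfeas : {z : σ → ℝ | (∀ i, eval z (φ i) = 0) ∧ ∀ j, 0 ≤ eval z (ψ j)}.Nonempty)
    (hfin : {z : σ → ℝ | ((∀ i, eval z (φ i) = 0) ∧ ∀ j, 0 ≤ eval z (ψ j)) ∧
      ∀ z' : σ → ℝ, ((∀ i, eval z' (φ i) = 0) ∧ ∀ j, 0 ≤ eval z' (ψ j)) →
        eval z F ≤ eval z' F}.Finite)
    (hiso : ∀ z0 : σ → ℝ, ((∀ i, eval z0 (φ i) = 0) ∧ ∀ j, 0 ≤ eval z0 (ψ j)) →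
      (∀ z' : σ → ℝ, ((∀ i, eval z' (φ i) = 0) ∧ ∀ j, 0 ≤ eval z' (ψ j)) →
        eval z0 F ≤ eval z' F) →
      ∃ U : Set (σ → ℝ), IsOpen U ∧ z0 ∈ U ∧ U ∩ {z | ∀ i, eval z (φ i) = 0} = {z0})
    {m : Polynomial ℝ} (hm : m ≠ 0)
    (hmF : Polynomial.aeval F m ∈ (Ideal.span (Set.range φ)).radical) (d : ℕ) :
    ∃ k0 : ℕ, ∀ k ≥ k0,
      (∃ w : (σ →₀ ℕ) → ℝ, RelaxFeasible k φ ψ w ∧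
        ∀ w' : (σ →₀ ℕ) → ℝ, RelaxFeasible k φ ψ w' → riesz w F ≤ riesz w' F) ∧
      ∀ w : (σ →₀ ℕ) → ℝ, RelaxFeasible k φ ψ w →
        (∀ w' : (σ →₀ ℕ) → ℝ, RelaxFeasible k φ ψ w' → riesz w F ≤ riesz w' F) →
        ∃ t : ℕ, d ≤ t ∧ t ≤ k ∧ (momMat t w).rank = (momMat (t - d) w).rank := by
  obtain ⟨z0, hz0, hmin⟩ := exists_minimizer harch F hfeas
  set S := hfin.toFinset
  have hz0S : z0 ∈ S := hfin.mem_toFinset.2 ⟨hz0, hmin⟩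
  obtain ⟨s, hs⟩ : ∃ s, S.card = s + 1 :=
    ⟨S.card - 1, (Nat.succ_pred_eq_of_pos (Finset.card_pos.2 ⟨z0, hz0S⟩)).symm⟩
  have hp := prod_sum_sq_mem_evNull harch hm hmF hmin S
    (fun z hz h => hfin.mem_toFinset.2 ⟨hz, h ▸ hmin⟩)
    (fun z hz => by
      have := hfin.mem_toFinset.1 hz
      exact hiso z this.1 this.2)
  set W : ℕ → Set ((σ →₀ ℕ) → ℝ) := fun k => {w | RelaxFeasible k φ ψ w ∧ riesz w F ≤ eval z0 F}
  have hW : ∀ k, ∀ w ∈ W k, RelaxFeasible k φ ψ w := fun _ _ h => h.1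
  have hlead : ∀ α : σ →₀ ℕ, α.degree = s + 1 → ∃ r : MvPolynomial σ ℝ,
      monomial α 1 + r ∈ evNull W ∧ ∀ β ∈ r.support, β.degree < s + 1 := by
    intro α hα
    have : Nonempty σ := by
      by_contra hne
      rw [not_nonempty_iff] at hne
      rw [Subsingleton.elim α 0, map_zero] at hα
      exact absurd hα (Nat.succ_ne_zero s).symm
    obtain ⟨x, r, hx, hr⟩ := exists_prod_X_sub_C_eq S α (hα.trans hs.symm)
    refine ⟨r, hx ▸ ?_, hs ▸ hr⟩
    exact prod_X_sub_C_mem (isQuadModule_evPos hW) (fun _ => evNull_subset_evPos)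
      (fun _ => mem_evNull_of_neg_mul_self_mem hW) hp x
  choose c hcd hcN using exists_totalDegree_le_sub_mem hlead
  have h1 : ∀ᶠ k in atTop, ∀ u v : MomIdx σ (s + d), ∀ w ∈ W k,
      rieszLin w ((monomial u.exp 1 - c (monomial u.exp 1)) * monomial v.exp 1) = 0 :=
    eventually_all.2 fun u => eventually_all.2 fun v => hcN _ _
  have h2 : ∀ᶠ k in atTop, ∀ u v : MomIdx σ (s + d), ∀ w ∈ W k,
      rieszLin w ((monomial u.exp 1 - c (monomial u.exp 1)) * c (monomial v.exp 1)) = 0 :=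
    eventually_all.2 fun u => eventually_all.2 fun v => hcN _ _
  rw [← eventually_atTop]
  filter_upwards [h1, h2, eventually_le_riesz harch hm hmF hmin, eventually_ge_atTop (s + d)]
    with k h1 h2 h3 h4
  have hδ : RelaxFeasible k φ ψ fun α => ∏ i, z0 i ^ α i := relaxFeasible_eval k hz0.1 hz0.2
  have hδF : riesz (fun α => ∏ i, z0 i ^ α i) F = eval z0 F := rieszLin_eval z0 F
  refine ⟨⟨_, hδ, fun w' hw' => hδF ▸ h3 w' hw'⟩, fun w hw hmw => ?_⟩
  have hwW : w ∈ W k := ⟨hw, hδF ▸ hmw _ hδ⟩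
  refine ⟨s + d, Nat.le_add_left _ _, h4, ?_⟩
  rw [Nat.add_sub_cancel]
  exact rank_momMat_eq (Nat.le_add_right _ _) w (fun u => c (monomial u.exp 1))
    (fun u => hcd _) (fun u v => h1 u v w hwW) fun u v => h2 u v w hwW

end FiniteConvergence

section CriticalPointReformulation

/-- The objective takes finitely many values on the zero set of the critical point equations. -/
lemma exists_aeval_mem_radical_span_phiTop {n m l1 l2 : ℕ}
    (E1X E2X : Finset (Fin l1)) (hXu : E1X ∪ E2X = Finset.univ)
    (E1Y E2Y : Finset (Fin l2)) (hYu : E1Y ∪ E2Y = Finset.univ)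
    (g : Fin l1 → MvPolynomial (Fin n) ℝ) (h : Fin l2 → MvPolynomial (Fin m) ℝ)
    (G1 : Matrix (Fin l1) (Fin n ⊕ Fin l1) (MvPolynomial (Fin n) ℝ))
    (H1 : Matrix (Fin l2) (Fin m ⊕ Fin l2) (MvPolynomial (Fin m) ℝ))
    (F : MvPolynomial (Fin n ⊕ Fin m) ℝ) :
    ∃ p : Polynomial ℝ, p ≠ 0 ∧ Polynomial.aeval F p ∈
      (Ideal.span (Set.range (phiTop E1X E2X E1Y E2Y g h G1 H1 F))).radical := by
  have hmem : ∀ i, phiTop E1X E2X E1Y E2Y g h G1 H1 F i ∈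
      Ideal.span (Set.range (phiTop E1X E2X E1Y E2Y g h G1 H1 F)) := fun i =>
    Ideal.subset_span ⟨i, rfl⟩
  have hl : ∀ (i : Fin n) (f : MvPolynomial (Fin m) ℝ),
      pderiv (Sum.inl i) (rename (Sum.inr : Fin m → Fin n ⊕ Fin m) f) = 0 := fun i f =>
    pderiv_eq_zero_of_notMem_vars fun hi => by
      obtain ⟨j, _, hj⟩ := Finset.mem_image.1 (vars_rename _ _ hi)
      exact Sum.inr_ne_inl hj
  have hr : ∀ (i : Fin m) (f : MvPolynomial (Fin n) ℝ),
      pderiv (Sum.inr i) (rename (Sum.inl : Fin n → Fin n ⊕ Fin m) f) = 0 := fun i f =>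
    pderiv_eq_zero_of_notMem_vars fun hi => by
      obtain ⟨j, _, hj⟩ := Finset.mem_image.1 (vars_rename _ _ hi)
      exact Sum.inl_ne_inr hj
  refine exists_aeval_mem_radical _ F (Sum.elim (lagX G1 F) (lagY H1 F))
    (Sum.elim (fun i => rename Sum.inl (g i)) fun j => rename Sum.inr (h j)) ?_ ?_
  · rintro (j | j)
    · convert hmem (.inl (.inl j)) using 1
      simp [phiTop, hl, pderiv_rename Sum.inl_injective]
    · convert hmem (.inl (.inr j)) using 1
      simp [phiTop, hr, pderiv_rename Sum.inr_injective]
  · rintro (i | i)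
    · rcases Finset.mem_union.1 (hXu ▸ Finset.mem_univ i) with hi | hi
      · exact Ideal.mul_mem_left _ _ (hmem (.inr (.inl (.inl ⟨i, hi⟩))))
      · exact hmem (.inr (.inr (.inl ⟨i, hi⟩)))
    · rcases Finset.mem_union.1 (hYu ▸ Finset.mem_univ i) with hi | hi
      · exact Ideal.mul_mem_left _ _ (hmem (.inr (.inl (.inr ⟨i, hi⟩))))
      · exact hmem (.inr (.inr (.inr ⟨i, hi⟩)))

end CriticalPointReformulation

/-- Theorem 4.3(ii): finite convergence, with flat truncation, of the Lasserre hierarchy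
for the (upper level) optimization problem `min F(x,y) s.t. φ(x,y) = 0, ψ(x,y) ≥ 0`
arising from the critical-point reformulation (4.1) of the saddle point problem. -/
theorem stmt8 {n m l1 l2 : ℕ}
    (E1X E2X : Finset (Fin l1)) (hXu : E1X ∪ E2X = Finset.univ) (hXd : Disjoint E1X E2X)
    (E1Y E2Y : Finset (Fin l2)) (hYu : E1Y ∪ E2Y = Finset.univ) (hYd : Disjoint E1Y E2Y)
    (K1 : Finset (Fin n → ℝ)) (K2 : Finset (Fin m → ℝ))
    (g : Fin l1 → MvPolynomial (Fin n) ℝ) (h : Fin l2 → MvPolynomial (Fin m) ℝ)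
    (G1 : Matrix (Fin l1) (Fin n ⊕ Fin l1) (MvPolynomial (Fin n) ℝ))
    (H1 : Matrix (Fin l2) (Fin m ⊕ Fin l2) (MvPolynomial (Fin m) ℝ))
    (hG1 : ∀ x : Fin n → ℝ, (Matrix.of fun i j => eval x (G1 i j)) * Gmat g x = 1)
    (hH1 : ∀ y : Fin m → ℝ, (Matrix.of fun i j => eval y (H1 i j)) * Gmat h y = 1)
    (F : MvPolynomial (Fin n ⊕ Fin m) ℝ)
    -- `IQ(φ, ψ)` is archimedean
    (harch : IsArchimedean (phiTop E1X E2X E1Y E2Y g h G1 H1 F)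
      (psiTop E2X E2Y K1 K2 g h G1 H1 F))
    -- the problem `min F s.t. φ = 0, ψ ≥ 0` is feasible
    (hfeas : {z : Fin n ⊕ Fin m → ℝ |
      (∀ idx, eval z (phiTop E1X E2X E1Y E2Y g h G1 H1 F idx) = 0) ∧
      ∀ idx, 0 ≤ eval z (psiTop E2X E2Y K1 K2 g h G1 H1 F idx)}.Nonempty)
    -- it has finitely many minimizers
    (hfin : {z : Fin n ⊕ Fin m → ℝ |
      ((∀ idx, eval z (phiTop E1X E2X E1Y E2Y g h G1 H1 F idx) = 0) ∧
        ∀ idx, 0 ≤ eval z (psiTop E2X E2Y K1 K2 g h G1 H1 F idx)) ∧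
      ∀ z' : Fin n ⊕ Fin m → ℝ,
        ((∀ idx, eval z' (phiTop E1X E2X E1Y E2Y g h G1 H1 F idx) = 0) ∧
          ∀ idx, 0 ≤ eval z' (psiTop E2X E2Y K1 K2 g h G1 H1 F idx)) →
        eval z F ≤ eval z' F}.Finite)
    -- each minimizer is an isolated real solution of `φ(z) = 0`
    (hiso : ∀ z0 : Fin n ⊕ Fin m → ℝ,
      ((∀ idx, eval z0 (phiTop E1X E2X E1Y E2Y g h G1 H1 F idx) = 0) ∧
        ∀ idx, 0 ≤ eval z0 (psiTop E2X E2Y K1 K2 g h G1 H1 F idx)) →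
      (∀ z' : Fin n ⊕ Fin m → ℝ,
        ((∀ idx, eval z' (phiTop E1X E2X E1Y E2Y g h G1 H1 F idx) = 0) ∧
          ∀ idx, 0 ≤ eval z' (psiTop E2X E2Y K1 K2 g h G1 H1 F idx)) →
        eval z0 F ≤ eval z' F) →
      ∃ U : Set (Fin n ⊕ Fin m → ℝ), IsOpen U ∧ z0 ∈ U ∧
        U ∩ {z | ∀ idx, eval z (phiTop E1X E2X E1Y E2Y g h G1 H1 F idx) = 0} = {z0}) :
    ∃ k0 : ℕ, ∀ k ≥ k0,
      (∃ w : ((Fin n ⊕ Fin m) →₀ ℕ) → ℝ,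
        RelaxFeasible k (phiTop E1X E2X E1Y E2Y g h G1 H1 F)
          (psiTop E2X E2Y K1 K2 g h G1 H1 F) w ∧
        ∀ w' : ((Fin n ⊕ Fin m) →₀ ℕ) → ℝ,
          RelaxFeasible k (phiTop E1X E2X E1Y E2Y g h G1 H1 F)
            (psiTop E2X E2Y K1 K2 g h G1 H1 F) w' →
          riesz w F ≤ riesz w' F) ∧
      ∀ w : ((Fin n ⊕ Fin m) →₀ ℕ) → ℝ,
        RelaxFeasible k (phiTop E1X E2X E1Y E2Y g h G1 H1 F)
          (psiTop E2X E2Y K1 K2 g h G1 H1 F) w →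
        (∀ w' : ((Fin n ⊕ Fin m) →₀ ℕ) → ℝ,
          RelaxFeasible k (phiTop E1X E2X E1Y E2Y g h G1 H1 F)
            (psiTop E2X E2Y K1 K2 g h G1 H1 F) w' →
          riesz w F ≤ riesz w' F) →
        ∃ t : ℕ, dTop E1X E2X E1Y E2Y K1 K2 g h G1 H1 F ≤ t ∧ t ≤ k ∧
          (momMat t w).rank = (momMat (t - dTop E1X E2X E1Y E2Y K1 K2 g h G1 H1 F) w).rank := by
  obtain ⟨p, hp, hpF⟩ := exists_aeval_mem_radical_span_phiTop E1X E2X hXu E1Y E2Y hYu g h G1 H1 F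
  exact exists_forall_flat_truncation harch hfeas hfin hiso hp hpF _
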